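/- Let A be a reduced commutative ring with total ring of fractions K (the localization of A at its nonzerodivisors). Assume that every prime ideal of K is maximal and that A is integrally closed in K. Let U be a multiplicative subset of A and B = U⁻¹A. If g : Y → Spec(B) is an M-morphism, then there exists an M-morphism f : X → Spec(A) such that X ×_{Spec(A)} Spec(B) is isomorphic to Y as a scheme over Spec(B). -/

import Mathlib

open AlgebraicGeometry CategoryTheory CategoryTheory.Limits

universe u

/-- The canonical map from `A` to the total ring of fractions of `A_red`. -/
noncomputable def totalFractionMap (A : Type u) [CommRing A] :
    CommRingCat.of A ⟶ CommRingCat.of (FractionRing (A ⧸ nilradical A)) :=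
  CommRingCat.ofHom ((algebraMap (A ⧸ nilradical A) (FractionRing (A ⧸ nilradical A))).comp
    (Ideal.Quotient.mk (nilradical A)))

/-- `f : X ⟶ Spec A` is an M-morphism if it is proper, of finite presentation, and its
base change to the total fraction ring of `A_red` is an isomorphism. -/
def IsMMorphism {A : Type u} [CommRing A] {X : Scheme.{u}}
    (f : X ⟶ Spec (CommRingCat.of A)) : Prop :=
  IsProper f ∧ LocallyOfFinitePresentation f ∧
    IsIso (pullback.snd f (Spec.map (totalFractionMap A)))

section
set_option linter.all false
set_option linter.style.haveILetI false
open AlgebraicGeometry CategoryTheory CategoryTheory.Limits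
namespace MM

/-- restriction of sections -/
noncomputable def rs {Y : Scheme.{u}} {U W : Y.Opens} (h : W ≤ U) : Γ(Y, U) →+* Γ(Y, W) :=
  (Y.presheaf.map (homOfLE h).op).hom

section
variable {Y : Scheme.{u}}

@[simp] lemma rs_rs {U V W : Y.Opens} (h : V ≤ U) (h' : W ≤ V) (s : Γ(Y, U)) :
    rs h' (rs h s) = rs (h'.trans h) s := by
  simp only [rs, ← RingHom.comp_apply, ← CommRingCat.hom_comp, ← Functor.map_comp]
  rfl

@[simp] lemma rs_self {U : Y.Opens} (h : U ≤ U) (s : Γ(Y, U)) : rs h s = s := by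
  have : (homOfLE h).op = 𝟙 _ := rfl
  simp only [rs, this, CategoryTheory.Functor.map_id]
  rfl

lemma basicOpen_rs {U W : Y.Opens} (h : W ≤ U) (s : Γ(Y, U)) :
    Y.basicOpen (rs h s) = W ⊓ Y.basicOpen s :=
  Y.basicOpen_res s (homOfLE h).op

lemma isUnit_rs_basicOpen {U W : Y.Opens} (s : Γ(Y, U)) (h : W ≤ U) (h' : W ≤ Y.basicOpen s) :
    IsUnit (rs h s) := by
  have := Y.toRingedSpace.isUnit_res_basicOpen s
  have h2 : IsUnit (rs (Y.basicOpen_le s) s) := this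
  have := h2.map (rs h')
  simpa using this

lemma exists_pow_mul_eq {U : Y.Opens} (hU : IsAffineOpen U) (f s t : Γ(Y, U))
    (h : rs (Y.basicOpen_le f) s = rs (Y.basicOpen_le f) t) : ∃ n, f ^ n * s = f ^ n * t := by
  have := hU.isLocalization_basicOpen f
  obtain ⟨⟨_, n, rfl⟩, hc⟩ := (IsLocalization.eq_iff_exists (Submonoid.powers f) _).mp
    (show algebraMap Γ(Y, U) Γ(Y, Y.basicOpen f) s = algebraMap _ _ t from h)
  exact ⟨n, hc⟩

lemma exists_pow_mul_eq_rs {U : Y.Opens} (hU : IsAffineOpen U) (f : Γ(Y, U))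
    (t : Γ(Y, Y.basicOpen f)) :
    ∃ n, ∃ s, rs (Y.basicOpen_le f) s = rs (Y.basicOpen_le f) f ^ n * t := by
  have := hU.isLocalization_basicOpen f
  obtain ⟨⟨s, _, n, rfl⟩, hc⟩ := IsLocalization.surj (Submonoid.powers f) t
  refine ⟨n, s, ?_⟩
  have h2 : t * rs (Y.basicOpen_le f) (f ^ n) = rs (Y.basicOpen_le f) s := hc
  rw [← h2, map_pow, mul_comm]

/-- A ring map criterion for `Spec` to be an open immersion. -/
def LocIso {R S : Type u} [CommRing R] [CommRing S] (φ : R →+* S) (h : R) : Prop :=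
  (∀ r, φ r = 0 → ∃ n, h ^ n * r = 0) ∧ (∀ s, ∃ n, ∃ r, φ r = φ h ^ n * s)

lemma LocIso.injective {R S : Type u} [CommRing R] [CommRing S] {φ : R →+* S} {h : R}
    (H : LocIso φ h) {x y : Ideal S} [x.IsPrime] [y.IsPrime] (hxy : x.comap φ = y.comap φ)
    (hx : φ h ∉ x) : x = y := by
  have key : ∀ {x y : Ideal S} [x.IsPrime] [y.IsPrime], x.comap φ = y.comap φ → φ h ∉ x → x ≤ y := by
    intro x y _ _ hxy hx s hs
    obtain ⟨n, r, hr⟩ := H.2 s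
    have h1 : r ∈ x.comap φ := by rw [Ideal.mem_comap, hr]; exact x.mul_mem_left _ hs
    rw [hxy, Ideal.mem_comap, hr] at h1
    refine (Ideal.IsPrime.mem_or_mem ‹y.IsPrime› h1).resolve_left fun h2 => hx ?_
    have h3 : h ∈ y.comap φ := Ideal.IsPrime.mem_of_pow_mem ‹y.IsPrime› _ h2
    rw [← hxy] at h3; exact h3
  refine le_antisymm (key hxy hx) (key hxy.symm fun h2 => hx ?_)
  have h3 : h ∈ y.comap φ := h2
  rw [← hxy] at h3; exact h3

lemma LocIso.isLocalization {R S : Type u} [CommRing R] [CommRing S] {φ : R →+* S} {h : R}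
    (H : LocIso φ h) :
    letI := ((algebraMap S (Localization.Away (φ h))).comp φ).toAlgebra
    IsLocalization.Away h (Localization.Away (φ h)) := by
  letI := ((algebraMap S (Localization.Away (φ h))).comp φ).toAlgebra
  have e : ∀ r : R, algebraMap R (Localization.Away (φ h)) r =
    algebraMap S (Localization.Away (φ h)) (φ r) := fun r => rfl
  refine ⟨?_, ?_, ?_⟩
  · rintro ⟨_, n, rfl⟩
    simp only [e, map_pow]
    exact (IsLocalization.Away.algebraMap_isUnit (φ h)).pow n
  · intro z
    obtain ⟨n, s, hs⟩ := IsLocalization.Away.surj (φ h) z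
    obtain ⟨m, r, hr⟩ := H.2 s
    refine ⟨⟨r, ⟨h ^ (m + n), m + n, rfl⟩⟩, ?_⟩
    simp only [e, hr, map_mul, map_pow, ← hs]
    ring
  · intro x y hxy
    simp only [e] at hxy
    obtain ⟨n, hn⟩ := (IsLocalization.Away.exists_of_eq (φ h) hxy)
    have : φ (h ^ n * (x - y)) = 0 := by simp [mul_sub, hn]
    obtain ⟨m, hm⟩ := H.1 _ this
    refine ⟨⟨h ^ (m + n), m + n, rfl⟩, ?_⟩
    rw [← sub_eq_zero]
    simp only
    rw [← hm]; ring

lemma LocIso.exists_comap {R S : Type u} [CommRing R] [CommRing S] {φ : R →+* S} {h : R}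
    (H : LocIso φ h) (p : Ideal R) [p.IsPrime] (hp : h ∉ p) :
    ∃ q : Ideal S, q.IsPrime ∧ q.comap φ = p := by
  letI := ((algebraMap S (Localization.Away (φ h))).comp φ).toAlgebra
  have := H.isLocalization
  have hd : Disjoint (Submonoid.powers h : Set R) (p : Set R) := by
    rw [Set.disjoint_left]
    rintro _ ⟨n, rfl⟩ h2
    exact hp (Ideal.IsPrime.mem_of_pow_mem ‹_› _ h2)
  have h1 := IsLocalization.isPrime_of_isPrime_disjoint (Submonoid.powers h)
    (Localization.Away (φ h)) p ‹_› hd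
  have h2 := IsLocalization.under_map_of_isPrime_disjoint (Submonoid.powers h)
    (Localization.Away (φ h)) ‹p.IsPrime› hd
  refine ⟨(p.map (algebraMap R (Localization.Away (φ h)))).comap (algebraMap S _),
    Ideal.IsPrime.comap _, ?_⟩
  rw [Ideal.comap_comap]
  exact h2

lemma isOpenImmersion_of_locIso {R S : Type u} [CommRing R] [CommRing S] (φ : R →+* S)
    (H : ∀ x : Ideal S, x.IsPrime → ∃ h, LocIso φ h ∧ φ h ∉ x) :
    IsOpenImmersion (Spec.map (CommRingCat.ofHom φ)) := by
  refine IsOpenImmersion.of_forall_source_exists _ ?_ ?_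
  · intro x y hxy
    obtain ⟨h, h1, h2⟩ := H x.asIdeal x.2
    have : x.asIdeal.comap φ = y.asIdeal.comap φ := congrArg PrimeSpectrum.asIdeal hxy
    have hx := x.2; have hy := y.2
    exact PrimeSpectrum.ext (h1.injective this h2)
  · intro x
    obtain ⟨h, h1, h2⟩ := H x.asIdeal x.2
    refine ⟨Spec (.of (Localization.Away (φ h))),
      Spec.map (CommRingCat.ofHom (algebraMap S (Localization.Away (φ h)))),
      IsOpenImmersion.of_isLocalization (φ h), ?_, ?_⟩
    · have := Scheme.Hom.opensRange_localizationAway (R := .of S) (φ h)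
      erw [this]
      exact h2
    · rw [← Spec.map_comp, ← CommRingCat.ofHom_comp]
      letI := ((algebraMap S (Localization.Away (φ h))).comp φ).toAlgebra
      have := h1.isLocalization
      exact IsOpenImmersion.of_isLocalization h

end
end MM
end

section
set_option linter.all false
open AlgebraicGeometry CategoryTheory CategoryTheory.Limits
namespace MM

/-- An affine open together with a subring of its ring of sections. -/
structure Chart (Y : Scheme.{u}) where
  U : Y.Opens
  hU : IsAffineOpen U
  P : Subring Γ(Y, U)

variable {Y : Scheme.{u}}

/-- `h` is good for `(c, d)`. -/
def Good (c d : Chart Y) (h : Γ(Y, c.U)) : Prop :=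
  h ∈ c.P ∧ ∃ hd : Y.basicOpen h ≤ d.U, ∀ q ∈ d.P, ∃ n, ∃ p ∈ c.P,
    rs (Y.basicOpen_le h) p = rs (Y.basicOpen_le h) h ^ n * rs hd q

/-- the subring generated by two charts on `W`. -/
noncomputable def Q2 (c d : Chart Y) (W : Y.Opens) (h : W ≤ c.U) (h' : W ≤ d.U) : Subring Γ(Y, W) :=
  Subring.closure ((rs h) '' c.P ∪ (rs h') '' d.P)

lemma mem_Q2_left {c d : Chart Y} {W : Y.Opens} {h : W ≤ c.U} {h' : W ≤ d.U} {p} (hp : p ∈ c.P) :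
    rs h p ∈ Q2 c d W h h' := Subring.subset_closure (.inl ⟨p, hp, rfl⟩)

lemma mem_Q2_right {c d : Chart Y} {W : Y.Opens} {h : W ≤ c.U} {h' : W ≤ d.U} {p} (hp : p ∈ d.P) :
    rs h' p ∈ Q2 c d W h h' := Subring.subset_closure (.inr ⟨p, hp, rfl⟩)

lemma Q2_le {c d : Chart Y} {W : Y.Opens} {h : W ≤ c.U} {h' : W ≤ d.U} {S : Subring Γ(Y, W)}
    (h1 : ∀ p ∈ c.P, rs h p ∈ S) (h2 : ∀ p ∈ d.P, rs h' p ∈ S) : Q2 c d W h h' ≤ S := by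
  refine (Subring.closure_le).mpr ?_
  rintro _ (⟨p, hp, rfl⟩ | ⟨p, hp, rfl⟩)
  exacts [h1 p hp, h2 p hp]

lemma notMem_congr {R : Type*} [CommRing R] {x : Ideal R} {a b : R} (h : b ∉ x) (e : a = b) :
    a ∉ x := e ▸ h

/-- `Spec P_c P_d → Spec P_c` is an open immersion -/
def Rel (c d : Chart Y) : Prop :=
  (1 : Γ(Y, c.U ⊓ d.U)) ∈ Submodule.span (Q2 c d _ inf_le_left inf_le_right)
    ((rs (inf_le_left : c.U ⊓ d.U ≤ c.U)) '' {h | Good c d h})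

lemma Good.mul {c d : Chart Y} {h k : Γ(Y, c.U)} (hh : Good c d h) (hk : k ∈ c.P) :
    Good c d (h * k) := by
  obtain ⟨h1, hd, H⟩ := hh
  have e : Y.basicOpen (h * k) ≤ Y.basicOpen h := by
    rw [Y.basicOpen_mul]; exact inf_le_left
  refine ⟨c.P.mul_mem h1 hk, e.trans hd, fun q hq => ?_⟩
  obtain ⟨n, p, hp, h2⟩ := H q hq
  refine ⟨n, p * k ^ n, c.P.mul_mem hp (c.P.pow_mem hk n), ?_⟩
  have := congrArg (rs e) h2
  simp only [map_mul, map_pow, rs_rs] at this ⊢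
  rw [this]; ring

lemma eq_of_rs_basicOpen {W : Y.Opens} (hW : IsAffineOpen W) {V : Y.Opens}
    (f s t : Γ(Y, W)) (hV : V ≤ W) (hf : Y.basicOpen f ≤ V) (h : rs hV s = rs hV t) :
    ∃ n, f ^ n * s = f ^ n * t := by
  apply exists_pow_mul_eq hW
  have := congrArg (rs hf) h
  simpa using this

/-- for a family of charts, and element good for all -/
lemma Good.exists_eq {c d : Chart Y} {h : Γ(Y, c.U)} (hh : Good c d h) {W : Y.Opens}
    (hW : IsAffineOpen W) (hc : W ≤ c.U) (hd : W ≤ d.U) {q : Γ(Y, d.U)} (hq : q ∈ d.P) :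
    ∃ n, ∃ p ∈ c.P, rs hc p = rs hc h ^ n * rs hd q := by
  obtain ⟨h1, hd', H⟩ := hh
  obtain ⟨n, p, hp, h2⟩ := H q hq
  have e1 : Y.basicOpen (rs hc h) ≤ Y.basicOpen h := by rw [basicOpen_rs]; exact inf_le_right
  obtain ⟨m, hm⟩ := exists_pow_mul_eq hW (rs hc h) (rs hc p) (rs hc h ^ n * rs hd q) (by
    have := congrArg (rs e1) h2
    simpa using this)
  refine ⟨m + n, h ^ m * p, c.P.mul_mem (c.P.pow_mem h1 m) hp, ?_⟩
  simp only [map_mul, map_pow, hm]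
  ring

section glue
variable {ι : Type u} (c : ι → Chart Y)

/-- intersection of chart domains -/
noncomputable def UJ (J : Finset ι) : Y.Opens := J.inf fun i => (c i).U

lemma UJ_le {J : Finset ι} {i : ι} (h : i ∈ J) : UJ c J ≤ (c i).U := Finset.inf_le h
lemma UJ_mono {J J' : Finset ι} (h : J ⊆ J') : UJ c J' ≤ UJ c J := Finset.inf_mono h

/-- the generated subring -/
noncomputable def QJ (J : Finset ι) : Subring Γ(Y, UJ c J) :=
  Subring.closure (⋃ i : J, (rs (UJ_le c i.2)) '' (c i).P)

lemma mem_QJ {J : Finset ι} {i : ι} (h : i ∈ J) {p} (hp : p ∈ (c i).P) :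
    rs (UJ_le c h) p ∈ QJ c J :=
  Subring.subset_closure (Set.mem_iUnion.mpr ⟨⟨i, h⟩, p, hp, rfl⟩)

lemma QJ_le {J : Finset ι} {S : Subring Γ(Y, UJ c J)}
    (H : ∀ i (h : i ∈ J), ∀ p ∈ (c i).P, rs (UJ_le c h) p ∈ S) : QJ c J ≤ S := by
  refine (Subring.closure_le).mpr (Set.iUnion_subset fun i => ?_)
  rintro _ ⟨p, hp, rfl⟩
  exact H i.1 i.2 p hp

/-- transition -/
noncomputable def QJmap {J J' : Finset ι} (h : J ⊆ J') : QJ c J →+* QJ c J' :=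
  ((rs (UJ_mono c h)).comp (QJ c J).subtype).codRestrict _ (by
    rintro ⟨x, hx⟩
    have : QJ c J ≤ (QJ c J').comap (rs (UJ_mono c h)) := QJ_le c fun i hi p hp => by
      rw [Subring.mem_comap, rs_rs]
      exact mem_QJ c (h hi) hp
    exact this hx)

@[simp] lemma QJmap_coe {J J' : Finset ι} (h : J ⊆ J') (x : QJ c J) :
    (QJmap c h x : Γ(Y, UJ c J')) = rs (UJ_mono c h) x.1 := rfl

variable [Y.IsSeparated]

lemma UJ_affine {J : Finset ι} (hJ : J.Nonempty) : IsAffineOpen (UJ c J) := by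
  classical
  induction hJ using Finset.Nonempty.cons_induction with
  | singleton a => simpa [UJ] using (c a).hU
  | cons a s ha hs ih =>
    simp only [UJ, Finset.cons_eq_insert, Finset.inf_insert] at ih ⊢
    exact (c a).hU.inf ih

lemma locIso_QJ {J J' : Finset ι} (h : J ⊆ J') (hJ : J.Nonempty) (f : Γ(Y, UJ c J)) (hf : f ∈ QJ c J)
    {i : ι} (hi : i ∈ J) (g : Γ(Y, (c i).U)) (hg : f = rs (UJ_le c hi) g)
    (H : ∀ j ∈ J', Good (c i) (c j) g) : LocIso (QJmap c h) ⟨f, hf⟩ := by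
  have hJ' : J'.Nonempty := hJ.mono h
  constructor
  · rintro ⟨r, hr⟩ h0
    have h0 : rs (UJ_mono c h) r = 0 := congrArg Subtype.val h0
    obtain ⟨n, hn⟩ := eq_of_rs_basicOpen (UJ_affine c hJ) f r 0 (UJ_mono c h)
      (Finset.le_inf fun j hj => by
        subst hg
        rw [basicOpen_rs]
        exact inf_le_right.trans (H j hj).2.choose) (by simpa using h0)
    exact ⟨n, Subtype.ext (by simpa using hn)⟩
  · rintro ⟨s, hs⟩
    suffices h : ∃ n, ∃ r ∈ QJ c J, rs (UJ_mono c h) r = rs (UJ_mono c h) f ^ n * s by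
      obtain ⟨n, r, hr, e⟩ := h
      exact ⟨n, ⟨r, hr⟩, Subtype.ext (by simpa using e)⟩
    unfold QJ at hs
    induction hs using Subring.closure_induction with
    | mem x hx =>
      obtain ⟨j, hj⟩ := Set.mem_iUnion.mp hx
      obtain ⟨p, hp, rfl⟩ := hj
      obtain ⟨n, r, hr, e⟩ := (H j j.2).exists_eq (UJ_affine c hJ') (UJ_le c (h hi)) (UJ_le c j.2) hp
      refine ⟨n, rs (UJ_le c hi) r, mem_QJ c hi hr, ?_⟩
      subst hg
      simpa using e
    | zero => exact ⟨0, 0, zero_mem _, by simp⟩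
    | one => exact ⟨0, 1, one_mem _, by simp⟩
    | add x y _ _ h1 h2 =>
      obtain ⟨n, r, hr, e⟩ := h1
      obtain ⟨m, t, ht, e'⟩ := h2
      refine ⟨n + m, f ^ m * r + f ^ n * t, add_mem (mul_mem (pow_mem hf _) hr)
        (mul_mem (pow_mem hf _) ht), ?_⟩
      simp only [map_add, map_mul, map_pow, e, e']; ring
    | neg x _ h1 =>
      obtain ⟨n, r, hr, e⟩ := h1
      exact ⟨n, -r, neg_mem hr, by simp [e]⟩
    | mul x y _ _ h1 h2 =>
      obtain ⟨n, r, hr, e⟩ := h1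
      obtain ⟨m, t, ht, e'⟩ := h2
      refine ⟨n + m, r * t, mul_mem hr ht, ?_⟩
      simp only [map_mul, e, e']; ring

/-- prime avoidance from `Rel`. -/
lemma Rel.exists_notMem {a b : Chart Y} (h : Rel a b) {D : Type*} [CommRing D]
    (θ : Q2 a b _ inf_le_left inf_le_right →+* D) (x : Ideal D) [x.IsPrime] :
    ∃ (g : _) (hg : Good a b g), θ ⟨rs inf_le_left g, mem_Q2_left hg.1⟩ ∉ x := by
  by_contra! hc
  have key : ∀ z ∈ Submodule.span (Q2 a b _ inf_le_left inf_le_right)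
    ((rs (inf_le_left : a.U ⊓ b.U ≤ a.U)) '' {h | Good a b h}),
      ∃ hz : z ∈ Q2 a b _ inf_le_left inf_le_right, θ ⟨z, hz⟩ ∈ x := by
    intro z hz
    induction hz using Submodule.span_induction with
    | mem z hz =>
      obtain ⟨g, hg, rfl⟩ := hz
      exact ⟨_, hc g hg⟩
    | zero => exact ⟨zero_mem _, by
        have : θ ⟨0, zero_mem _⟩ = 0 := map_zero θ
        rw [this]; exact zero_mem _⟩
    | add z w _ _ hz hw =>
      obtain ⟨h1, h2⟩ := hz
      obtain ⟨h3, h4⟩ := hw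
      refine ⟨add_mem h1 h3, ?_⟩
      have := map_add θ ⟨z, h1⟩ ⟨w, h3⟩
      exact (congrArg (· ∈ x) this).mpr (add_mem h2 h4)
    | smul r z _ hz =>
      obtain ⟨h1, h2⟩ := hz
      refine ⟨mul_mem r.2 h1, ?_⟩
      have := map_mul θ r ⟨z, h1⟩
      exact (congrArg (· ∈ x) this).mpr (x.mul_mem_left _ h2)
  obtain ⟨h1, h2⟩ := key _ h
  have : θ ⟨1, h1⟩ = 1 := map_one θ
  rw [this] at h2
  exact ‹x.IsPrime›.ne_top ((Ideal.eq_top_iff_one _).mpr h2)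

/-- the map from a pairwise ring -/
noncomputable def Q2map {J : Finset ι} {i j : ι} (hi : i ∈ J) (hj : j ∈ J) :
    Q2 (c i) (c j) _ inf_le_left inf_le_right →+* QJ c J :=
  ((rs (le_inf (UJ_le c hi) (UJ_le c hj))).comp (Subring.subtype _)).codRestrict _ (by
    rintro ⟨x, hx⟩
    have : Q2 (c i) (c j) _ inf_le_left inf_le_right ≤
        (QJ c J).comap (rs (le_inf (UJ_le c hi) (UJ_le c hj))) := by
      refine Q2_le (fun p hp => ?_) (fun p hp => ?_)
      · rw [Subring.mem_comap, rs_rs]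
        exact mem_QJ c hi hp
      · rw [Subring.mem_comap, rs_rs]
        exact mem_QJ c hj hp
    exact this hx)

lemma exists_good_notMem (hR : ∀ i j, Rel (c i) (c j)) {J : Finset ι} {i : ι} (hi : i ∈ J)
    (x : Ideal (QJ c J)) [x.IsPrime] :
    ∃ (g : Γ(Y, (c i).U)) (hg : g ∈ (c i).P), (∀ j ∈ J, Good (c i) (c j) g) ∧
      (⟨_, mem_QJ c hi hg⟩ : QJ c J) ∉ x := by
  classical
  have h1 : ∀ j : J, ∃ (g : Γ(Y, (c i).U)) (hg : g ∈ (c i).P), Good (c i) (c j) g ∧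
      (⟨_, mem_QJ c hi hg⟩ : QJ c J) ∉ x := by
    intro j
    obtain ⟨g, hg, h⟩ := (hR i j).exists_notMem (Q2map c hi j.2) x
    refine ⟨g, hg.1, hg, notMem_congr h (Subtype.ext ?_)⟩
    simp [Q2map]
  choose g hg hG hn using h1
  refine ⟨∏ j, g j, Subring.prod_mem _ fun j _ => hg j, fun j hj => ?_, fun h => ?_⟩
  · rw [← Finset.mul_prod_erase _ _ (Finset.mem_univ (⟨j, hj⟩ : J))]
    exact (hG ⟨j, hj⟩).mul (Subring.prod_mem _ fun j _ => hg j)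
  · have e : (⟨_, mem_QJ c hi (Subring.prod_mem _ fun j (_ : j ∈ Finset.univ) => hg j)⟩ : QJ c J) =
        ∏ j, (⟨_, mem_QJ c hi (hg j)⟩ : QJ c J) := by
      apply Subtype.ext
      simp
    rw [e, ‹x.IsPrime›.prod_mem_iff] at h
    obtain ⟨j, _, hj⟩ := h
    exact hn j hj

lemma isOpenImmersion_QJmap (hR : ∀ i j, Rel (c i) (c j)) {J J' : Finset ι} (h : J ⊆ J')
    (hJ : J.Nonempty) : IsOpenImmersion (Spec.map (CommRingCat.ofHom (QJmap c h))) := by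
  apply isOpenImmersion_of_locIso
  intro x hx
  obtain ⟨i, hi⟩ := hJ
  obtain ⟨g, hg, hG, hn⟩ := exists_good_notMem c hR (h hi) x
  refine ⟨⟨rs (UJ_le c hi) g, mem_QJ c hi hg⟩,
    locIso_QJ c h ⟨i, hi⟩ _ _ hi g rfl hG, notMem_congr hn (Subtype.ext ?_)⟩
  simp

/-- existence of common refinement of primes -/
lemma exists_prime_union [DecidableEq ι] (hR : ∀ i j, Rel (c i) (c j)) {K J J' : Finset ι} (h : K ⊆ J) (h' : K ⊆ J')
    (hK : K.Nonempty) (x : Ideal (QJ c J)) (x' : Ideal (QJ c J')) [x.IsPrime] [x'.IsPrime]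
    (e : x.comap (QJmap c h) = x'.comap (QJmap c h')) :
    ∃ y : Ideal (QJ c (J ∪ J')), y.IsPrime ∧ y.comap (QJmap c Finset.subset_union_left) = x ∧
      y.comap (QJmap c Finset.subset_union_right) = x' := by
  obtain ⟨i, hi⟩ := hK
  obtain ⟨g, hg, hG, hn⟩ := exists_good_notMem c hR (h hi) x
  obtain ⟨g', hg', hG', hn'⟩ := exists_good_notMem c hR (h' hi) x'
  set p := x.comap (QJmap c h) with hp
  have : p.IsPrime := Ideal.IsPrime.comap _
  let G : QJ c K := ⟨rs (UJ_le c hi) g, mem_QJ c hi hg⟩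
  let G' : QJ c K := ⟨rs (UJ_le c hi) g', mem_QJ c hi hg'⟩
  have hx : QJmap c h G ∉ x := notMem_congr hn (Subtype.ext (by simp [G]))
  have hx' : QJmap c h' G' ∉ x' := notMem_congr hn' (Subtype.ext (by simp [G']))
  have hGp : G * G' ∉ p := by
    intro hh
    rcases ‹p.IsPrime›.mem_or_mem hh with h1 | h1
    · exact hx h1
    · rw [e] at h1; exact hx' h1
  have L := locIso_QJ c (h.trans (Finset.subset_union_left (s₂ := J'))) ⟨i, hi⟩ _ (G * G').2 hi (g * g')
    (by simp [G, G']) (fun j hj => by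
      rcases Finset.mem_union.mp hj with hj | hj
      · exact (hG j hj).mul hg'
      · rw [mul_comm]; exact (hG' j hj).mul hg)
  obtain ⟨y, hy, hyp⟩ := L.exists_comap p hGp
  have c1 : (QJmap c (Finset.subset_union_left (s₂ := J'))).comp (QJmap c h) =
    QJmap c (h.trans Finset.subset_union_left) := by ext z; simp
  have c2 : (QJmap c (Finset.subset_union_right (s₁ := J))).comp (QJmap c h') =
    QJmap c (h.trans Finset.subset_union_left) := by ext z; simp
  refine ⟨y, hy, ?_, ?_⟩
  · have := Ideal.IsPrime.comap (QJmap c (Finset.subset_union_left (s₂ := J'))) (K := y)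
    symm
    refine (locIso_QJ c h ⟨i, hi⟩ _ G.2 hi g rfl hG).injective ?_ hx
    rw [Ideal.comap_comap, c1, hyp]
  · have := Ideal.IsPrime.comap (QJmap c (Finset.subset_union_right (s₁ := J))) (K := y)
    symm
    refine (locIso_QJ c h' ⟨i, hi⟩ _ G'.2 hi g' rfl hG').injective ?_ hx'
    rw [Ideal.comap_comap, c2, hyp, e]

end glue
end MM
end

section
set_option linter.all false
open AlgebraicGeometry CategoryTheory CategoryTheory.Limits
namespace MM
variable {Y : Scheme.{u}}

/-- `P_c → P_c P_d` -/
noncomputable def q2l (c d : Chart Y) : c.P →+* Q2 c d (c.U ⊓ d.U) inf_le_left inf_le_right :=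
  ((rs inf_le_left).comp c.P.subtype).codRestrict _ fun x => mem_Q2_left x.2

/-- `P_d → P_c P_d` -/
noncomputable def q2r (c d : Chart Y) : d.P →+* Q2 c d (c.U ⊓ d.U) inf_le_left inf_le_right :=
  ((rs inf_le_right).comp d.P.subtype).codRestrict _ fun x => mem_Q2_right x.2

lemma rs_bijective {U W : Y.Opens} (h : W ≤ U) (h' : U ≤ W) : Function.Bijective (rs h) := by
  refine Function.bijective_iff_has_inverse.mpr ⟨rs h', fun x => ?_, fun x => ?_⟩ <;> simp

section glue
variable {ι : Type u} (c : ι → Chart Y)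

/-- map from a chart ring -/
noncomputable def pJ {J : Finset ι} {i : ι} (hi : i ∈ J) : (c i).P →+* QJ c J :=
  ((rs (UJ_le c hi)).comp (c i).P.subtype).codRestrict _ fun x => mem_QJ c hi x.2

lemma Q2map_q2l {J : Finset ι} {i j : ι} (hi : i ∈ J) (hj : j ∈ J) :
    (Q2map c hi hj).comp (q2l (c i) (c j)) = pJ c hi := by
  ext x; simp [Q2map, q2l, pJ]

lemma Q2map_q2r {J : Finset ι} {i j : ι} (hi : i ∈ J) (hj : j ∈ J) :
    (Q2map c hi hj).comp (q2r (c i) (c j)) = pJ c hj := by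
  ext x; simp [Q2map, q2r, pJ]

lemma QJmap_pJ {J J' : Finset ι} (h : J ⊆ J') {i : ι} (hi : i ∈ J) :
    (QJmap c h).comp (pJ c hi) = pJ c (h hi) := by
  ext x; simp [QJmap, pJ]

lemma QJmap_QJmap {J J' J'' : Finset ι} (h : J ⊆ J') (h' : J' ⊆ J'') :
    (QJmap c h').comp (QJmap c h) = QJmap c (h.trans h') := by
  ext x; simp [QJmap]

lemma pJ_bijective (i : ι) : Function.Bijective (pJ c (Finset.mem_singleton_self i)) := by
  have hb := rs_bijective (UJ_le c (Finset.mem_singleton_self i)) (by simp [UJ])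
  constructor
  · intro x y h
    exact Subtype.ext (hb.1 (congrArg Subtype.val h))
  · have : QJ c {i} ≤ (c i).P.map (rs (UJ_le c (Finset.mem_singleton_self i))) := by
      refine QJ_le c fun j hj p hp => ?_
      obtain rfl := Finset.mem_singleton.mp hj
      exact ⟨p, hp, rfl⟩
    rintro ⟨x, hx⟩
    obtain ⟨p, hp, e⟩ := this hx
    exact ⟨⟨p, hp⟩, Subtype.ext e⟩

/-- The diagram. -/
noncomputable def diag : ({J : Finset ι // J.Nonempty})ᵒᵖ ⥤ Scheme.{u} where
  obj J := Spec (.of (QJ c J.unop.1))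
  map f := Spec.map (CommRingCat.ofHom (QJmap c (leOfHom f.unop)))
  map_id J := by
    rw [← Spec.map_id]; congr 1; ext x; simp [QJmap]
  map_comp f g := by
    rw [← Spec.map_comp, ← CommRingCat.ofHom_comp, QJmap_QJmap]

variable [Y.IsSeparated]

theorem exists_glue (hR : ∀ i j, Rel (c i) (c j)) :
    ∃ (X : Scheme.{u}) (j : ∀ i, Spec (.of (c i).P) ⟶ X), (∀ i, IsOpenImmersion (j i)) ∧
      (∀ x, ∃ i y, j i y = x) ∧
      (∀ i k, Spec.map (CommRingCat.ofHom (q2l (c i) (c k))) ≫ j i =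
        Spec.map (CommRingCat.ofHom (q2r (c i) (c k))) ≫ j k) ∧
      (∀ i k x y, j i x = j k y → ∃ z, Spec.map (CommRingCat.ofHom (q2l (c i) (c k))) z = x ∧
        Spec.map (CommRingCat.ofHom (q2r (c i) (c k))) z = y) ∧
      (∀ (T : Scheme.{u}) (f : ∀ i, Spec (.of (c i).P) ⟶ T),
        (∀ i k, Spec.map (CommRingCat.ofHom (q2l (c i) (c k))) ≫ f i =
          Spec.map (CommRingCat.ofHom (q2r (c i) (c k))) ≫ f k) → ∃ g, ∀ i, j i ≫ g = f i) := by
  classical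
  let F := diag c
  have hopen : ∀ {J J'} (f : J ⟶ J'), IsOpenImmersion (F.map f) := fun {J J'} f =>
    isOpenImmersion_QJmap c hR (leOfHom f.unop) J'.unop.2
  have hdir : (F ⋙ Scheme.forget).IsLocallyDirected := by
    constructor
    intro J J' K f f' x x' e
    have hx := x.2; have hx' := x'.2
    have e' : x.asIdeal.comap (QJmap c (leOfHom f.unop)) =
      x'.asIdeal.comap (QJmap c (leOfHom f'.unop)) := congrArg PrimeSpectrum.asIdeal e
    obtain ⟨y, hy, h1, h2⟩ := exists_prime_union c hR (leOfHom f.unop) (leOfHom f'.unop) K.unop.2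
      x.asIdeal x'.asIdeal e'
    exact ⟨.op ⟨J.unop.1 ∪ J'.unop.1, J.unop.2.mono Finset.subset_union_left⟩,
      Quiver.Hom.op (homOfLE Finset.subset_union_left),
      Quiver.Hom.op (homOfLE Finset.subset_union_right), ⟨y, hy⟩,
      PrimeSpectrum.ext h1, PrimeSpectrum.ext h2⟩
  have hb := fun i => CommRingCat.ofHom (pJ c (Finset.mem_singleton_self i))
  let s : ι → ({J : Finset ι // J.Nonempty})ᵒᵖ := fun i => .op ⟨{i}, Finset.singleton_nonempty i⟩
  let b : ∀ i, F.obj (s i) ⟶ Spec (.of (c i).P) := fun i =>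
    Spec.map (CommRingCat.ofHom (pJ c (Finset.mem_singleton_self i)))
  have hb : ∀ i, IsIso (b i) := fun i => by
    have : IsIso (CommRingCat.ofHom (pJ c (Finset.mem_singleton_self i))) := by
      rw [ConcreteCategory.isIso_iff_bijective]
      exact pJ_bijective c i
    exact inferInstanceAs (IsIso (Spec.map _))
  let st : ∀ (J : ({J : Finset ι // J.Nonempty})ᵒᵖ) (i) (hi : i ∈ J.unop.1), J ⟶ s i := fun J i hi =>
    Quiver.Hom.op (homOfLE (Finset.singleton_subset_iff.mpr hi))
  have hst : ∀ J i hi, F.map (st J i hi) ≫ b i = Spec.map (CommRingCat.ofHom (pJ c hi)) := by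
    intro J i hi
    change Spec.map _ ≫ Spec.map _ = _
    rw [← Spec.map_comp, ← CommRingCat.ofHom_comp, QJmap_pJ]
  have hst' : ∀ J i hi, F.map (st J i hi) = Spec.map (CommRingCat.ofHom (pJ c hi)) ≫ inv (b i) := by
    intro J i hi
    exact (IsIso.eq_comp_inv (b i)).mpr (hst J i hi)
  refine ⟨colimit F, fun i => inv (b i) ≫ colimit.ι F (s i), fun i => inferInstance, ?_, ?_, ?_, ?_⟩
  · intro x
    obtain ⟨J, y, rfl⟩ := Scheme.IsLocallyDirected.ι_jointly_surjective F x
    obtain ⟨i, hi⟩ := J.unop.2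
    refine ⟨i, b i (F.map (st J i hi) y), ?_⟩
    simp only [← Scheme.Hom.comp_apply, Category.assoc, IsIso.hom_inv_id_assoc, colimit.w]
  · intro i k
    have hJ : ({i, k} : Finset ι).Nonempty := ⟨i, by simp⟩
    let J : ({J : Finset ι // J.Nonempty})ᵒᵖ := .op ⟨{i, k}, hJ⟩
    have hi : i ∈ J.unop.1 := by simp [J]
    have hk : k ∈ J.unop.1 := by simp [J]
    have e1 := colimit.w F (st J i hi)
    have e2 := colimit.w F (st J k hk)
    rw [hst' J i hi] at e1; rw [hst' J k hk] at e2
    have hbij : Function.Bijective (Q2map c hi hk) := by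
      have hr : Function.Bijective (rs (le_inf (UJ_le c hi) (UJ_le c hk))) :=
        rs_bijective _ (by simp [UJ, J])
      constructor
      · intro x y h
        exact Subtype.ext (hr.1 (congrArg Subtype.val h))
      · have : QJ c J.unop.1 ≤ (Q2 (c i) (c k) _ inf_le_left inf_le_right).map
            (rs (le_inf (UJ_le c hi) (UJ_le c hk))) := by
          refine QJ_le c fun j hj p hp => ?_
          have hj' : j = i ∨ j = k := by simpa [J] using hj
          rcases hj' with rfl | rfl
          · exact ⟨_, mem_Q2_left hp, by simp⟩
          · exact ⟨_, mem_Q2_right hp, by simp⟩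
        rintro ⟨x, hx⟩
        obtain ⟨p, hp, e⟩ := this hx
        exact ⟨⟨p, hp⟩, Subtype.ext e⟩
    have : IsIso (CommRingCat.ofHom (Q2map c hi hk)) := by
      rw [ConcreteCategory.isIso_iff_bijective]
      exact hbij
    rw [← cancel_epi (Spec.map (CommRingCat.ofHom (Q2map c hi hk))), ← Spec.map_comp_assoc,
      ← Spec.map_comp_assoc, ← CommRingCat.ofHom_comp, ← CommRingCat.ofHom_comp, Q2map_q2l,
      Q2map_q2r, ← Category.assoc, ← Category.assoc]
    exact e1.trans e2.symm
  · intro i k x y e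
    simp only [Scheme.Hom.comp_apply] at e
    obtain ⟨J, fi, fk, z, h1, h2⟩ := (Scheme.IsLocallyDirected.ι_eq_ι_iff F).mp e
    have hi : i ∈ J.unop.1 := Finset.singleton_subset_iff.mp (leOfHom fi.unop)
    have hk : k ∈ J.unop.1 := Finset.singleton_subset_iff.mp (leOfHom fk.unop)
    obtain rfl : fi = st J i hi := Subsingleton.elim _ _
    obtain rfl : fk = st J k hk := Subsingleton.elim _ _
    have h1 := congrArg (b i) h1
    have h2 := congrArg (b k) h2
    simp only [← Scheme.Hom.comp_apply, hst, IsIso.inv_hom_id] at h1 h2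
    refine ⟨Spec.map (CommRingCat.ofHom (Q2map c hi hk)) z, ?_, ?_⟩
    · erw [← Scheme.Hom.comp_apply]; rw [← Spec.map_comp, ← CommRingCat.ofHom_comp, Q2map_q2l]
      exact h1
    · erw [← Scheme.Hom.comp_apply]; rw [← Spec.map_comp, ← CommRingCat.ofHom_comp, Q2map_q2r]
      exact h2
  · intro T f hf
    have key : ∀ (J : ({J : Finset ι // J.Nonempty})ᵒᵖ) i (hi : i ∈ J.unop.1) k (hk : k ∈ J.unop.1),
        Spec.map (CommRingCat.ofHom (pJ c hi)) ≫ f i = Spec.map (CommRingCat.ofHom (pJ c hk)) ≫ f k := by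
      intro J i hi k hk
      rw [← Q2map_q2l c hi hk, ← Q2map_q2r c hi hk]
      simp only [CommRingCat.ofHom_comp, Spec.map_comp, Category.assoc, hf]
    choose e he using fun J : ({J : Finset ι // J.Nonempty})ᵒᵖ => J.unop.2
    refine ⟨colimit.desc F ⟨T, fun J => Spec.map (CommRingCat.ofHom (pJ c (he J))) ≫ f (e J), ?_⟩, ?_⟩
    · intro J J' g
      change Spec.map _ ≫ Spec.map _ ≫ _ = _ ≫ 𝟙 _
      rw [← Spec.map_comp_assoc, ← CommRingCat.ofHom_comp, QJmap_pJ]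
      exact (key J _ _ _ _).trans (Category.comp_id _).symm
    · intro i
      rw [Category.assoc, colimit.ι_desc, IsIso.inv_comp_eq]
      exact key (s i) _ _ _ _

end glue
end MM
end

section
set_option linter.all false
open AlgebraicGeometry CategoryTheory CategoryTheory.Limits
namespace MM
variable {Y : Scheme.{u}} [Y.IsSeparated]

lemma span_transport {R R' : Type*} [CommRing R] [CommRing R'] (φ : R →+* R') {Q : Subring R}
    {Q' : Subring R'} {S : Set R} {S' : Set R'} (hQ : ∀ q ∈ Q, φ q ∈ Q')
    (hS : ∀ s ∈ S, φ s ∈ Submodule.span Q' S') {z : R} (hz : z ∈ Submodule.span Q S) :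
    φ z ∈ Submodule.span Q' S' := by
  induction hz using Submodule.span_induction with
  | mem x hx => exact hS x hx
  | zero => simp
  | add x y _ _ hx hy => rw [map_add]; exact add_mem hx hy
  | smul a x _ hx =>
    have : φ (a • x) = (⟨φ a, hQ _ a.2⟩ : Q') • φ x := by
      rw [Subring.smul_def, smul_eq_mul, map_mul]; rfl
    rw [this]; exact Submodule.smul_mem _ _ hx

lemma span_mul {R : Type*} [CommRing R] {Q : Subring R} {S : Set R} {q z : R} (hq : q ∈ Q)
    (hz : z ∈ Submodule.span Q S) : q * z ∈ Submodule.span Q S :=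
  Submodule.smul_mem _ (⟨q, hq⟩ : Q) hz

lemma span_le_subring {R : Type*} [CommRing R] {Q : Subring R} {S : Set R} (hS : S ⊆ Q) {z : R}
    (hz : z ∈ Submodule.span Q S) : z ∈ Q := by
  induction hz using Submodule.span_induction with
  | mem x hx => exact hS hx
  | zero => exact zero_mem _
  | add x y _ _ hx hy => exact add_mem hx hy
  | smul a x _ hx => exact mul_mem a.2 hx

/-- the standard ring of two charts -/
noncomputable abbrev QQ (c d : Chart Y) : Subring Γ(Y, c.U ⊓ d.U) :=
  Q2 c d (c.U ⊓ d.U) inf_le_left inf_le_right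

lemma colon_local {c d : Chart Y} (h : Rel c d) (M : Submodule (QQ c d) Γ(Y, c.U ⊓ d.U))
    (z : Γ(Y, c.U ⊓ d.U)) (H : ∀ g, Good c d g → ∃ k, rs inf_le_left g ^ k * z ∈ M) : z ∈ M := by
  let I : Ideal (QQ c d) :=
    { carrier := {q | q.1 * z ∈ M}
      add_mem' := fun {a b} ha hb => by
        simp only [Set.mem_setOf_eq, Subring.coe_add, add_mul] at *; exact add_mem ha hb
      zero_mem' := by simp
      smul_mem' := fun a b hb => by
        simp only [Set.mem_setOf_eq, smul_eq_mul, Subring.coe_mul, mul_assoc] at *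
        exact M.smul_mem a hb }
  by_contra hz
  have hI : I ≠ ⊤ := fun e => hz (by
    have : (1 : QQ c d) ∈ I := e ▸ Submodule.mem_top
    have : (1 : QQ c d).1 * z ∈ M := this
    simpa using this)
  obtain ⟨m, hm, hIm⟩ := Ideal.exists_le_maximal I hI
  have := hm.isPrime
  obtain ⟨g, hg, h2⟩ := h.exists_notMem (RingHom.id _) m
  obtain ⟨k, hk⟩ := H g hg
  refine h2 (‹m.IsPrime›.mem_of_pow_mem k (hIm ?_))
  change _ ∈ M
  simpa using hk

lemma relI {c d : Chart Y} (H : ∀ x : Ideal (QQ c d), x.IsPrime →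
    ∃ (g : _) (hg : Good c d g), (⟨rs inf_le_left g, mem_Q2_left hg.1⟩ : QQ c d) ∉ x) : Rel c d := by
  by_contra hn
  let I : Ideal (QQ c d) :=
    { carrier := {q | q.1 ∈ Submodule.span (QQ c d)
        ((rs (inf_le_left : c.U ⊓ d.U ≤ c.U)) '' {h | Good c d h})}
      add_mem' := fun {a b} ha hb => by
        simp only [Set.mem_setOf_eq, Subring.coe_add] at *; exact add_mem ha hb
      zero_mem' := by simp
      smul_mem' := fun a b hb => span_mul a.2 hb }
  have hI : I ≠ ⊤ := fun e => hn (by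
    have : (1 : QQ c d) ∈ I := e ▸ Submodule.mem_top
    exact this)
  obtain ⟨m, hm, hIm⟩ := Ideal.exists_le_maximal I hI
  obtain ⟨g, hg, h⟩ := H m hm.isPrime
  exact h (hIm (Submodule.subset_span ⟨g, hg, rfl⟩))

lemma Rel.refl (c : Chart Y) : Rel c c := by
  refine relI fun x hx => ⟨1, ⟨one_mem _, Y.basicOpen_le _, fun q hq => ⟨0, q, hq, by simp⟩⟩, ?_⟩
  refine notMem_congr ((Ideal.ne_top_iff_one x).mp hx.ne_top) (Subtype.ext ?_)
  simp

/-- domination -/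
def Dom (c' c : Chart Y) : Prop := ∃ h : c'.U ≤ c.U, ∀ p ∈ c.P, rs h p ∈ c'.P

lemma Dom.refl (c : Chart Y) : Dom c c := ⟨le_rfl, fun p hp => by simpa using hp⟩
lemma Dom.trans {a b c : Chart Y} (h : Dom a b) (h' : Dom b c) : Dom a c := by
  obtain ⟨h, H⟩ := h
  obtain ⟨h', H'⟩ := h'
  exact ⟨h.trans h', fun p hp => by simpa using H _ (H' p hp)⟩

lemma Dom.rs_mem {c' c d' d : Chart Y} (hc : Dom c' c) (hd : Dom d' d) {x} (hx : x ∈ QQ c d) :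
    rs (inf_le_inf hc.choose hd.choose) x ∈ QQ c' d' := by
  have : QQ c d ≤ (QQ c' d').comap (rs (inf_le_inf hc.choose hd.choose)) := by
    refine Q2_le (fun p hp => ?_) (fun p hp => ?_)
    · have := mem_Q2_left (d := d') (h := inf_le_left) (h' := inf_le_right) (hc.choose_spec p hp)
      simpa using this
    · have := mem_Q2_right (c := c') (h := inf_le_left) (h' := inf_le_right) (hd.choose_spec p hp)
      simpa using this
  exact this hx

/-- transition for dominating charts -/
noncomputable def domMap {c' c d' d : Chart Y} (hc : Dom c' c) (hd : Dom d' d) :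
    QQ c d →+* QQ c' d' :=
  ((rs (inf_le_inf hc.choose hd.choose)).comp (Subring.subtype _)).codRestrict _
    fun x => hc.rs_mem hd x.2

lemma Rel.dom {c' c d : Chart Y} (h : Rel c d) (hc : Dom c' c) : Rel c' d := by
  refine relI fun x hx => ?_
  obtain ⟨g, hg, hn⟩ := h.exists_notMem (domMap hc (Dom.refl d)) x
  obtain ⟨h1, H⟩ := hc
  have e : Y.basicOpen (rs h1 g) ≤ Y.basicOpen g := by rw [basicOpen_rs]; exact inf_le_right
  refine ⟨rs h1 g, ⟨H _ hg.1, e.trans hg.2.choose, fun q hq => ?_⟩,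
    notMem_congr hn (Subtype.ext ?_)⟩
  · obtain ⟨n, p, hp, h2⟩ := hg.2.choose_spec q hq
    refine ⟨n, rs h1 p, H p hp, ?_⟩
    have := congrArg (rs e) h2
    simpa using this
  · simp [domMap]

/-- `c'` is the chart of the blow-up of `c` in `G` at `f`. -/
structure IsBlow (c : Chart Y) (G : Set Γ(Y, c.U)) (f : Γ(Y, c.U)) (c' : Chart Y) : Prop where
  sub : G ⊆ c.P
  mem : f ∈ G
  eq : c'.U = Y.basicOpen f
  P_eq : c'.P = Subring.closure (rs (eq.trans_le (Y.basicOpen_le f)) '' c.P ∪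
    {z | ∃ g ∈ G, z * rs (eq.trans_le (Y.basicOpen_le f)) f = rs (eq.trans_le (Y.basicOpen_le f)) g})

namespace IsBlow
variable {c c' : Chart Y} {G : Set Γ(Y, c.U)} {f : Γ(Y, c.U)} (B : IsBlow c G f c')
include B
lemma le : c'.U ≤ c.U := B.eq.trans_le (Y.basicOpen_le f)

lemma dom : Dom c' c := ⟨B.le, fun p hp => by
  rw [B.P_eq]; exact Subring.subset_closure (.inl ⟨p, hp, rfl⟩)⟩

lemma isUnit : IsUnit (rs B.le f) := isUnit_rs_basicOpen f B.le B.eq.le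

lemma isUnit_of_le {W : Y.Opens} (h : W ≤ c'.U) : IsUnit (rs (h.trans B.le) f) :=
  isUnit_rs_basicOpen f _ (h.trans B.eq.le)

lemma exists_div {g} (hg : g ∈ Submodule.span c.P G) : ∃ z ∈ c'.P, z * rs B.le f = rs B.le g := by
  induction hg using Submodule.span_induction with
  | mem x hx =>
    obtain ⟨v, hv⟩ := B.isUnit
    refine ⟨rs B.le x * (v⁻¹ : _ˣ).1, ?_, by rw [← hv]; simp⟩
    rw [B.P_eq]
    refine Subring.subset_closure (.inr ⟨x, hx, ?_⟩)
    rw [← hv]; simp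
  | zero => exact ⟨0, zero_mem _, by simp⟩
  | add x y _ _ hx hy =>
    obtain ⟨z, hz, h1⟩ := hx
    obtain ⟨w, hw, h2⟩ := hy
    exact ⟨z + w, add_mem hz hw, by rw [add_mul, h1, h2, map_add]⟩
  | smul a x _ hx =>
    obtain ⟨z, hz, h1⟩ := hx
    refine ⟨rs B.le a.1 * z, mul_mem (B.dom.choose_spec _ a.2) hz, ?_⟩
    rw [mul_assoc, h1, ← map_mul]; rfl

/-- division inside `QQ` -/
lemma exists_div_QQ {d d' : Chart Y} (hd : Dom d' d) {z} (hz : z ∈ Submodule.span (QQ c d) (rs inf_le_left '' G)) :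
    ∃ w ∈ QQ c' d', w * rs (inf_le_left.trans B.le) f = rs (inf_le_inf B.le hd.choose) z := by
  induction hz using Submodule.span_induction with
  | mem x hx =>
    obtain ⟨g, hg, rfl⟩ := hx
    obtain ⟨z, hz, h⟩ := B.exists_div (Submodule.subset_span hg)
    refine ⟨rs inf_le_left z, mem_Q2_left hz, ?_⟩
    have := congrArg (rs (inf_le_left : c'.U ⊓ d'.U ≤ _)) h
    simpa using this
  | zero => exact ⟨0, zero_mem _, by simp⟩
  | add x y _ _ hx hy =>
    obtain ⟨z, hz, h1⟩ := hx
    obtain ⟨w, hw, h2⟩ := hy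
    exact ⟨z + w, add_mem hz hw, by rw [add_mul, h1, h2, map_add]⟩
  | smul a x _ hx =>
    obtain ⟨z, hz, h1⟩ := hx
    refine ⟨rs (inf_le_inf B.le hd.choose) a.1 * z, mul_mem (B.dom.rs_mem hd a.2) hz, ?_⟩
    rw [mul_assoc, h1, ← map_mul]; rfl
end IsBlow

lemma Good.clear_Q {b d e : Chart Y} {h : Γ(Y, b.U)} (hh : Good b d h) {T : Y.Opens}
    (hT : IsAffineOpen T) (hb : T ≤ b.U) (hd : T ≤ d.U) (he : T ≤ e.U)
    {q} (hq : q ∈ QQ d e) :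
    ∃ m, ∃ s ∈ QQ b e, rs (le_inf hb he) s = rs hb h ^ m * rs (le_inf hd he) q := by
  unfold QQ Q2 at hq
  induction hq using Subring.closure_induction with
  | mem x hx =>
    rcases hx with ⟨p, hp, rfl⟩ | ⟨p, hp, rfl⟩
    · obtain ⟨n, r, hr, e1⟩ := hh.exists_eq hT hb hd hp
      exact ⟨n, rs inf_le_left r, mem_Q2_left hr, by simpa using e1⟩
    · exact ⟨0, rs inf_le_right p, mem_Q2_right hp, by simp⟩
  | zero => exact ⟨0, 0, zero_mem _, by simp⟩
  | one => exact ⟨0, 1, one_mem _, by simp⟩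
  | add x y _ _ h1 h2 =>
    obtain ⟨n, r, hr, e⟩ := h1
    obtain ⟨m, t, ht, e'⟩ := h2
    have := mem_Q2_left (d := ‹Chart Y›) (h := inf_le_left) (h' := inf_le_right) hh.1
    refine ⟨n + m, rs inf_le_left h ^ m * r + rs inf_le_left h ^ n * t, add_mem (mul_mem (pow_mem this _) hr)
      (mul_mem (pow_mem this _) ht), ?_⟩
    simp only [map_add, map_mul, map_pow, e, e', rs_rs]; ring
  | neg x _ h1 =>
    obtain ⟨n, r, hr, e⟩ := h1
    exact ⟨n, -r, neg_mem hr, by simp [e]⟩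
  | mul x y _ _ h1 h2 =>
    obtain ⟨n, r, hr, e⟩ := h1
    obtain ⟨m, t, ht, e'⟩ := h2
    refine ⟨n + m, r * t, mul_mem hr ht, ?_⟩
    simp only [map_mul, e, e']; ring

lemma Good.clear_span {b d e : Chart Y} {h : Γ(Y, b.U)} (hh : Good b d h) {T : Y.Opens}
    (hT : IsAffineOpen T) (hb : T ≤ b.U) (hd : T ≤ d.U) (he : T ≤ e.U) {J : Set Γ(Y, e.U)}
    {q} (hq : q ∈ Submodule.span (QQ d e) (rs inf_le_right '' J)) :
    ∃ m, ∃ s ∈ Submodule.span (QQ b e) (rs inf_le_right '' J),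
      rs (le_inf hb he) s = rs hb h ^ m * rs (le_inf hd he) q := by
  have hm := mem_Q2_left (d := e) (h := inf_le_left) (h' := inf_le_right) hh.1
  induction hq using Submodule.span_induction with
  | mem x hx =>
    obtain ⟨j, hj, rfl⟩ := hx
    exact ⟨0, rs inf_le_right j, Submodule.subset_span ⟨j, hj, rfl⟩, by simp⟩
  | zero => exact ⟨0, 0, zero_mem _, by simp⟩
  | add x y _ _ h1 h2 =>
    obtain ⟨n, r, hr, e⟩ := h1
    obtain ⟨m, t, ht, e'⟩ := h2
    refine ⟨n + m, rs inf_le_left h ^ m * r + rs inf_le_left h ^ n * t, add_mem (span_mul (pow_mem hm _) hr)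
      (span_mul (pow_mem hm _) ht), ?_⟩
    simp only [map_add, map_mul, map_pow, e, e', rs_rs]; ring
  | smul a x _ h1 =>
    obtain ⟨n, r, hr, e1⟩ := h1
    obtain ⟨m, s, hs, e2⟩ := hh.clear_Q hT hb hd he a.2
    refine ⟨m + n, s * r, span_mul hs hr, ?_⟩
    rw [Subring.smul_def, smul_eq_mul]
    simp only [map_mul, e1, e2]; ring

/-- The clearing lemma. -/
lemma Good.clear {b d e : Chart Y} {h : Γ(Y, b.U)} (hh : Good b d h) {J : Set Γ(Y, e.U)}
    {z} (hz : z ∈ Submodule.span (QQ d e) (rs inf_le_right '' J)) {p : Γ(Y, b.U)} {n : ℕ}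
    (hp : ∀ (T : Y.Opens) (hb : T ≤ b.U) (hd : T ≤ d.U) (he : T ≤ e.U),
      rs hb p = rs hb h ^ n * rs (le_inf hd he) z) :
    ∃ k, rs inf_le_left (h ^ k * p) ∈ Submodule.span (QQ b e) (rs inf_le_right '' J) := by
  have hT : IsAffineOpen (b.U ⊓ d.U ⊓ e.U) := (b.hU.inf d.hU).inf e.hU
  have h1 : b.U ⊓ d.U ⊓ e.U ≤ b.U := inf_le_left.trans inf_le_left
  have h2 : b.U ⊓ d.U ⊓ e.U ≤ d.U := inf_le_left.trans inf_le_right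
  have h3 : b.U ⊓ d.U ⊓ e.U ≤ e.U := inf_le_right
  obtain ⟨m, s, hs, e1⟩ := hh.clear_span hT h1 h2 h3 hz
  have e2 := hp _ h1 h2 h3
  obtain ⟨k, hk⟩ := eq_of_rs_basicOpen (b.hU.inf e.hU) (rs inf_le_left h) (rs inf_le_left (h ^ m * p))
    (rs inf_le_left h ^ n * s) (le_inf h1 h3) (by
      rw [basicOpen_rs]
      refine le_inf (le_inf (inf_le_left.trans inf_le_left) (inf_le_right.trans hh.2.choose))
        (inf_le_left.trans inf_le_right)) (by
      simp only [map_mul, map_pow, rs_rs, e1, e2]; ring)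
  refine ⟨k + m, ?_⟩
  have hm := mem_Q2_left (d := e) (h := inf_le_left) (h' := inf_le_right) hh.1
  rw [pow_add, mul_assoc, map_mul, map_pow, hk]
  exact span_mul (pow_mem hm _) (span_mul (pow_mem hm _) hs)

lemma Good.clear_left {c d : Chart Y} {h : Γ(Y, c.U)} (hh : Good c d h) {G : Set Γ(Y, c.U)}
    {z : Γ(Y, c.U ⊓ d.U)} (hz : z ∈ Submodule.span (QQ c d) (rs inf_le_left '' G)) :
    ∃ m, ∃ s ∈ Submodule.span c.P G, rs inf_le_left s = rs inf_le_left h ^ m * z := by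
  have hQ : ∀ q ∈ QQ c d, ∃ m, ∃ s ∈ c.P, rs inf_le_left s = rs inf_le_left h ^ m * q := by
    intro q hq
    unfold QQ Q2 at hq
    induction hq using Subring.closure_induction with
    | mem x hx =>
      rcases hx with ⟨p, hp, rfl⟩ | ⟨p, hp, rfl⟩
      · exact ⟨0, p, hp, by simp⟩
      · exact hh.exists_eq (c.hU.inf d.hU) inf_le_left inf_le_right hp
    | zero => exact ⟨0, 0, zero_mem _, by simp⟩
    | one => exact ⟨0, 1, one_mem _, by simp⟩
    | add x y _ _ h1 h2 =>
      obtain ⟨n, r, hr, e⟩ := h1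
      obtain ⟨m, t, ht, e'⟩ := h2
      refine ⟨n + m, h ^ m * r + h ^ n * t, add_mem (mul_mem (pow_mem hh.1 _) hr)
        (mul_mem (pow_mem hh.1 _) ht), ?_⟩
      simp only [map_add, map_mul, map_pow, e, e']; ring
    | neg x _ h1 =>
      obtain ⟨n, r, hr, e⟩ := h1
      exact ⟨n, -r, neg_mem hr, by simp [e]⟩
    | mul x y _ _ h1 h2 =>
      obtain ⟨n, r, hr, e⟩ := h1
      obtain ⟨m, t, ht, e'⟩ := h2
      refine ⟨n + m, r * t, mul_mem hr ht, ?_⟩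
      simp only [map_mul, e, e']; ring
  induction hz using Submodule.span_induction with
  | mem x hx =>
    obtain ⟨j, hj, rfl⟩ := hx
    exact ⟨0, j, Submodule.subset_span hj, by simp⟩
  | zero => exact ⟨0, 0, zero_mem _, by simp⟩
  | add x y _ _ h1 h2 =>
    obtain ⟨n, r, hr, e⟩ := h1
    obtain ⟨m, t, ht, e'⟩ := h2
    refine ⟨n + m, h ^ m * r + h ^ n * t, add_mem (span_mul (pow_mem hh.1 _) hr)
      (span_mul (pow_mem hh.1 _) ht), ?_⟩
    simp only [map_add, map_mul, map_pow, e, e']; ring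
  | smul a x _ h1 =>
    obtain ⟨n, r, hr, e1⟩ := h1
    obtain ⟨m, s, hs, e2⟩ := hQ a.1 a.2
    refine ⟨m + n, s * r, span_mul hs hr, ?_⟩
    rw [Subring.smul_def, smul_eq_mul]
    simp only [map_mul, e1, e2]; ring

end MM
end

section
set_option linter.all false
open AlgebraicGeometry CategoryTheory CategoryTheory.Limits
namespace MM
variable {Y : Scheme.{u}} [Y.IsSeparated]

/-- coherence of two generating sets -/
def Coh (c d : Chart Y) (G : Set Γ(Y, c.U)) (H : Set Γ(Y, d.U)) : Prop :=
  (∀ x ∈ G, rs inf_le_left x ∈ Submodule.span (QQ c d) (rs (inf_le_right : c.U ⊓ d.U ≤ _) '' H)) ∧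
  (∀ x ∈ H, rs inf_le_right x ∈ Submodule.span (QQ c d) (rs (inf_le_left : c.U ⊓ d.U ≤ _) '' G))

theorem Rel.blow {c d c' d' : Chart Y} {G : Set Γ(Y, c.U)} {H : Set Γ(Y, d.U)} {f g}
    (h : Rel c d) (C : Coh c d G H) (B : IsBlow c G f c') (B' : IsBlow d H g d') : Rel c' d' := by
  have lW : c'.U ⊓ d'.U ≤ c.U ⊓ d.U := inf_le_inf B.le B'.le
  -- the unit `g / f`
  obtain ⟨ε, hε, e1⟩ := B.exists_div_QQ B'.dom (C.2 g B'.mem)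
  have hε' : ∃ ε' ∈ QQ c' d', ε' * ε = 1 := by
    have key : ∀ z ∈ Submodule.span (QQ c d) (rs (inf_le_right : c.U ⊓ d.U ≤ d.U) '' H),
        ∃ w ∈ QQ c' d', w * rs (inf_le_right.trans B'.le) g = rs lW z := by
      intro z hz
      induction hz using Submodule.span_induction with
      | mem x hx =>
        obtain ⟨y, hy, rfl⟩ := hx
        obtain ⟨z, hz, h⟩ := B'.exists_div (Submodule.subset_span hy)
        refine ⟨rs inf_le_right z, mem_Q2_right hz, ?_⟩
        have := congrArg (rs (inf_le_right : c'.U ⊓ d'.U ≤ _)) h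
        simpa using this
      | zero => exact ⟨0, zero_mem _, by simp⟩
      | add x y _ _ hx hy =>
        obtain ⟨z, hz, h1⟩ := hx
        obtain ⟨w, hw, h2⟩ := hy
        exact ⟨z + w, add_mem hz hw, by rw [add_mul, h1, h2, map_add]⟩
      | smul a x _ hx =>
        obtain ⟨z, hz, h1⟩ := hx
        refine ⟨rs lW a.1 * z, mul_mem (B.dom.rs_mem B'.dom a.2) hz, ?_⟩
        rw [mul_assoc, h1, ← map_mul]; rfl
    obtain ⟨w, hw, e2⟩ := key _ (C.1 f B.mem)
    refine ⟨w, hw, ?_⟩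
    have u1 := B.isUnit_of_le (W := c'.U ⊓ d'.U) inf_le_left
    apply u1.mul_right_cancel
    simp only [rs_rs] at e1 e2
    rw [mul_assoc, e1, e2, one_mul]
  obtain ⟨ε', hε', e2⟩ := hε'
  simp only [rs_rs] at e1
  refine relI fun x hx => ?_
  obtain ⟨k, hk, hn⟩ := h.exists_notMem (domMap B.dom B'.dom) x
  obtain ⟨n, i, hi, e3⟩ := hk.clear_left (C.2 g B'.mem)
  obtain ⟨z, hz, e4⟩ := B.exists_div hi
  have hkc' := B.dom.choose_spec k hk.1
  have hf'P : rs B.le k * z ∈ c'.P := mul_mem hkc' hz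
  -- domain
  have d1 : Y.basicOpen (rs B.le k * z) ≤ Y.basicOpen k := by
    rw [Y.basicOpen_mul, basicOpen_rs]; exact inf_le_left.trans inf_le_right
  have d2 : Y.basicOpen (rs B.le k * z) ≤ d.U := d1.trans hk.2.choose
  have d0 : Y.basicOpen (rs B.le k * z) ≤ c'.U := Y.basicOpen_le _
  have d3 : Y.basicOpen (rs B.le k * z) ≤ d'.U := by
    rw [B'.eq]
    have a1 : Y.basicOpen (rs B.le k * z) ≤ Y.basicOpen (rs B.le i) := by
      rw [← e4, Y.basicOpen_mul, Y.basicOpen_mul]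
      refine le_inf inf_le_right ?_
      rw [basicOpen_rs, basicOpen_rs, ← B.eq, inf_idem]
      exact inf_le_left.trans inf_le_left
    have a2 : Y.basicOpen (rs (inf_le_left : c.U ⊓ d.U ≤ _) i) ≤ Y.basicOpen g := by
      rw [e3, Y.basicOpen_mul, basicOpen_rs]; exact inf_le_right.trans inf_le_right
    refine le_trans ?_ a2
    rw [basicOpen_rs] at a1 ⊢
    exact le_inf (le_inf (d0.trans B.le) d2) (a1.trans inf_le_right)
  set D := Y.basicOpen (rs B.le k * z) with hD
  have E3 := congrArg (rs (le_inf (d0.trans B.le) d2)) e3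
  have E4 := congrArg (rs d0) e4
  simp only [map_mul, map_pow, rs_rs] at E3 E4
  have uf := B.isUnit_of_le d0
  have ug := B'.isUnit_of_le d3
  refine ⟨rs B.le k * z, ⟨hf'P, d3, fun q hq => ?_⟩, ?_⟩
  · rw [B'.P_eq] at hq
    induction hq using Subring.closure_induction with
    | mem x hx =>
      rcases hx with ⟨p, hp, rfl⟩ | ⟨y, hy, ey⟩
      · obtain ⟨m, r, hr, e5⟩ := hk.exists_eq (c.hU.inf d.hU) inf_le_left inf_le_right hp
        refine ⟨m, z ^ m * rs B.le r, mul_mem (pow_mem hz _) (B.dom.choose_spec r hr), ?_⟩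
        have E5 := congrArg (rs (le_inf (d0.trans B.le) d2)) e5
        simp only [map_mul, map_pow, rs_rs] at E5 ⊢
        rw [E5]; ring
      · obtain ⟨m, i', hi', e5⟩ := hk.clear_left (C.2 y hy)
        obtain ⟨z', hz', e6⟩ := B.exists_div hi'
        refine ⟨m + 1, z ^ m * rs B.le k ^ (n + 1) * z', mul_mem (mul_mem (pow_mem hz _)
          (pow_mem hkc' _)) hz', ?_⟩
        have E5 := congrArg (rs (le_inf (d0.trans B.le) d2)) e5
        have E6 := congrArg (rs d0) e6
        have Ey := congrArg (rs d3) ey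
        simp only [map_mul, map_pow, rs_rs] at E5 E6 Ey ⊢
        apply uf.mul_right_cancel
        rw [mul_assoc, E6, E5, ← Ey]
        linear_combination (-(rs (d0.trans B.le) k) * rs d0 z ^ m * rs (d0.trans B.le) k ^ m * rs d3 x) * (E4.trans E3)
    | zero => exact ⟨0, 0, zero_mem _, by simp⟩
    | one => exact ⟨0, 1, one_mem _, by simp⟩
    | add x y _ _ h1 h2 =>
      obtain ⟨n, r, hr, e⟩ := h1
      obtain ⟨m, t, ht, e'⟩ := h2
      refine ⟨n + m, (rs B.le k * z) ^ m * r + (rs B.le k * z) ^ n * t, add_mem (mul_mem (pow_mem hf'P _) hr)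
        (mul_mem (pow_mem hf'P _) ht), ?_⟩
      simp only [map_add, map_mul, map_pow] at e e' ⊢
      rw [e, e']; ring
    | neg x _ h1 =>
      obtain ⟨n, r, hr, e⟩ := h1
      exact ⟨n, -r, neg_mem hr, by simp only [map_neg, e]; ring⟩
    | mul x y _ _ h1 h2 =>
      obtain ⟨n, r, hr, e⟩ := h1
      obtain ⟨m, t, ht, e'⟩ := h2
      refine ⟨n + m, r * t, mul_mem hr ht, ?_⟩
      simp only [map_mul, e, e']; ring
  · -- not in x
    intro hmem
    have F3 := congrArg (rs lW) e3
    have F4 := congrArg (rs (inf_le_left : c'.U ⊓ d'.U ≤ _)) e4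
    simp only [map_mul, map_pow, rs_rs] at F3 F4
    have u1 := B.isUnit_of_le (W := c'.U ⊓ d'.U) inf_le_left
    have hzε : rs inf_le_left z = rs (inf_le_left.trans B.le) k ^ n * ε := by
      apply u1.mul_right_cancel
      rw [F4, F3, mul_assoc, e1]
    let κ : QQ c' d' := domMap B.dom B'.dom ⟨rs inf_le_left k, mem_Q2_left hk.1⟩
    have hκ : κ.1 = rs (inf_le_left.trans B.le) k := by simp [κ, domMap]
    have : κ ^ (n + 1) ∈ x := by
      have := x.mul_mem_left ⟨ε', hε'⟩ hmem
      refine (congrArg (· ∈ x) (Subtype.ext ?_)).mp this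
      simp only [Subring.coe_mul, map_mul, rs_rs, Subring.coe_pow, hκ, hzε]
      linear_combination (rs (inf_le_left.trans B.le) k) ^ (n+1) * e2
    exact hn (hx.mem_of_pow_mem _ this)

end MM
end

section
set_option linter.all false
open AlgebraicGeometry CategoryTheory CategoryTheory.Limits
namespace MM
variable {Y : Scheme.{u}} [Y.IsSeparated]

variable {R : Type u} [CommRing R] (ρ : R →+* Γ(Y, ⊤)) (w : R)

/-- base ring in sections -/
noncomputable def bs (U : Y.Opens) : R →+* Γ(Y, U) := (rs le_top).comp ρ

@[simp] lemma rs_bs {U W : Y.Opens} (h : W ≤ U) (r : R) : rs h (bs ρ U r) = bs ρ W r := by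
  simp [bs]

/-- contains the base -/
def Base (c : Chart Y) : Prop := ∀ r, bs ρ c.U r ∈ c.P

/-- invert `w` -/
noncomputable abbrev sat (c : Chart Y) : Chart Y :=
  ⟨c.U, c.hU, Subring.closure (c.P ∪ {z | z * bs ρ c.U w = 1})⟩

lemma le_sat (c : Chart Y) : c.P ≤ (sat ρ w c).P := fun _ hx => Subring.subset_closure (.inl hx)

lemma mem_sat {c : Chart Y} (hc : Base ρ c) {x : Γ(Y, c.U)} (hx : x ∈ (sat ρ w c).P) :
    ∃ n, bs ρ c.U w ^ n * x ∈ c.P := by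
  have hw := hc w
  unfold sat at hx
  induction hx using Subring.closure_induction with
  | mem x hx =>
    rcases hx with hx | hx
    · exact ⟨0, by simpa using hx⟩
    · exact ⟨1, by rw [pow_one, mul_comm, hx]; exact one_mem _⟩
  | zero => exact ⟨0, by simp⟩
  | one => exact ⟨0, by simp⟩
  | add x y _ _ h1 h2 =>
    obtain ⟨n, h1⟩ := h1
    obtain ⟨m, h2⟩ := h2
    refine ⟨n + m, ?_⟩
    have := add_mem (mul_mem (pow_mem hw m) h1) (mul_mem (pow_mem hw n) h2)
    convert this using 1; ring
  | neg x _ h1 =>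
    obtain ⟨n, h1⟩ := h1
    exact ⟨n, by rw [mul_neg]; exact neg_mem h1⟩
  | mul x y _ _ h1 h2 =>
    obtain ⟨n, h1⟩ := h1
    obtain ⟨m, h2⟩ := h2
    refine ⟨n + m, ?_⟩
    convert mul_mem h1 h2 using 1; ring

variable (hu : IsUnit (ρ w))
include hu

lemma isUnit_bs (U : Y.Opens) : IsUnit (bs ρ U w) := hu.map (rs le_top)

lemma mem_sat_of {c : Chart Y} {x : Γ(Y, c.U)} {n : ℕ} (h : bs ρ c.U w ^ n * x ∈ (sat ρ w c).P) :
    x ∈ (sat ρ w c).P := by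
  obtain ⟨v, hv⟩ := isUnit_bs ρ w hu c.U
  have hm : (v⁻¹ : _ˣ).1 ∈ (sat ρ w c).P := Subring.subset_closure (.inr (by
    change _ * _ = _
    rw [← hv]; simp))
  have := mul_mem (pow_mem hm n) h
  rw [← hv, ← mul_assoc, ← mul_pow] at this
  simpa using this
omit hu

lemma Dom.sat {c' c : Chart Y} (h : Dom c' c) : Dom (sat ρ w c') (sat ρ w c) := by
  obtain ⟨h, H⟩ := h
  refine ⟨h, fun p hp => ?_⟩
  have : (MM.sat ρ w c).P ≤ (MM.sat ρ w c').P.comap (rs h) := by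
    refine Subring.closure_le.mpr ?_
    rintro x (hx | hx)
    · exact le_sat ρ w _ (H x hx)
    · refine Subring.subset_closure (.inr ?_)
      have := congrArg (rs h) hx
      simpa using this
  exact this hp

/-- compatibility after inverting `w` -/
def RelU (c d : Chart Y) : Prop := Rel (sat ρ w c) (sat ρ w d)

lemma IsBlow.self (c : Chart Y) {f} (hf : f ∈ c.P) (h : Y.basicOpen f = c.U) : IsBlow c {f} f c := by
  refine ⟨by simpa using hf, rfl, h.symm, le_antisymm ?_ ?_⟩
  · intro x hx
    exact Subring.subset_closure (.inl ⟨x, hx, by simp⟩)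
  · refine Subring.closure_le.mpr ?_
    rintro x (⟨x, hx, rfl⟩ | ⟨g, rfl, hx⟩)
    · simpa using hx
    · have : IsUnit (rs (h.symm.trans_le (Y.basicOpen_le g)) g) := isUnit_rs_basicOpen g _ h.ge
      have : x = 1 := this.mul_right_cancel (by rw [hx, one_mul])
      rw [this]; exact one_mem _

include hu in
lemma IsBlow.sat {c c' : Chart Y} {G f} (B : IsBlow c G f c') {e : ℕ}
    (he : bs ρ c.U w ^ e ∈ Submodule.span c.P G) :
    IsBlow (sat ρ w c) {f, 1} f (sat ρ w c') := by
  refine ⟨?_, by simp, B.eq, ?_⟩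
  · rintro x (rfl | rfl)
    · exact le_sat ρ w c (B.sub B.mem)
    · exact one_mem _
  have hle : (MM.sat ρ w c').U ≤ (MM.sat ρ w c).U := B.le
  apply le_antisymm
  · refine Subring.closure_le.mpr ?_
    have h1 : c'.P ≤ Subring.closure (rs hle '' (MM.sat ρ w c).P ∪
        {z | ∃ g ∈ ({f, 1} : Set Γ(Y, (MM.sat ρ w c).U)), z * rs hle f = rs hle g}) := by
      rw [B.P_eq]
      refine Subring.closure_le.mpr ?_
      rintro x (⟨x, hx, rfl⟩ | ⟨g, hg, hx⟩)
      · exact Subring.subset_closure (.inl ⟨x, le_sat ρ w _ hx, rfl⟩)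
      · obtain ⟨v, hv⟩ := B.isUnit
        have h1 : (v⁻¹ : _ˣ).1 ∈ Subring.closure (rs hle '' (MM.sat ρ w c).P ∪
          {z | ∃ g ∈ ({f, 1} : Set Γ(Y, (MM.sat ρ w c).U)), z * rs hle f = rs hle g}) := by
          refine Subring.subset_closure (.inr ⟨1, by simp, ?_⟩)
          rw [map_one]
          change _ * rs B.le f = 1
          rw [← hv]; simp
        have h2 : rs hle g ∈ Subring.closure (rs hle '' (MM.sat ρ w c).P ∪
          {z | ∃ g ∈ ({f, 1} : Set Γ(Y, (MM.sat ρ w c).U)), z * rs hle f = rs hle g}) :=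
          Subring.subset_closure (.inl ⟨g, le_sat ρ w _ (B.sub hg), rfl⟩)
        have : x = rs hle g * (v⁻¹ : _ˣ).1 := by
          change x * rs B.le f = rs B.le g at hx
          change x = rs B.le g * _
          rw [← hx, ← hv]; simp
        rw [SetLike.mem_coe, this]
        exact mul_mem h2 h1
    rintro x (hx | hx)
    · exact h1 hx
    · obtain ⟨v, hv⟩ := isUnit_bs ρ w hu c.U
      refine Subring.subset_closure (.inl ⟨(v⁻¹ : _ˣ).1, Subring.subset_closure (.inr ?_), ?_⟩)
      · change _ * _ = _
        rw [← hv]; simp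
      · apply (isUnit_bs ρ w hu c'.U).mul_right_cancel
        rw [hx, ← rs_bs ρ B.le]
        change rs B.le _ * rs B.le _ = _
        rw [← map_mul, ← hv]; simp
  · refine Subring.closure_le.mpr ?_
    rintro x (⟨x, hx, rfl⟩ | ⟨g, rfl | rfl, hx⟩)
    · exact (B.dom.sat ρ w).choose_spec x hx
    · have : x = 1 := B.isUnit.mul_right_cancel (by rw [one_mul]; exact hx)
      rw [this]; exact one_mem _
    · obtain ⟨z, hz, h1⟩ := B.exists_div he
      refine mem_sat_of ρ w hu (n := e) ?_
      have : bs ρ c'.U w ^ e * x = z := by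
        apply B.isUnit.mul_right_cancel
        rw [h1, mul_assoc]
        change x * rs B.le f = rs B.le 1 at hx
        rw [hx]; simp
      change bs ρ c'.U w ^ e * x ∈ _
      rw [this]
      exact le_sat ρ w _ hz

lemma RelU.left {c' c d : Chart Y} (h : RelU ρ w c d) (H : Dom c' c) : RelU ρ w c' d :=
  Rel.dom h (H.sat ρ w)

lemma basicOpen_one' {U : Y.Opens} : Y.basicOpen (1 : Γ(Y, U)) = U :=
  Y.basicOpen_of_isUnit isUnit_one

include hu in
lemma RelU.right {d c c' : Chart Y} {G f} (h : RelU ρ w d c) (B : IsBlow c G f c') {e : ℕ}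
    (he : bs ρ c.U w ^ e ∈ Submodule.span c.P G) : RelU ρ w d c' := by
  refine Rel.blow h ⟨?_, ?_⟩ (IsBlow.self _ (f := 1) (one_mem _) basicOpen_one') (B.sat ρ w hu he)
  · rintro _ rfl
    exact Submodule.subset_span ⟨1, by simp, by simp⟩
  · intro x hx
    have h1 : rs inf_le_right x = rs inf_le_right x * rs (inf_le_left : (MM.sat ρ w d).U ⊓ (MM.sat ρ w c).U ≤ _) 1 := by
      rw [map_one, mul_one]
    rw [h1]
    exact span_mul (mem_Q2_right ((B.sat ρ w hu he).sub hx)) (Submodule.subset_span ⟨1, rfl, rfl⟩)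

/-- finite type -/
def FT (c : Chart Y) : Prop := ∃ s : Set Γ(Y, c.U), s.Finite ∧
  c.P = Subring.closure (Set.range (bs ρ c.U) ∪ s)

lemma FT.base {c : Chart Y} (h : FT ρ c) : Base ρ c := by
  obtain ⟨s, -, h⟩ := h
  intro r
  rw [h]; exact Subring.subset_closure (.inl ⟨r, rfl⟩)

lemma IsBlow.ft {c c' : Chart Y} {G f} (B : IsBlow c G f c') (h : FT ρ c) (hG : G.Finite) :
    FT ρ c' := by
  obtain ⟨s, hs, h⟩ := h
  obtain ⟨v, hv⟩ := B.isUnit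
  refine ⟨rs B.le '' s ∪ (fun g => rs B.le g * (v⁻¹ : _ˣ).1) '' G, (hs.image _).union (hG.image _), ?_⟩
  rw [B.P_eq]
  apply le_antisymm
  · refine Subring.closure_le.mpr ?_
    rintro x (⟨x, hx, rfl⟩ | ⟨g, hg, hx⟩)
    · have : c.P ≤ (Subring.closure (Set.range (bs ρ c'.U) ∪ (rs B.le '' s ∪ (fun g => rs B.le g * (v⁻¹ : _ˣ).1) '' G))).comap
          (rs B.le) := by
        rw [h]
        refine Subring.closure_le.mpr ?_
        rintro x (⟨r, rfl⟩ | hx)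
        · exact Subring.subset_closure (.inl ⟨r, by simp⟩)
        · exact Subring.subset_closure (.inr (.inl ⟨x, hx, rfl⟩))
      exact this hx
    · refine Subring.subset_closure (.inr (.inr ⟨g, hg, ?_⟩))
      change rs B.le g * _ = x
      rw [← hx, ← hv]; simp
  · refine Subring.closure_le.mpr ?_
    rintro x (⟨r, rfl⟩ | ⟨x, hx, rfl⟩ | ⟨g, hg, rfl⟩)
    · refine Subring.subset_closure (.inl ⟨bs ρ c.U r, ?_, by simp⟩)
      rw [h]; exact Subring.subset_closure (.inl ⟨r, rfl⟩)
    · refine Subring.subset_closure (.inl ⟨x, ?_, rfl⟩)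
      rw [h]; exact Subring.subset_closure (.inr hx)
    · refine Subring.subset_closure (.inr ⟨g, hg, ?_⟩)
      rw [← hv]; simp

/-- closure under blow-ups -/
inductive Cl (E : Set (Chart Y)) : Chart Y → Prop
  | base {c} : c ∈ E → Cl E c
  | step {c c' : Chart Y} {G : Set Γ(Y, c.U)} {f} {e : ℕ} : Cl E c → G.Finite →
      bs ρ c.U w ^ e ∈ Submodule.span c.P G → IsBlow c G f c' → Cl E c'

lemma Cl.ft {E : Set (Chart Y)} (hE : ∀ c ∈ E, FT ρ c) {c} (h : Cl ρ w E c) : FT ρ c := by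
  induction h with
  | base h => exact hE _ h
  | step _ hG _ B ih => exact B.ft ρ ih hG

include hu in
lemma Cl.relU {E : Set (Chart Y)} (hE : ∀ c ∈ E, ∀ d ∈ E, RelU ρ w c d) {c d} (h : Cl ρ w E c)
    (h' : Cl ρ w E d) : RelU ρ w c d := by
  induction h with
  | base hc =>
    induction h' with
    | base hd => exact hE _ hc _ hd
    | step _ _ he B ih => exact ih.right ρ w hu B he
  | step _ _ _ B ih => exact ih.left ρ w B.dom

/-- the blow-up chart -/
noncomputable def blow (c : Chart Y) (G : Set Γ(Y, c.U)) (f : Γ(Y, c.U)) : Chart Y :=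
  ⟨Y.basicOpen f, c.hU.basicOpen f, Subring.closure (rs (Y.basicOpen_le f) '' c.P ∪
    {z | ∃ g ∈ G, z * rs (Y.basicOpen_le f) f = rs (Y.basicOpen_le f) g})⟩

lemma isBlow_blow {c : Chart Y} {G : Set Γ(Y, c.U)} {f} (h : G ⊆ c.P) (hf : f ∈ G) : IsBlow c G f (blow c G f) :=
  ⟨h, hf, rfl, rfl⟩

/-- coherent families -/
structure CohFam (N : Set (Chart Y)) (G : ∀ c : Chart Y, Set Γ(Y, c.U)) : Prop where
  sub : ∀ c ∈ N, G c ⊆ c.P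
  fin : ∀ c ∈ N, (G c).Finite
  coh : ∀ c ∈ N, ∀ d ∈ N, Coh c d (G c) (G d)
  unit : ∃ e : ℕ, ∀ c ∈ N, bs ρ c.U w ^ e ∈ Submodule.span c.P (G c)

/-- blow-up of a model -/
def bl (N : Set (Chart Y)) (G : ∀ c : Chart Y, Set Γ(Y, c.U)) : Set (Chart Y) :=
  ⋃ c ∈ N, blow c (G c) '' G c

/-- model -/
def Model (N : Set (Chart Y)) : Prop := N.Finite ∧ ∀ c ∈ N, ∀ d ∈ N, Rel c d

variable {ρ w} in
lemma CohFam.exists {N : Set (Chart Y)} {G} (C : CohFam ρ w N G) {c'} (h : c' ∈ bl N G) :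
    ∃ c ∈ N, ∃ f, IsBlow c (G c) f c' := by
  simp only [bl, Set.mem_iUnion] at h
  obtain ⟨c, hc, f, hf, rfl⟩ := h
  exact ⟨c, hc, f, isBlow_blow (C.sub c hc) hf⟩

variable {ρ w} in
lemma CohFam.model {N : Set (Chart Y)} {G} (C : CohFam ρ w N G) (h : Model N) : Model (bl N G) := by
  refine ⟨h.1.biUnion fun c hc => (C.fin c hc).image _, fun c' hc' d' hd' => ?_⟩
  obtain ⟨c, hc, f, B⟩ := C.exists hc'
  obtain ⟨d, hd, g, B'⟩ := C.exists hd'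
  exact (h.2 c hc d hd).blow (C.coh c hc d hd) B B'

variable {ρ w} in
lemma CohFam.cl {N E : Set (Chart Y)} {G} (C : CohFam ρ w N G) (h : ∀ c ∈ N, Cl ρ w E c) :
    ∀ c ∈ bl N G, Cl ρ w E c := by
  intro c' hc'
  obtain ⟨c, hc, f, B⟩ := C.exists hc'
  obtain ⟨e, he⟩ := C.unit
  exact .step (h c hc) (C.fin c hc) (he c hc) B

end MM
end

section
set_option linter.all false
open AlgebraicGeometry CategoryTheory CategoryTheory.Limits
namespace MM
variable {Y : Scheme.{u}} [Y.IsSeparated]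
variable {R : Type u} [CommRing R] (ρ : R →+* Γ(Y, ⊤)) (w : R)

lemma FT.noeth [IsNoetherianRing R] {c : Chart Y} (h : FT ρ c) : IsNoetherianRing c.P := by
  obtain ⟨s, hs, h⟩ := h
  letI := (bs ρ c.U).toAlgebra
  obtain ⟨s, rfl⟩ := hs.exists_finset_coe
  have : Algebra.FiniteType R (Algebra.adjoin R (s : Set Γ(Y, c.U))) :=
    (Subalgebra.fg_iff_finiteType _).mp (Subalgebra.fg_adjoin_finset s)
  have := Algebra.FiniteType.isNoetherianRing R (Algebra.adjoin R (s : Set Γ(Y, c.U)))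
  have e : c.P = (Algebra.adjoin R (s : Set Γ(Y, c.U))).toSubring := by
    rw [h, Algebra.adjoin_eq_ring_closure]; rfl
  rw [e]; exact this

lemma exists_finite_span {T : Type*} [CommRing T] {P : Subring T} [IsNoetherianRing P] {S : Set T}
    (hS : S ⊆ P) : ∃ G ⊆ S, G.Finite ∧ ∀ x ∈ S, x ∈ Submodule.span P G := by
  have h1 : (Submodule.span P S).FG := by
    have : Submodule.span P S = (Submodule.span P (P.subtype ⁻¹' S : Set P)).map
        (Algebra.linearMap P T) := by
      rw [Submodule.map_span]
      congr 1
      ext x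
      constructor
      · intro hx; exact ⟨⟨x, hS hx⟩, hx, rfl⟩
      · rintro ⟨y, hy, rfl⟩; exact hy
    rw [this]
    exact (IsNoetherian.noetherian _).map _
  obtain ⟨G, hG, e⟩ := (Submodule.fg_span_iff_fg_span_finset_subset S).mp h1
  exact ⟨G, hG, G.finite_toSet, fun x hx => e ▸ Submodule.subset_span hx⟩

lemma QQ_rs {c d : Chart Y} {W : Y.Opens} (h : W ≤ c.U ⊓ d.U) {S : Subring Γ(Y, W)}
    (h1 : ∀ p ∈ c.P, rs (h.trans inf_le_left) p ∈ S) (h2 : ∀ p ∈ d.P, rs (h.trans inf_le_right) p ∈ S) :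
    ∀ q ∈ QQ c d, rs h q ∈ S := by
  have : QQ c d ≤ S.comap (rs h) := Q2_le (fun p hp => by simpa using h1 p hp)
    (fun p hp => by simpa using h2 p hp)
  exact fun q hq => this hq

lemma span_swap {b d : Chart Y} {S : Set Γ(Y, d.U)} {z}
    (hz : z ∈ Submodule.span (QQ d b) (rs (inf_le_left : d.U ⊓ b.U ≤ _) '' S)) :
    rs (le_inf inf_le_right inf_le_left : b.U ⊓ d.U ≤ d.U ⊓ b.U) z ∈
      Submodule.span (QQ b d) (rs (inf_le_right : b.U ⊓ d.U ≤ _) '' S) := by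
  refine span_transport _ (QQ_rs _ (fun p hp => mem_Q2_right hp) (fun p hp => mem_Q2_left hp)) ?_ hz
  rintro _ ⟨s, hs, rfl⟩
  exact Submodule.subset_span ⟨s, hs, by simp⟩

variable {ρ w} in
lemma CohFam.mk' [IsNoetherianRing R] {N : Set (Chart Y)} (hM : Model N) (hN : ∀ c ∈ N, FT ρ c)
    (S : ∀ c : Chart Y, Set Γ(Y, c.U)) (hS : ∀ c ∈ N, S c ⊆ c.P)
    (H : ∀ b ∈ N, ∀ d ∈ N, ∀ g, Good b d g → ∀ x ∈ S d, ∃ k, ∃ y ∈ S b,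
      rs inf_le_left y = rs inf_le_left g ^ k * rs (inf_le_right : b.U ⊓ d.U ≤ _) x)
    (hw : ∃ e : ℕ, ∀ c ∈ N, bs ρ c.U w ^ e ∈ S c) :
    ∃ G, CohFam ρ w N G ∧ (∀ c ∈ N, G c ⊆ S c) ∧ ∀ c ∈ N, ∀ x ∈ S c, x ∈ Submodule.span c.P (G c) := by
  have : ∀ c : Chart Y, ∃ G : Set Γ(Y, c.U), c ∈ N → G ⊆ S c ∧ G.Finite ∧
      ∀ x ∈ S c, x ∈ Submodule.span c.P G := by
    intro c
    by_cases hc : c ∈ N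
    · have := (hN c hc).noeth
      obtain ⟨G, h⟩ := exists_finite_span (hS c hc)
      exact ⟨G, fun _ => h⟩
    · exact ⟨∅, fun h => (hc h).elim⟩
  choose G hG using this
  have key : ∀ b ∈ N, ∀ d ∈ N, ∀ x ∈ G d, rs inf_le_right x ∈
      Submodule.span (QQ b d) (rs (inf_le_left : b.U ⊓ d.U ≤ _) '' G b) := by
    intro b hb d hd x hx
    refine colon_local (hM.2 b hb d hd) _ _ fun g hg => ?_
    obtain ⟨k, y, hy, e⟩ := H b hb d hd g hg x ((hG d hd).1 hx)
    refine ⟨k, ?_⟩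
    rw [← e]
    exact span_transport (Q' := QQ b d) (S' := rs inf_le_left '' G b) (rs inf_le_left) (fun q hq => mem_Q2_left hq)
      (fun s hs => Submodule.subset_span ⟨s, hs, rfl⟩) ((hG b hb).2.2 y hy)
  refine ⟨G, ⟨fun c hc => (hG c hc).1.trans (hS c hc), fun c hc => (hG c hc).2.1,
    fun b hb d hd => ⟨fun x hx => ?_, key b hb d hd⟩, ?_⟩,
    fun c hc => (hG c hc).1, fun c hc => (hG c hc).2.2⟩
  · simpa using span_swap (key d hd b hb x hx)
  · obtain ⟨e, he⟩ := hw
    exact ⟨e, fun c hc => (hG c hc).2.2 _ (he c hc)⟩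

/-- pulled back ideal -/
def pullI (M : Set (Chart Y)) (J : ∀ c : Chart Y, Set Γ(Y, c.U)) (b : Chart Y) : Set Γ(Y, b.U) :=
  {f | f ∈ b.P ∧ ∀ a ∈ M, rs (inf_le_left : b.U ⊓ a.U ≤ _) f ∈
    Submodule.span (QQ b a) (rs (inf_le_right : b.U ⊓ a.U ≤ _) '' J a)}

/-- uniform exponent -/
lemma exists_uniform {α : Type*} {s : Set α} (hs : s.Finite) (p : α → ℕ → Prop)
    (hm : ∀ a ∈ s, ∀ n m, n ≤ m → p a n → p a m) (h : ∀ a ∈ s, ∃ n, p a n) :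
    ∃ n, ∀ a ∈ s, p a n := by
  induction s, hs using Set.Finite.induction_on with
  | empty => exact ⟨0, by simp⟩
  | insert ha hs ih =>
    obtain ⟨n, hn⟩ := ih (fun a h' => hm a (.inr h')) (fun a h' => h a (.inr h'))
    obtain ⟨m, hm'⟩ := h _ (.inl rfl)
    refine ⟨max n m, ?_⟩
    rintro b (rfl | hb)
    · exact hm _ (.inl rfl) _ _ (le_max_right _ _) hm'
    · exact hm _ (.inr hb) _ _ (le_max_left _ _) (hn b hb)

lemma pullI_good {M : Set (Chart Y)} (hM : M.Finite) {J : ∀ c : Chart Y, Set Γ(Y, c.U)} {b d : Chart Y}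
    {g} (hg : Good b d g) {x} (hx : x ∈ pullI M J d) : ∃ k, ∃ y ∈ pullI M J b,
      rs inf_le_left y = rs inf_le_left g ^ k * rs (inf_le_right : b.U ⊓ d.U ≤ _) x := by
  obtain ⟨n, p, hp, e⟩ := hg.exists_eq (b.hU.inf d.hU) inf_le_left inf_le_right hx.1
  obtain ⟨k, hk⟩ := exists_uniform hM (fun a k => rs (inf_le_left : b.U ⊓ a.U ≤ _) (g ^ k * p) ∈
    Submodule.span (QQ b a) (rs (inf_le_right : b.U ⊓ a.U ≤ _) '' J a))
    (fun a ha n m hnm h => by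
      obtain ⟨l, rfl⟩ := Nat.exists_eq_add_of_le hnm
      rw [add_comm, pow_add, mul_assoc, map_mul]
      exact span_mul (mem_Q2_left (pow_mem hg.1 _)) h)
    (fun a ha => hg.clear (hx.2 a ha) (n := n) fun T hb hd he => by
      have := congrArg (rs (le_inf hb hd)) e
      simpa using this)
  refine ⟨k + n, g ^ k * p, ⟨mul_mem (pow_mem hg.1 _) hp, hk⟩, ?_⟩
  rw [map_mul, e, map_pow, pow_add, mul_assoc]

variable {ρ w} in
/-- transfer of a coherent blow-up -/
lemma transfer [IsNoetherianRing R] {N M : Set (Chart Y)} (hN : Model N) (hM : Model M)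
    (hF : ∀ c ∈ N, FT ρ c) (hFM : ∀ c ∈ M, FT ρ c)
    (hR : ∀ c ∈ N, ∀ d ∈ M, Rel c d) {J} (hJ : CohFam ρ w M J) :
    ∃ G, CohFam ρ w N G ∧ (∀ c ∈ bl N G, ∀ d ∈ bl M J, Rel c d) ∧
      ∀ t : Chart Y, (∃ d ∈ bl M J, Dom t d) → (∀ c ∈ N, Rel t c) → ∀ c ∈ bl N G, Rel t c := by
  obtain ⟨G, hG, hG1, hG2⟩ := CohFam.mk' (w := w) hN hF (pullI M J) (fun c hc x hx => hx.1)
    (fun b hb d hd g hg x hx => pullI_good hM.1 hg hx) (by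
      obtain ⟨e, he⟩ := hJ.unit
      refine ⟨e, fun c hc => ⟨pow_mem ((hF c hc).base ρ w) _, fun a ha => ?_⟩⟩
      have := span_transport (Q' := QQ c a) (S' := rs inf_le_right '' J a) (rs inf_le_right)
        (fun q hq => mem_Q2_right hq)
        (fun s hs => Submodule.subset_span ⟨s, hs, rfl⟩) (he a ha)
      simpa using this)
  have hC : ∀ b ∈ N, ∀ a ∈ M, Coh b a (G b) (J a) := by
    intro b hb a ha
    refine ⟨fun x hx => (hG1 b hb hx).2 a ha, fun x hx => ?_⟩
    refine colon_local (hR b hb a ha) _ _ fun g hg => ?_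
    obtain ⟨k, y, hy, e⟩ := pullI_good (x := x) hM.1 hg (J := J)
      ⟨hJ.sub a ha hx, fun a' ha' => (hJ.coh a ha a' ha').1 x hx⟩
    refine ⟨k, ?_⟩
    rw [← e]
    exact span_transport (Q' := QQ b a) (S' := rs inf_le_left '' G b) (rs inf_le_left) (fun q hq => mem_Q2_left hq)
      (fun s hs => Submodule.subset_span ⟨s, hs, rfl⟩) (hG2 b hb y hy)
  refine ⟨G, hG, fun c hc d hd => ?_, fun t ht hR' c' hc' => ?_⟩
  · obtain ⟨b, hb, f, B⟩ := hG.exists hc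
    obtain ⟨a, ha, g, B'⟩ := hJ.exists hd
    exact (hR b hb a ha).blow (hC b hb a ha) B B'
  · obtain ⟨b, hb, f, B⟩ := hG.exists hc'
    obtain ⟨d, hd, hle, hD⟩ := ht
    obtain ⟨a, ha, g, B'⟩ := hJ.exists hd
    have hla : t.U ≤ a.U := hle.trans B'.le
    have hDa : ∀ p ∈ a.P, rs hla p ∈ t.P := fun p hp => by
      have := hD _ (B'.dom.choose_spec p hp)
      simpa using this
    have hg : rs hla g ∈ t.P := hDa _ (B'.sub B'.mem)
    have hQ : ∀ q ∈ QQ b a, rs (le_inf inf_le_right (inf_le_left.trans hla) : t.U ⊓ b.U ≤ _) q ∈ QQ t b :=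
      QQ_rs _ (fun p hp => mem_Q2_right hp) (fun p hp => by
        have := mem_Q2_left (d := b) (h := inf_le_left) (h' := inf_le_right) (hDa p hp)
        simpa using this)
    refine (hR' b hb).blow ⟨?_, ?_⟩ (IsBlow.self t hg ?_) B
    · rintro _ rfl
      have := span_transport (S' := rs inf_le_right '' G b) _ hQ (by
        rintro _ ⟨s, hs, rfl⟩
        exact Submodule.subset_span ⟨s, hs, by simp⟩) ((hC b hb a ha).2 g B'.mem)
      simpa using this
    · intro x hx
      have := span_transport (S' := rs inf_le_left '' {rs hla g}) _ hQ (by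
        rintro _ ⟨s, hs, rfl⟩
        obtain ⟨z, hz, e⟩ := B'.exists_div (Submodule.subset_span hs)
        have e' := congrArg (rs (inf_le_left.trans hle : t.U ⊓ b.U ≤ d.U)) e
        simp only [map_mul, rs_rs] at e'
        rw [rs_rs, ← e']
        refine span_mul ?_ (Submodule.subset_span ⟨_, rfl, by simp⟩)
        have := mem_Q2_left (d := b) (h := inf_le_left) (h' := inf_le_right) (hD z hz)
        simpa using this) ((hC b hb a ha).1 x hx)
      simpa using this
    · exact (basicOpen_rs hla g).trans (inf_eq_left.mpr (hle.trans B'.eq.le))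

end MM
end

section
set_option linter.all false
open AlgebraicGeometry CategoryTheory CategoryTheory.Limits
namespace MM
variable {Y : Scheme.{u}} [Y.IsSeparated]
variable {R : Type u} [CommRing R] (ρ : R →+* Γ(Y, ⊤)) (w : R)

/-- denominators with companions -/
def Den (M : Chart Y) (X : Set Γ(Y, M.U)) (b : Chart Y) : Set (Γ(Y, M.U) → Γ(Y, b.U)) :=
  {α | Y.basicOpen (α 1) ≤ M.U ∧ ∀ x ∈ X, α x ∈ b.P ∧
    rs (inf_le_left : b.U ⊓ M.U ≤ _) (α x) = rs inf_le_right x * rs inf_le_left (α 1)}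

lemma Good.exists_uniform {b d : Chart Y} {g} (hg : Good b d g) {W : Y.Opens} (hW : IsAffineOpen W)
    (hb : W ≤ b.U) (hd : W ≤ d.U) {ι : Type*} {X : Set ι} (hX : X.Finite) (q : ι → Γ(Y, d.U))
    (hq : ∀ x ∈ X, q x ∈ d.P) : ∃ n, ∃ p : ι → Γ(Y, b.U), ∀ x ∈ X, p x ∈ b.P ∧
      rs hb (p x) = rs hb g ^ n * rs hd (q x) := by
  obtain ⟨n, hn⟩ := MM.exists_uniform hX (fun x n => ∃ p ∈ b.P, rs hb p = rs hb g ^ n * rs hd (q x))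
    (fun x hx n m hnm ⟨p, hp, e⟩ => by
      obtain ⟨l, rfl⟩ := Nat.exists_eq_add_of_le hnm
      refine ⟨g ^ l * p, mul_mem (pow_mem hg.1 _) hp, ?_⟩
      rw [map_mul, e, map_pow, add_comm, pow_add, mul_assoc])
    (fun x hx => hg.exists_eq hW hb hd (hq x hx))
  choose! p hp using hn
  exact ⟨n, p, hp⟩

lemma Den.good {M : Chart Y} {X : Set Γ(Y, M.U)} (hX : X.Finite) (h1 : 1 ∈ X) {b d : Chart Y} {g}
    (hg : Good b d g) {α} (hα : α ∈ Den M X d) : ∃ k, ∃ β ∈ Den M X b, ∀ x ∈ X,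
      rs inf_le_left (β x) = rs inf_le_left g ^ k * rs (inf_le_right : b.U ⊓ d.U ≤ _) (α x) := by
  obtain ⟨n, p, hp⟩ := hg.exists_uniform (b.hU.inf d.hU) inf_le_left inf_le_right hX α
    (fun x hx => (hα.2 x hx).1)
  have hT1 : b.U ⊓ M.U ⊓ d.U ≤ b.U ⊓ d.U := le_inf (inf_le_left.trans inf_le_left) inf_le_right
  have hT2 : b.U ⊓ M.U ⊓ d.U ≤ d.U ⊓ M.U := le_inf inf_le_right (inf_le_left.trans inf_le_right)
  obtain ⟨j, hj⟩ := exists_uniform hX (fun x j => rs (inf_le_left : b.U ⊓ M.U ≤ _) g ^ j * rs inf_le_left (p x) =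
      rs inf_le_left g ^ j * (rs inf_le_right x * rs inf_le_left (p 1)))
    (fun x hx n m hnm e => by
      obtain ⟨l, rfl⟩ := Nat.exists_eq_add_of_le hnm
      rw [add_comm, pow_add, mul_assoc, e, mul_assoc])
    (fun x hx => by
      refine eq_of_rs_basicOpen (b.hU.inf M.hU) _ _ _ (inf_le_left : b.U ⊓ M.U ⊓ d.U ≤ _) ?_ ?_
      · rw [basicOpen_rs]
        exact le_inf inf_le_left (inf_le_right.trans hg.2.choose)
      · have e1 := congrArg (rs hT1) (hp x hx).2
        have e2 := congrArg (rs hT1) (hp 1 h1).2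
        have e3 := congrArg (rs hT2) (hα.2 x hx).2
        simp only [map_mul, map_pow, rs_rs] at e1 e2 e3 ⊢
        rw [e1, e2, e3]; ring)
  refine ⟨j + 1 + n, fun x => g ^ (j + 1) * p x, ⟨?_, fun x hx => ⟨mul_mem (pow_mem hg.1 _) (hp x hx).1, ?_⟩⟩,
    fun x hx => ?_⟩
  · have e := congrArg Y.basicOpen (hp 1 h1).2
    simp only [basicOpen_rs, Y.basicOpen_mul] at e ⊢
    have h2 : Y.basicOpen (g ^ (j + 1)) ≤ Y.basicOpen g := by
      rw [pow_succ, Y.basicOpen_mul]; exact inf_le_right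
    have h3 : Y.basicOpen (g ^ (j + 1)) ⊓ Y.basicOpen (p 1) ≤ b.U ⊓ d.U ⊓ Y.basicOpen (p 1) :=
      le_inf (le_inf (inf_le_left.trans (Y.basicOpen_le _)) (inf_le_left.trans (h2.trans hg.2.choose))) inf_le_right
    refine h3.trans (e.le.trans (inf_le_right.trans (inf_le_right.trans hα.1)))
  · simp only [map_mul, map_pow, pow_succ]
    linear_combination rs inf_le_left g * hj x hx
  · simp only [map_mul, map_pow, (hp x hx).2]; ring

lemma exists_pow_mem_QQ {b M : Chart Y} (hb : Base ρ b) (hM : Base ρ M) {q : Γ(Y, b.U ⊓ M.U)}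
    (hq : q ∈ QQ (sat ρ w b) (sat ρ w M)) : ∃ e, bs ρ (b.U ⊓ M.U) w ^ e * q ∈ QQ b M := by
  have hw : bs ρ (b.U ⊓ M.U) w ∈ QQ b M := by
    have := mem_Q2_left (d := M) (h := inf_le_left) (h' := inf_le_right) (hb w)
    simpa using this
  unfold QQ Q2 at hq
  induction hq using Subring.closure_induction with
  | mem x hx =>
    rcases hx with ⟨p, hp, rfl⟩ | ⟨p, hp, rfl⟩
    · obtain ⟨n, hn⟩ := mem_sat ρ w hb hp
      refine ⟨n, ?_⟩
      have := mem_Q2_left (d := M) (h := inf_le_left) (h' := inf_le_right) hn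
      simpa using this
    · obtain ⟨n, hn⟩ := mem_sat ρ w hM hp
      refine ⟨n, ?_⟩
      have := mem_Q2_right (c := b) (h := inf_le_left) (h' := inf_le_right) hn
      simpa using this
  | zero => exact ⟨0, by simp⟩
  | one => exact ⟨0, by simp⟩
  | add x y _ _ h1 h2 =>
    obtain ⟨n, h1⟩ := h1
    obtain ⟨m, h2⟩ := h2
    refine ⟨n + m, ?_⟩
    have := add_mem (mul_mem (pow_mem hw m) h1) (mul_mem (pow_mem hw n) h2)
    convert this using 1; ring
  | neg x _ h1 =>
    obtain ⟨n, h1⟩ := h1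
    exact ⟨n, by rw [mul_neg]; exact neg_mem h1⟩
  | mul x y _ _ h1 h2 =>
    obtain ⟨n, h1⟩ := h1
    obtain ⟨m, h2⟩ := h2
    refine ⟨n + m, ?_⟩
    convert mul_mem h1 h2 using 1; ring

lemma exists_pow_mem_span {b M : Chart Y} (hb : Base ρ b) (hM : Base ρ M) {S : Set Γ(Y, b.U ⊓ M.U)}
    {z : Γ(Y, b.U ⊓ M.U)}
    (hz : z ∈ Submodule.span (QQ (sat ρ w b) (sat ρ w M)) S) :
    ∃ e, bs ρ (b.U ⊓ M.U) w ^ e * z ∈ Submodule.span (QQ b M) S := by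
  have hw : bs ρ (b.U ⊓ M.U) w ∈ QQ b M := by
    have := mem_Q2_left (d := M) (h := inf_le_left) (h' := inf_le_right) (hb w)
    simpa using this
  induction hz using Submodule.span_induction with
  | mem x hx => exact ⟨0, by simpa using Submodule.subset_span hx⟩
  | zero => exact ⟨0, by simp⟩
  | add x y _ _ h1 h2 =>
    obtain ⟨n, h1⟩ := h1
    obtain ⟨m, h2⟩ := h2
    refine ⟨n + m, ?_⟩
    have := add_mem (span_mul (pow_mem hw m) h1) (span_mul (pow_mem hw n) h2)
    convert this using 1; ring
  | smul a x _ h1 =>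
    obtain ⟨n, h1⟩ := h1
    obtain ⟨m, h2⟩ := exists_pow_mem_QQ ρ w hb hM a.2
    refine ⟨m + n, ?_⟩
    have := span_mul h2 h1
    convert this using 1
    rw [Subring.smul_def, smul_eq_mul]; ring

lemma Den.unit (hu : IsUnit (ρ w)) {M b : Chart Y} (hM : Base ρ M) (hb : Base ρ b) {X : Set Γ(Y, M.U)} (hX : X.Finite)
    (h1 : 1 ∈ X) (hXM : X ⊆ M.P) (h : RelU ρ w b M) : ∃ e, bs ρ (b.U ⊓ M.U) w ^ e ∈
      Submodule.span (QQ b M) (rs (inf_le_left : b.U ⊓ M.U ≤ _) '' ((fun α => α 1) '' Den M X b)) := by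
  have : (1 : Γ(Y, b.U ⊓ M.U)) ∈ Submodule.span (QQ (sat ρ w b) (sat ρ w M))
      (rs (inf_le_left : b.U ⊓ M.U ≤ _) '' ((fun α => α 1) '' Den M X b)) := by
    refine colon_local h _ _ fun g hg => ?_
    obtain ⟨n, p, hp⟩ := hg.exists_uniform (b.hU.inf M.hU) inf_le_left inf_le_right hX id
      (fun x hx => le_sat ρ w M (hXM hx))
    obtain ⟨m, hm⟩ := exists_uniform hX (fun x m => bs ρ b.U w ^ m * (g * p x) ∈ b.P)
      (fun x hx n m hnm e => by
        obtain ⟨l, rfl⟩ := Nat.exists_eq_add_of_le hnm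
        rw [add_comm, pow_add, mul_assoc]
        exact mul_mem (pow_mem (hb w) _) e)
      (fun x hx => mem_sat ρ w hb (mul_mem hg.1 (hp x hx).1))
    have hp1 := (hp 1 h1).2
    simp only [id, map_one, mul_one] at hp1
    refine ⟨1 + n, ?_⟩
    obtain ⟨v, hv⟩ := isUnit_bs ρ w hu (b.U ⊓ M.U)
    have hv' : (v⁻¹ : _ˣ).1 ∈ QQ (sat ρ w b) (sat ρ w M) := by
      obtain ⟨v', hv'⟩ := isUnit_bs ρ w hu b.U
      have := mem_Q2_left (c := sat ρ w b) (d := sat ρ w M) (h := inf_le_left) (h' := inf_le_right) (p := (v'⁻¹ : _ˣ).1)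
        (Subring.subset_closure (.inr (by change _ * _ = _; rw [← hv']; simp)))
      convert this using 1
      symm
      apply Units.eq_inv_of_mul_eq_one_left
      rw [hv, ← rs_bs ρ inf_le_left, ← hv', ← map_mul]; simp
    have key : rs inf_le_left g ^ (1 + n) * 1 = (v⁻¹ : _ˣ).1 ^ m *
        rs (inf_le_left : b.U ⊓ M.U ≤ _) (bs ρ b.U w ^ m * (g * p 1)) := by
      have e : (v⁻¹ : _ˣ).1 ^ m * v.1 ^ m = 1 := by rw [← mul_pow]; simp
      simp only [map_mul, map_pow, rs_bs, ← hv]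
      erw [hp1]
      linear_combination (-rs inf_le_left g ^ (1 + n)) * e
    rw [key]
    refine span_mul (pow_mem hv' m) (Submodule.subset_span
      ⟨_, ⟨fun x => bs ρ b.U w ^ m * (g * p x), ⟨?_, fun x hx => ⟨hm x hx, ?_⟩⟩, rfl⟩, rfl⟩)
    · simp only [Y.basicOpen_mul]
      exact inf_le_right.trans (inf_le_left.trans hg.2.choose)
    · have e := (hp x hx).2
      simp only [map_mul]
      erw [e, hp1]
      simp only [id]
      ring
  obtain ⟨e, he⟩ := exists_pow_mem_span ρ w hb hM this
  exact ⟨e, by simpa using he⟩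

lemma Den.isGood {M : Chart Y} {X : Set Γ(Y, M.U)} (h1 : 1 ∈ X)
    (hM : M.P = Subring.closure (Set.range (bs ρ M.U) ∪ X)) {b c : Chart Y} (hc : Base ρ c)
    {G f} (B : IsBlow b G f c) {α} (hα : α ∈ Den M X b)
    (hG : ∀ x ∈ X, α x ∈ Submodule.span b.P G) {z} (hz : z ∈ c.P) (e : z * rs B.le f = rs B.le (α 1)) :
    Good c M z := by
  have hle : Y.basicOpen z ≤ Y.basicOpen (α 1) := by
    have := congrArg Y.basicOpen e
    rw [Y.basicOpen_mul, basicOpen_rs, basicOpen_rs] at this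
    calc _ ≤ Y.basicOpen z ⊓ (c.U ⊓ Y.basicOpen f) := le_inf le_rfl (le_inf (Y.basicOpen_le _)
            ((Y.basicOpen_le _).trans B.eq.le))
      _ ≤ _ := this.le.trans inf_le_right
  have hd := hle.trans hα.1
  refine ⟨hz, hd, fun q hq => ?_⟩
  rw [hM] at hq
  induction hq using Subring.closure_induction with
  | mem x hx =>
    rcases hx with ⟨r, rfl⟩ | hx
    · exact ⟨0, _, hc r, by simp⟩
    · obtain ⟨t, ht, et⟩ := B.exists_div (hG x hx)
      refine ⟨1, t, ht, ?_⟩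
      have hu := B.isUnit_of_le (Y.basicOpen_le z)
      apply hu.mul_right_cancel
      have e1 := congrArg (rs (Y.basicOpen_le z)) et
      have e2 := congrArg (rs (Y.basicOpen_le z)) e
      have e3 := congrArg (rs (le_inf ((Y.basicOpen_le z).trans B.le) hd)) (hα.2 x hx).2
      simp only [map_mul, map_pow, rs_rs] at e1 e2 e3 ⊢
      rw [e1, e3, ← e2]; ring
  | zero => exact ⟨0, 0, zero_mem _, by simp⟩
  | one => exact ⟨0, 1, one_mem _, by simp⟩
  | add x y _ _ h1 h2 =>
    obtain ⟨n, p, hp, h1⟩ := h1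
    obtain ⟨m, p', hp', h2⟩ := h2
    refine ⟨n + m, z ^ m * p + z ^ n * p', add_mem (mul_mem (pow_mem hz _) hp) (mul_mem (pow_mem hz _) hp'), ?_⟩
    simp only [map_add, map_mul, map_pow, h1, h2]; ring
  | neg x _ h1 =>
    obtain ⟨n, p, hp, h1⟩ := h1
    exact ⟨n, -p, neg_mem hp, by simp [h1]⟩
  | mul x y _ _ h1 h2 =>
    obtain ⟨n, p, hp, h1⟩ := h1
    obtain ⟨m, p', hp', h2⟩ := h2
    refine ⟨n + m, p * p', mul_mem hp hp', ?_⟩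
    simp only [map_mul, h1, h2]; ring

variable {ρ w} in
lemma lemma4 [IsNoetherianRing R] (hu : IsUnit (ρ w)) {N : Set (Chart Y)} (hN : Model N)
    (hF : ∀ c ∈ N, FT ρ c) {M : Chart Y} (hFM : FT ρ M) (hU : ∀ c ∈ N, RelU ρ w c M) :
    ∃ G, CohFam ρ w N G ∧ ∀ c ∈ bl N G, Rel c M := by
  have hBM := hFM.base ρ
  obtain ⟨X, hX, hM, h1⟩ : ∃ X : Set Γ(Y, M.U), X.Finite ∧
      M.P = Subring.closure (Set.range (bs ρ M.U) ∪ X) ∧ 1 ∈ X := by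
    obtain ⟨X, hX, h⟩ := hFM
    refine ⟨insert 1 X, hX.insert _, ?_, .inl rfl⟩
    rw [h]
    refine le_antisymm (Subring.closure_mono (Set.union_subset_union_right _ (Set.subset_insert _ _))) ?_
    refine Subring.closure_le.mpr ?_
    rintro x (hx | rfl | hx)
    · exact Subring.subset_closure (.inl hx)
    · exact one_mem _
    · exact Subring.subset_closure (.inr hx)
  have hXM : X ⊆ M.P := by rw [hM]; exact fun x hx => Subring.subset_closure (.inr hx)
  obtain ⟨e, he⟩ := exists_uniform hN.1 (fun b e => bs ρ (b.U ⊓ M.U) w ^ e ∈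
      Submodule.span (QQ b M) (rs (inf_le_left : b.U ⊓ M.U ≤ _) '' ((fun α => α 1) '' Den M X b)))
    (fun b hb n m hnm h => by
      obtain ⟨l, rfl⟩ := Nat.exists_eq_add_of_le hnm
      rw [add_comm, pow_add]
      refine span_mul (pow_mem ?_ _) h
      have := mem_Q2_left (d := M) (h := inf_le_left) (h' := inf_le_right) ((hF b hb).base ρ w)
      simpa using this)
    (fun b hb => Den.unit ρ w hu hBM ((hF b hb).base ρ) hX h1 hXM (hU b hb))
  obtain ⟨G, hG, hG1, hG2⟩ := CohFam.mk' (w := w) hN hF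
    (fun b => {y | ∃ α ∈ Den M X b, ∃ x ∈ X, α x = y} ∪ {bs ρ b.U w ^ e}) (by
      rintro c hc _ (⟨α, hα, x, hx, rfl⟩ | rfl)
      · exact (hα.2 x hx).1
      · exact pow_mem ((hF c hc).base ρ w) _) (by
      rintro b hb d hd g hg _ (⟨α, hα, x, hx, rfl⟩ | rfl)
      · obtain ⟨k, β, hβ, h⟩ := Den.good hX h1 hg hα
        exact ⟨k, β x, .inl ⟨β, hβ, x, hx, rfl⟩, h x hx⟩
      · exact ⟨0, _, .inr rfl, by simp⟩) ⟨e, fun c hc => .inr rfl⟩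
  refine ⟨G, hG, fun c hc => ?_⟩
  have hBc : Base ρ c := by
    obtain ⟨b, hb, f, B⟩ := hG.exists hc
    exact (B.ft ρ (hF b hb) (hG.fin b hb)).base ρ
  obtain ⟨b, hb, f, B⟩ := hG.exists hc
  have key : ∀ z ∈ Submodule.span (QQ b M) (rs (inf_le_left : b.U ⊓ M.U ≤ _) '' ((fun α => α 1) '' Den M X b)),
      ∃ z' ∈ Submodule.span (QQ c M) (rs (inf_le_left : c.U ⊓ M.U ≤ _) '' {h | Good c M h}),
        z' * rs (inf_le_left.trans B.le) f = rs (inf_le_inf_right _ B.le) z := by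
    intro z hz
    induction hz using Submodule.span_induction with
    | mem x hx =>
      obtain ⟨_, ⟨α, hα, rfl⟩, rfl⟩ := hx
      obtain ⟨z, hz, ez⟩ := B.exists_div (hG2 b hb _ (.inl ⟨α, hα, 1, h1, rfl⟩))
      refine ⟨_, Submodule.subset_span ⟨z, Den.isGood ρ h1 hM hBc B hα
        (fun x hx => hG2 b hb _ (.inl ⟨α, hα, x, hx, rfl⟩)) hz ez, rfl⟩, ?_⟩
      have := congrArg (rs (inf_le_left : c.U ⊓ M.U ≤ _)) ez
      simpa using this
    | zero => exact ⟨0, zero_mem _, by simp⟩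
    | add x y _ _ h1 h2 =>
      obtain ⟨x', h1, e1⟩ := h1
      obtain ⟨y', h2, e2⟩ := h2
      exact ⟨x' + y', add_mem h1 h2, by rw [add_mul, e1, e2, map_add]⟩
    | smul a x _ h1 =>
      obtain ⟨x', h1, e1⟩ := h1
      refine ⟨rs (inf_le_inf_right _ B.le) a.1 * x', span_mul (B.dom.rs_mem (Dom.refl M) a.2) h1, ?_⟩
      rw [mul_assoc, e1, ← map_mul]; rfl
  obtain ⟨z', hz', e'⟩ := key (rs inf_le_left f) (by
    rcases hG1 b hb B.mem with ⟨α, hα, x, hx, rfl⟩ | rfl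
    · rw [(hα.2 x hx).2]
      exact span_mul (mem_Q2_right (hXM hx)) (Submodule.subset_span ⟨_, ⟨α, hα, rfl⟩, rfl⟩)
    · simpa using he b hb)
  rw [rs_rs] at e'
  have : z' = 1 := (B.isUnit_of_le inf_le_left).mul_right_cancel (by rw [one_mul]; exact e')
  rw [this] at hz'
  exact hz'

/-- sequences of coherent blow-ups -/
inductive Sq (N : Set (Chart Y)) : Set (Chart Y) → Prop
  | refl : Sq N N
  | step {N' G} : Sq N N' → CohFam ρ w N' G → Sq N (bl N' G)

variable {ρ w}

lemma Sq.trans {N N' N'' : Set (Chart Y)} (h : Sq ρ w N N') (h' : Sq ρ w N' N'') : Sq ρ w N N'' := by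
  induction h' with
  | refl => exact h
  | step _ C ih => exact ih.step C

lemma Sq.model {N N' : Set (Chart Y)} (h : Sq ρ w N N') (hN : Model N) : Model N' := by
  induction h with
  | refl => exact hN
  | step _ C ih => exact C.model ih

lemma Sq.cl {N N' E : Set (Chart Y)} (h : Sq ρ w N N') (hN : ∀ c ∈ N, Cl ρ w E c) :
    ∀ c ∈ N', Cl ρ w E c := by
  induction h with
  | refl => exact hN
  | step _ C ih => exact C.cl ih

lemma Sq.dom {N N' : Set (Chart Y)} (h : Sq ρ w N N') : ∀ c ∈ N', ∃ b ∈ N, Dom c b := by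
  induction h with
  | refl => exact fun c hc => ⟨c, hc, Dom.refl c⟩
  | step _ C ih =>
    intro c hc
    obtain ⟨b, hb, f, B⟩ := C.exists hc
    obtain ⟨a, ha, h⟩ := ih b hb
    exact ⟨a, ha, B.dom.trans h⟩

section
variable [IsNoetherianRing R] (hu : IsUnit (ρ w)) {E : Set (Chart Y)} (hE : ∀ c ∈ E, FT ρ c)
  (hE' : ∀ c ∈ E, ∀ d ∈ E, RelU ρ w c d)
include hu hE hE'

lemma lemma4' {N : Set (Chart Y)} (hN : Model N) (hF : ∀ c ∈ N, Cl ρ w E c) {L : Set (Chart Y)} (hL : L.Finite)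
    (hLE : ∀ c ∈ L, Cl ρ w E c) : ∃ N', Sq ρ w N N' ∧ ∀ c ∈ N', ∀ d ∈ L, Rel c d := by
  induction L, hL using Set.Finite.induction_on with
  | empty => exact ⟨N, .refl, by simp⟩
  | @insert M L ha hs ih =>
    obtain ⟨N', h, H⟩ := ih (fun c hc => hLE c (.inr hc))
    have hMc := hLE M (.inl rfl)
    obtain ⟨G, hG, h'⟩ := lemma4 hu (h.model hN) (fun c hc => (h.cl hF c hc).ft ρ w hE) (hMc.ft ρ w hE)
      (fun c hc => (h.cl hF c hc).relU ρ w hu hE' hMc)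
    refine ⟨_, h.step hG, ?_⟩
    rintro c hc d (rfl | hd)
    · exact h' c hc
    · obtain ⟨b, hb, f, B⟩ := hG.exists hc
      exact (H b hb d hd).dom B.dom

lemma transfer' {N M M' : Set (Chart Y)} (hN : Model N) (hF : ∀ c ∈ N, Cl ρ w E c)
    (hM : Model M) (hFM : ∀ c ∈ M, Cl ρ w E c) (hR : ∀ c ∈ N, ∀ d ∈ M, Rel c d)
    (h : Sq ρ w M M') : ∃ N', Sq ρ w N N' ∧ (∀ c ∈ N', ∀ d ∈ M', Rel c d) ∧
      ∀ t : Chart Y, (∃ d ∈ M', Dom t d) → (∀ c ∈ N, Rel t c) → ∀ c ∈ N', Rel t c := by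
  induction h with
  | refl => exact ⟨N, .refl, hR, fun t _ h => h⟩
  | @step M' J h C ih =>
    obtain ⟨N', h1, h2, h3⟩ := ih
    obtain ⟨G, hG, h4, h5⟩ := transfer (h1.model hN) (h.model hM) (fun c hc => (h1.cl hF c hc).ft ρ w hE)
      (fun c hc => (h.cl hFM c hc).ft ρ w hE) h2 C
    refine ⟨_, h1.step hG, h4, fun t ht ht' => h5 t ht (h3 t ?_ ht')⟩
    obtain ⟨d, hd, hD⟩ := ht
    obtain ⟨b, hb, f, B⟩ := C.exists hd
    exact ⟨b, hb, hD.trans B.dom⟩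
end

end MM
end

section
set_option linter.all false
open AlgebraicGeometry CategoryTheory CategoryTheory.Limits
namespace MM
variable {Y : Scheme.{u}}
variable {R : Type u} [CommRing R] {ρ : R →+* Γ(Y, ⊤)} {w : R}

/-- evaluation at a point -/
noncomputable def ev {U : Y.Opens} {y : Y} (hy : y ∈ U) : Γ(Y, U) →+* Y.residueField y :=
  (Y.evaluation U y hy).hom

lemma ev_rs {U W : Y.Opens} {y : Y} (h : W ≤ U) (hy : y ∈ W) (s : Γ(Y, U)) :
    ev hy (rs h s) = ev (h hy) s :=
  congrArg (Y.residue y).hom (Y.presheaf.germ_res_apply (homOfLE h) y hy s)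

lemma ev_ne_zero {U : Y.Opens} {y : Y} (hy : y ∈ U) (s : Γ(Y, U)) : ev hy s ≠ 0 ↔ y ∈ Y.basicOpen s := by
  exact Y.evaluation_ne_zero_iff_mem_basicOpen y hy s

/-- the chart has center for the valuation -/
def Covers (c : Chart Y) (y : Y) (V : ValuationSubring (Y.residueField y)) : Prop :=
  ∃ hy : y ∈ c.U, ∀ p ∈ c.P, ev hy p ∈ V

lemma exists_max_val {K : Type*} [Field K] (V : ValuationSubring K) {ι : Type*} {G : Set ι} (hG : G.Finite)
    (hne : G.Nonempty) (φ : ι → K) : ∃ f ∈ G, ∀ g ∈ G, ∃ v ∈ V, φ g = v * φ f := by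
  obtain ⟨f, hf, h⟩ := Set.exists_max_image G (fun g => V.valuation (φ g)) hG hne
  refine ⟨f, hf, fun g hg => ?_⟩
  by_cases h0 : φ f = 0
  · have := h g hg
    rw [h0, map_zero, le_zero_iff, map_eq_zero] at this
    exact ⟨0, zero_mem _, by rw [this, h0, zero_mul]⟩
  · refine ⟨φ g / φ f, ?_, by field_simp⟩
    rw [← V.valuation_le_one_iff, map_div₀]
    exact div_le_one_of_le₀ (h g hg) zero_le

variable [Y.IsSeparated]

lemma CohFam.covers (hu : IsUnit (ρ w)) {N : Set (Chart Y)} {G} (C : CohFam ρ w N G) {c} (hc : c ∈ N) {y V}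
    (h : Covers c y V) : ∃ c' ∈ bl N G, Covers c' y V := by
  obtain ⟨hy, h⟩ := h
  obtain ⟨e, he⟩ := C.unit
  have h1 : ev hy (bs ρ c.U w ^ e) ≠ 0 := (((isUnit_bs ρ w hu c.U).pow e).map (ev hy)).ne_zero
  have h2 : ∃ g ∈ G c, ev hy g ≠ 0 := by
    by_contra! hn
    have : ∀ z ∈ Submodule.span c.P (G c), ev hy z = 0 := by
      intro z hz
      induction hz using Submodule.span_induction with
      | mem x hx => exact hn x hx
      | zero => simp
      | add x y _ _ hx hy => simp [hx, hy]
      | smul a x _ hx => rw [Subring.smul_def, smul_eq_mul, map_mul, hx, mul_zero]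
    exact h1 (this _ (he c hc))
  obtain ⟨g, hg, hg0⟩ := h2
  obtain ⟨f, hf, hmax⟩ := exists_max_val V (C.fin c hc) ⟨g, hg⟩ (ev hy)
  have hf0 : ev hy f ≠ 0 := fun h0 => by
    obtain ⟨v, _, e⟩ := hmax g hg
    exact hg0 (by rw [e, h0, mul_zero])
  have hyf := (ev_ne_zero hy f).mp hf0
  refine ⟨blow c (G c) f, ?_, hyf, ?_⟩
  · simp only [bl, Set.mem_iUnion]; exact ⟨c, hc, f, hf, rfl⟩
  · have : (blow c (G c) f).P ≤ V.toSubring.comap (ev hyf) := by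
      refine Subring.closure_le.mpr ?_
      rintro _ (⟨p, hp, rfl⟩ | ⟨g, hg, e⟩)
      · change ev hyf _ ∈ V
        rw [ev_rs]; exact h p hp
      · change ev hyf _ ∈ V
        obtain ⟨v, hv, e'⟩ := hmax g hg
        have := congrArg (ev hyf) e
        rw [map_mul, ev_rs, ev_rs, e'] at this
        rw [mul_right_cancel₀ hf0 this]; exact hv
    exact fun p hp => this hp

lemma Sq.covers (hu : IsUnit (ρ w)) {N N' : Set (Chart Y)} (h : Sq ρ w N N') {y V} (hc : ∃ c ∈ N, Covers c y V) :
    ∃ c ∈ N', Covers c y V := by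
  induction h with
  | refl => exact hc
  | step _ C ih =>
    obtain ⟨c, hc, h⟩ := ih
    exact C.covers hu hc h

theorem exists_model [IsNoetherianRing R] (hu : IsUnit (ρ w)) {E : Set (Chart Y)} (hf : E.Finite) (hE : ∀ c ∈ E, FT ρ c)
    (hE' : ∀ c ∈ E, ∀ d ∈ E, RelU ρ w c d) : ∃ N, Model N ∧ (∀ c ∈ N, Cl ρ w E c) ∧
      ∀ y V, (∃ c ∈ E, Covers c y V) → ∃ c ∈ N, Covers c y V := by
  suffices H : ∀ E' ⊆ E, ∃ N, Model N ∧ (∀ c ∈ N, Cl ρ w E c) ∧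
      ∀ y V, (∃ c ∈ E', Covers c y V) → ∃ c ∈ N, Covers c y V from H E le_rfl
  intro E' hEE
  have hf' := hf.subset hEE
  induction E', hf' using Set.Finite.induction_on with
  | empty => exact ⟨∅, ⟨by simp, by simp⟩, by simp, by simp⟩
  | @insert M L ha hs ih =>
    obtain ⟨N, h1, h2, h3⟩ := ih ((Set.subset_insert _ _).trans hEE)
    have hM : ∀ c ∈ ({M} : Set (Chart Y)), Cl ρ w E c := by
      rintro _ rfl; exact .base (hEE (.inl rfl))
    have hM' : Model ({M} : Set (Chart Y)) := ⟨Set.finite_singleton M, by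
      rintro _ rfl _ rfl; exact Rel.refl _⟩
    obtain ⟨N', hN', hR⟩ := lemma4' hu hE hE' h1 h2 (Set.finite_singleton M) hM
    obtain ⟨M', hM1, hR'⟩ := lemma4' hu hE hE' hM' hM (hN'.model h1).1 (hN'.cl h2)
    obtain ⟨N'', hN'', hR1, hR2⟩ := transfer' hu hE hE' (hN'.model h1) (hN'.cl h2) hM' hM hR hM1
    refine ⟨N'' ∪ M', ⟨(hN''.model (hN'.model h1)).1.union (hM1.model hM').1, ?_⟩, ?_, ?_⟩
    · rintro c (hc | hc) d (hd | hd)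
      · exact (hN''.model (hN'.model h1)).2 c hc d hd
      · exact hR1 c hc d hd
      · exact hR2 c ⟨c, hc, Dom.refl c⟩ (hR' c hc) d hd
      · exact (hM1.model hM').2 c hc d hd
    · rintro c (hc | hc)
      · exact hN''.cl (hN'.cl h2) c hc
      · exact hM1.cl hM c hc
    · rintro y V ⟨c, rfl | hc, h⟩
      · obtain ⟨c, hc, h⟩ := hM1.covers hu ⟨c, rfl, h⟩
        exact ⟨c, .inr hc, h⟩
      · obtain ⟨c, hc, h⟩ := (hN'.trans hN'').covers hu (h3 y V ⟨c, hc, h⟩)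
        exact ⟨c, .inl hc, h⟩

end MM
end

section
set_option linter.all false
open AlgebraicGeometry CategoryTheory CategoryTheory.Limits
namespace MM

lemma exists_val {A K F : Type u} [CommRing A] [Field K] [Field F] (O : ValuationSubring K) (φ : A →+* K)
    (ε : A →+* F) (hk : ∀ a, ε a = 0 → φ a = 0) : ∃ V : ValuationSubring F,
      (∀ s t, φ t ≠ 0 → φ s / φ t ∈ O → ε s / ε t ∈ V) ∧
      (∀ s t, φ t ≠ 0 → ε s / ε t ∈ V → φ s / φ t ∈ O) ∧
      (∀ s t, φ t ≠ 0 → φ s = 0 → V.valuation (ε s / ε t) < 1) := by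
  let p := RingHom.ker φ
  have hp : p.IsPrime := RingHom.ker_isPrime φ
  let L := Localization.AtPrime p
  have h1 : ∀ y : p.primeCompl, φ y ≠ 0 := fun y h => y.2 h
  have h2 : ∀ y : p.primeCompl, ε y ≠ 0 := fun y h => y.2 (hk _ h)
  let φ' : L →+* K := IsLocalization.lift (M := p.primeCompl) (g := φ) (fun y => (h1 y).isUnit)
  let ε' : L →+* F := IsLocalization.lift (M := p.primeCompl) (g := ε) (fun y => (h2 y).isUnit)
  let T : Subring L := O.toSubring.comap φ'
  let τ : T →+* O := (φ'.comp T.subtype).codRestrict O.toSubring fun x => x.2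
  have hτ : IsLocalHom τ := by
    refine ⟨fun x hx => ?_⟩
    have h3 : φ' x.1 ≠ 0 := by
      intro h
      have : τ x = 0 := Subtype.ext h
      rw [this] at hx
      exact not_isUnit_zero hx
    have h4 : IsUnit x.1 := by
      obtain ⟨a, s, e⟩ := IsLocalization.exists_mk'_eq p.primeCompl x.1
      rw [← e] at h3 ⊢
      rw [IsLocalization.AtPrime.isUnit_mk'_iff (S := L) (I := p)]
      intro ha
      apply h3
      rw [IsLocalization.lift_mk', show φ a = 0 from ha, zero_mul]
    obtain ⟨v, hv⟩ := h4
    obtain ⟨o, ho⟩ := hx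
    have h5 : φ' (v⁻¹ : Lˣ).1 = ((o⁻¹ : Oˣ).1 : K) := by
      have e1 : φ' v.1 = (o.1 : K) := by rw [hv]; exact congrArg Subtype.val ho.symm
      have e2 : (o.1 : K) * ((o⁻¹ : Oˣ).1 : K) = 1 := by
        exact congrArg Subtype.val (o.mul_inv)
      have e3 : φ' v.1 * φ' (v⁻¹ : Lˣ).1 = 1 := by rw [← map_mul]; simp
      rw [e1] at e3
      exact mul_left_cancel₀ (left_ne_zero_of_mul_eq_one e2) (e3.trans e2.symm)
    refine IsUnit.of_mul_eq_one ⟨(v⁻¹ : Lˣ).1, ?_⟩ (Subtype.ext ?_)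
    · change φ' _ ∈ O; rw [h5]; exact (o⁻¹ : Oˣ).1.2
    · change x.1 * _ = 1
      rw [← hv]; simp
  have hT : IsLocalRing T := RingHom.domain_isLocalRing τ
  obtain ⟨V, hV, hl⟩ := IsLocalRing.exists_factor_valuationRing (ε'.comp T.subtype)
  have key : ∀ s t (ht : φ t ≠ 0), φ' (IsLocalization.mk' L s (⟨t, ht⟩ : p.primeCompl)) = φ s / φ t ∧
      ε' (IsLocalization.mk' L s (⟨t, ht⟩ : p.primeCompl)) = ε s / ε t := by
    intro s t ht
    constructor
    · rw [IsLocalization.lift_mk', div_eq_mul_inv]; congr 1; simp; rfl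
    · rw [IsLocalization.lift_mk', div_eq_mul_inv]; congr 1; simp; rfl
  have hA : ∀ s t, φ t ≠ 0 → φ s / φ t ∈ O → ε s / ε t ∈ V := by
    intro s t ht h
    have := hV ⟨IsLocalization.mk' L s (⟨t, ht⟩ : p.primeCompl), by
      change φ' _ ∈ O; rw [(key s t ht).1]; exact h⟩
    change ε' _ ∈ V at this
    rw [← (key s t ht).2]; exact this
  -- units
  have hB : ∀ s t, φ t ≠ 0 → φ s / φ t ∈ O → (ε s / ε t)⁻¹ ∈ V → ε s / ε t ≠ 0 → (φ s / φ t)⁻¹ ∈ O ∧ φ s ≠ 0 := by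
    intro s t ht h h' h0
    let x : T := ⟨IsLocalization.mk' L s (⟨t, ht⟩ : p.primeCompl), by
      change φ' _ ∈ O; rw [(key s t ht).1]; exact h⟩
    have hu : IsUnit ((ε'.comp T.subtype).codRestrict V.toSubring hV x) := by
      refine IsUnit.of_mul_eq_one ⟨(ε s / ε t)⁻¹, h'⟩ (Subtype.ext ?_)
      have e0 : ε' x.1 = ε s / ε t := (key s t ht).2
      change ε' x.1 * _ = 1
      rw [e0]; exact mul_inv_cancel₀ h0
    obtain ⟨v, hv⟩ := hl.map_nonunit x hu
    have e1 : φ' x.1 * φ' (v⁻¹ : Tˣ).1 = 1 := by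
      rw [← map_mul, ← hv]
      have : v.1.1 * (v⁻¹ : Tˣ).1.1 = 1 := congrArg Subtype.val v.mul_inv
      rw [this, map_one]
    have e2 : φ' x.1 = φ s / φ t := (key s t ht).1
    rw [e2] at e1
    refine ⟨?_, fun h => by simp [h] at e1⟩
    rw [← eq_inv_of_mul_eq_one_right e1]
    exact (v⁻¹ : Tˣ).1.2
  refine ⟨V, hA, fun s t ht h => ?_, fun s t ht hs => ?_⟩
  · by_contra hn
    have h0 : φ s ≠ 0 := fun h => hn (by rw [h, zero_div]; exact zero_mem _)
    have h3 : φ t / φ s ∈ O := by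
      have := (O.mem_or_inv_mem (φ s / φ t)).resolve_left hn
      rwa [inv_div] at this
    have := hB t s h0 h3 (by rwa [inv_div]) (div_ne_zero (fun h => ht (hk _ h)) (fun h => h0 (hk _ h)))
    rw [inv_div] at this
    exact hn this.1
  · have h3 : φ s / φ t ∈ O := by rw [hs, zero_div]; exact zero_mem _
    by_contra hn
    have h4 : (ε s / ε t)⁻¹ ∈ V := by
      rw [← V.valuation_le_one_iff, map_inv₀]
      exact inv_le_one_of_one_le₀ (not_lt.mp hn)
    have h5 : ε s / ε t ≠ 0 := fun h => hn (by rw [h, map_zero]; exact zero_lt_one)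
    exact (hB s t ht h3 h4 h5).2 hs

end MM
end

section
set_option linter.all false
open AlgebraicGeometry CategoryTheory CategoryTheory.Limits
namespace MM
variable {Y : Scheme.{u}}

lemma exists_point {U : Y.Opens} (hU : IsAffineOpen U) (p : Ideal Γ(Y, U)) (hp : p.IsPrime) :
    ∃ (y : Y) (hy : y ∈ U), ∀ a, ev hy a = 0 ↔ a ∈ p := by
  let x : Spec Γ(Y, U) := ⟨p, hp⟩
  have hy : hU.fromSpec x ∈ U := by
    have h1 : hU.fromSpec x ∈ Set.range hU.fromSpec := ⟨x, rfl⟩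
    rw [hU.range_fromSpec] at h1; exact h1
  refine ⟨hU.fromSpec x, hy, fun a => ?_⟩
  have h2 : ev hy a ≠ 0 ↔ a ∉ p := by
    rw [ev_ne_zero]
    have : x ∈ hU.fromSpec ⁻¹ᵁ Y.basicOpen a ↔ x ∈ PrimeSpectrum.basicOpen a := by
      rw [hU.fromSpec_preimage_basicOpen]; rfl
    exact this
  tauto

lemma LocIso.exists_lift {R S : Type u} [CommRing R] [CommRing S] {φ : R →+* S} {h : R}
    (H : LocIso φ h) {D : Type u} [CommRing D] (ψ : R →+* D) (hu : IsUnit (ψ h)) :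
    ∃ θ : S →+* D, θ.comp φ = ψ := by
  letI := ((algebraMap S (Localization.Away (φ h))).comp φ).toAlgebra
  have := H.isLocalization
  refine ⟨(IsLocalization.Away.lift (S := Localization.Away (φ h)) h hu).comp (algebraMap S _), ?_⟩
  ext r
  exact IsLocalization.Away.lift_eq h hu r

variable [Y.IsSeparated]

lemma locIso_q2l {c d : Chart Y} {g} (hg : Good c d g) : LocIso (q2l c d) ⟨g, hg.1⟩ := by
  obtain ⟨hd⟩ := hg.2
  constructor
  · rintro ⟨r, hr⟩ h0
    have h0 : rs (inf_le_left : c.U ⊓ d.U ≤ c.U) r = 0 := congrArg Subtype.val h0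
    obtain ⟨n, hn⟩ := eq_of_rs_basicOpen c.hU g r 0 inf_le_left (le_inf (Y.basicOpen_le g) hd)
      (by simpa using h0)
    exact ⟨n, Subtype.ext (by simpa using hn)⟩
  · rintro ⟨s, hs⟩
    suffices h : ∃ n, ∃ r ∈ c.P, rs (inf_le_left : c.U ⊓ d.U ≤ c.U) r = rs inf_le_left g ^ n * s by
      obtain ⟨n, r, hr, e⟩ := h
      exact ⟨n, ⟨r, hr⟩, Subtype.ext e⟩
    unfold Q2 at hs
    have hf := hg.1
    induction hs using Subring.closure_induction with
    | mem x hx =>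
      rcases hx with ⟨p, hp, rfl⟩ | ⟨p, hp, rfl⟩
      · exact ⟨0, p, hp, by simp⟩
      · exact hg.exists_eq (c.hU.inf d.hU) inf_le_left inf_le_right hp
    | zero => exact ⟨0, 0, zero_mem _, by simp⟩
    | one => exact ⟨0, 1, one_mem _, by simp⟩
    | add x y _ _ h1 h2 =>
      obtain ⟨n, r, hr, e⟩ := h1
      obtain ⟨m, t, ht, e'⟩ := h2
      refine ⟨n + m, g ^ m * r + g ^ n * t, add_mem (mul_mem (pow_mem hf _) hr)
        (mul_mem (pow_mem hf _) ht), ?_⟩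
      simp only [map_add, map_mul, map_pow, e, e']; ring
    | neg x _ h1 =>
      obtain ⟨n, r, hr, e⟩ := h1
      exact ⟨n, -r, neg_mem hr, by simp [e]⟩
    | mul x y _ _ h1 h2 =>
      obtain ⟨n, r, hr, e⟩ := h1
      obtain ⟨m, t, ht, e'⟩ := h2
      refine ⟨n + m, r * t, mul_mem hr ht, ?_⟩
      simp only [map_mul, e, e']; ring

lemma lemmaE {N : Set (Chart Y)} (hN : ∀ c ∈ N, ∀ d ∈ N, Rel c d) {R : Type u} [CommRing R] (ρ : R →+* Γ(Y, ⊤))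
    (hb : ∀ c ∈ N, Base ρ c)
    (hcov : ∀ (y : Y) (V : ValuationSubring (Y.residueField y)), (∀ r, ev (U := ⊤) trivial (ρ r) ∈ V) →
      ∃ c ∈ N, Covers c y V) {a : Chart Y} (ha : a ∈ N) {K : Type u} [Field K] (O : ValuationSubring K)
    (φ : a.P →+* K) (hφ : ∀ r, φ ⟨bs ρ a.U r, hb a ha r⟩ ∈ O) :
    ∃ b ∈ N, ∃ θ : QQ a b →+* K, θ.comp (q2l a b) = φ ∧ ∀ p, θ (q2r a b p) ∈ O := by
  have hp : (RingHom.ker φ).IsPrime := RingHom.ker_isPrime φ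
  obtain ⟨q, hq, hqp⟩ := Ideal.exists_minimalPrimes_le (I := ⊥) (J := RingHom.ker φ) bot_le
  obtain ⟨q', hq', hqq⟩ := Ideal.exists_comap_eq_of_mem_minimalPrimes_of_injective
    (f := a.P.subtype) Subtype.val_injective q (by simpa using hq)
  obtain ⟨y, hy, hey⟩ := exists_point a.hU q' hq'
  let ε : a.P →+* Y.residueField y := (ev hy).comp a.P.subtype
  have hk : ∀ p, ε p = 0 → φ p = 0 := fun p h => by
    have : p ∈ q := by rw [← hqq]; exact (hey _).mp h
    exact hqp this
  obtain ⟨V, hA, hB, hC⟩ := exists_val O φ ε hk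
  obtain ⟨b, hbN, hyb, hV⟩ := hcov y V (by
    intro r
    have := hA ⟨bs ρ a.U r, hb a ha r⟩ 1 (by simp) (by simpa using hφ r)
    rw [map_one, div_one] at this
    have e : ε ⟨bs ρ a.U r, hb a ha r⟩ = ev (U := ⊤) trivial (ρ r) := ev_rs le_top hy (ρ r)
    rwa [e] at this)
  have h0 : ∀ {s}, φ s ≠ 0 → ε s ≠ 0 := fun h h' => h (hk _ h')
  let W : Subring (Y.residueField y) :=
    { carrier := {z | ∃ s t, φ s ≠ 0 ∧ φ t ≠ 0 ∧ φ s / φ t ∈ O ∧ (ε s / ε t) * z ∈ V}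
      zero_mem' := ⟨1, 1, by simp, by simp, by simpa using one_mem O, by simpa using zero_mem V⟩
      one_mem' := ⟨1, 1, by simp, by simp, by simpa using one_mem O, by simpa using one_mem V⟩
      neg_mem' := by
        rintro z ⟨s, t, h1, h2, h3, h4⟩
        exact ⟨s, t, h1, h2, h3, by rw [mul_neg]; exact neg_mem h4⟩
      add_mem' := by
        rintro z z' ⟨s, t, h1, h2, h3, h4⟩ ⟨s', t', h1', h2', h3', h4'⟩
        refine ⟨s * s', t * t', by simp [h1, h1'], by simp [h2, h2'], ?_, ?_⟩
        · rw [map_mul, map_mul, mul_div_mul_comm]; exact mul_mem h3 h3'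
        · rw [map_mul, map_mul, mul_div_mul_comm]
          have e : ε s / ε t * (ε s' / ε t') * (z + z') = ε s' / ε t' * (ε s / ε t * z) +
            ε s / ε t * (ε s' / ε t' * z') := by ring
          rw [e]; exact add_mem (mul_mem (hA _ _ h2' h3') h4) (mul_mem (hA _ _ h2 h3) h4')
      mul_mem' := by
        rintro z z' ⟨s, t, h1, h2, h3, h4⟩ ⟨s', t', h1', h2', h3', h4'⟩
        refine ⟨s * s', t * t', by simp [h1, h1'], by simp [h2, h2'], ?_, ?_⟩
        · rw [map_mul, map_mul, mul_div_mul_comm]; exact mul_mem h3 h3'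
        · rw [map_mul, map_mul, mul_div_mul_comm]
          have e : ε s / ε t * (ε s' / ε t') * (z * z') = (ε s / ε t * z) *
            (ε s' / ε t' * z') := by ring
          rw [e]; exact mul_mem h4 h4' }
  have hyab : y ∈ a.U ⊓ b.U := ⟨hy, hyb⟩
  have hW : QQ a b ≤ W.comap (ev hyab) := by
    refine Q2_le (fun p hp => ?_) (fun p hp => ?_)
    · rw [Subring.mem_comap, ev_rs]
      by_cases h : φ ⟨p, hp⟩ ∈ O
      · refine ⟨1, 1, by simp, by simp, by simpa using one_mem O, ?_⟩
        have := hA ⟨p, hp⟩ 1 (by simp) (by simpa using h)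
        simpa [ε] using this
      · have h1 : φ ⟨p, hp⟩ ≠ 0 := fun h' => h (by rw [h']; exact zero_mem _)
        refine ⟨1, ⟨p, hp⟩, by simp, h1, ?_, ?_⟩
        · have := (O.mem_or_inv_mem (φ ⟨p, hp⟩)).resolve_left h
          simpa using this
        · have e : ev hy p = ε ⟨p, hp⟩ := rfl
          rw [e, map_one, one_div, inv_mul_cancel₀ (h0 h1)]; exact one_mem _
    · rw [Subring.mem_comap, ev_rs]
      refine ⟨1, 1, by simp, by simp, by simpa using one_mem O, ?_⟩
      simpa using hV p hp
  have hex : ∃ g, ∃ hg : Good a b g, φ ⟨g, hg.1⟩ ≠ 0 := by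
    by_contra! hn
    have key : ∀ z ∈ Submodule.span (QQ a b) ((rs (inf_le_left : a.U ⊓ b.U ≤ a.U)) '' {h | Good a b h}),
        ∀ q ∈ QQ a b, V.valuation (ev hyab (q * z)) < 1 := by
      intro z hz
      induction hz using Submodule.span_induction with
      | mem z hz =>
        obtain ⟨g, hg, rfl⟩ := hz
        intro q hq
        obtain ⟨s, t, h1, h2, h3, h4⟩ := hW hq
        have e : ev hyab (q * rs inf_le_left g) = (ε s / ε t * ev hyab q) * (ε (t * ⟨g, hg.1⟩) / ε s) := by
          rw [map_mul, ev_rs]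
          have e1 : ev hy g = ε ⟨g, hg.1⟩ := rfl
          rw [e1, map_mul]
          have := h0 h1; have := h0 h2
          field_simp
        rw [e, map_mul]
        refine mul_lt_one_of_nonneg_of_lt_one_right ((V.valuation_le_one_iff _).mpr h4) zero_le (hC _ _ h1 ?_)
        rw [map_mul, hn g hg, mul_zero]
      | zero => intro q hq; simp
      | add z w _ _ hz hw =>
        intro q hq
        rw [mul_add, map_add]
        exact (V.valuation.map_add _ _).trans_lt (max_lt (hz q hq) (hw q hq))
      | smul r z _ hz =>
        intro q hq
        have : q * (r • z) = (q * r.1) * z := by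
          rw [mul_assoc]; rfl
        rw [this]
        exact hz _ (mul_mem hq r.2)
    have := key 1 (hN a ha b hbN) 1 (one_mem _)
    simp at this
  obtain ⟨g, hg, hgφ⟩ := hex
  obtain ⟨θ, hθ⟩ := (locIso_q2l hg).exists_lift φ hgφ.isUnit
  refine ⟨b, hbN, θ, hθ, fun p => ?_⟩
  obtain ⟨n, r, e⟩ := (locIso_q2l hg).2 (q2r a b p)
  have e1 := congrArg θ e
  have e2 : ∀ x, θ (q2l a b x) = φ x := fun x => congrArg (fun f => f x) hθ
  rw [map_mul, map_pow, e2, e2] at e1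
  have e3 : ε r = ε ⟨g, hg.1⟩ ^ n * ev hyb p.1 := by
    have := congrArg (fun x => ev hyab x.1) e
    have h4 : ev hyab (q2l a b r).1 = ε r := ev_rs _ _ _
    have h5 : ev hyab (q2l a b ⟨g, hg.1⟩).1 = ε ⟨g, hg.1⟩ := ev_rs _ _ _
    have h6 : ev hyab (q2r a b p).1 = ev hyb p.1 := ev_rs _ _ _
    rw [← h4, ← h5, ← h6, ← map_pow, ← map_mul]; exact this
  have h7 := hB r (⟨g, hg.1⟩ ^ n) (by rw [map_pow]; exact pow_ne_zero _ hgφ) (by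
    rw [e3, map_pow, mul_div_cancel_left₀ _ (pow_ne_zero _ (h0 hgφ))]
    exact hV _ p.2)
  rwa [e1, map_pow, mul_div_cancel_left₀ _ (pow_ne_zero _ hgφ)] at h7

end MM
end

section
set_option linter.all false
open AlgebraicGeometry CategoryTheory CategoryTheory.Limits
namespace MM
variable {Y : Scheme.{u}} [Y.IsSeparated]
variable {R : Type u} [CommRing R] (ρ : R →+* Γ(Y, ⊤))

/-- structure map of a chart -/
noncomputable def be {c : Chart Y} (hc : Base ρ c) : R →+* c.P := (bs ρ c.U).codRestrict _ hc

lemma FT.finiteType {c : Chart Y} (h : FT ρ c) (hc : Base ρ c) : (be ρ hc).FiniteType := by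
  obtain ⟨U, hU, P⟩ := c
  obtain ⟨s, hs, h⟩ := h
  dsimp only at *
  letI := (bs ρ U).toAlgebra
  obtain ⟨s, rfl⟩ := hs.exists_finset_coe
  have h1 : Algebra.FiniteType R (Algebra.adjoin R (s : Set Γ(Y, U))) :=
    (Subalgebra.fg_iff_finiteType _).mp (Subalgebra.fg_adjoin_finset s)
  have e : P = (Algebra.adjoin R (s : Set Γ(Y, U))).toSubring := by
    rw [h, Algebra.adjoin_eq_ring_closure]; rfl
  subst e
  have h2 : be ρ hc = algebraMap R (Algebra.adjoin R (s : Set Γ(Y, U))) := rfl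
  rw [h2]; exact (RingHom.finiteType_algebraMap (B := Algebra.adjoin R (s : Set Γ(Y, U)))).mpr h1

/-- lift along an injection -/
lemma exists_lift_range {A O K : Type*} [CommRing A] [CommRing O] [Field K] [Algebra O K]
    (hi : Function.Injective (algebraMap O K)) (θ : A →+* K) (h : ∀ a, θ a ∈ (algebraMap O K).range) :
    ∃ l : A →+* O, (algebraMap O K).comp l = θ := by
  choose f hf using h
  refine ⟨⟨⟨⟨f, hi (by simp [hf])⟩, fun a b => hi (by simp [hf])⟩, hi (by simp [hf]), fun a b => hi (by simp [hf])⟩, ?_⟩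
  ext a; exact hf a

theorem proper_glue [IsNoetherianRing R] {N : Set (Chart Y)} (hf : N.Finite) (hN : ∀ c ∈ N, ∀ d ∈ N, Rel c d)
    (hb : ∀ c ∈ N, Base ρ c) (hft : ∀ c ∈ N, FT ρ c)
    (hcov : ∀ (y : Y) (V : ValuationSubring (Y.residueField y)), (∀ r, ev (U := ⊤) trivial (ρ r) ∈ V) →
      ∃ c ∈ N, Covers c y V)
    (X : Scheme.{u}) (j : ∀ i : N, Spec (.of i.1.P) ⟶ X) (h1 : ∀ i, IsOpenImmersion (j i))
    (h2 : ∀ x, ∃ i y, j i y = x)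
    (h3 : ∀ i k : N, Spec.map (CommRingCat.ofHom (q2l i.1 k.1)) ≫ j i =
        Spec.map (CommRingCat.ofHom (q2r i.1 k.1)) ≫ j k)
    (h4 : ∀ (i k : N) x y, j i x = j k y → ∃ z, Spec.map (CommRingCat.ofHom (q2l i.1 k.1)) z = x ∧
        Spec.map (CommRingCat.ofHom (q2r i.1 k.1)) z = y)
    (π : X ⟶ Spec (.of R)) (hπ : ∀ i, j i ≫ π = Spec.map (CommRingCat.ofHom (be ρ (hb i.1 i.2)))) :
    IsProper π ∧ LocallyOfFinitePresentation π := by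
  let 𝒰 : X.OpenCover := .mkOfCovers N (fun i => Spec (.of i.1.P)) j h2 h1
  have hfin : Finite N := hf
  have t1 : LocallyOfFiniteType π := by
    have : IsZariskiLocalAtSource (@LocallyOfFiniteType : MorphismProperty Scheme.{u}) := HasRingHomProperty.instIsZariskiLocalAtSource (Q := RingHom.FiniteType)
    rw [IsZariskiLocalAtSource.iff_of_openCover (P := @LocallyOfFiniteType) 𝒰]
    intro i
    suffices h : ∀ i, LocallyOfFiniteType (j i ≫ π) from h i
    intro i
    rw [hπ, HasRingHomProperty.Spec_iff (P := @LocallyOfFiniteType)]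
    exact (hft i.1 i.2).finiteType ρ _
  have t2 : CompactSpace X := by
    have : Finite 𝒰.I₀ := hfin
    have : ∀ i, CompactSpace (𝒰.X i) := fun i => by change CompactSpace (Spec _); infer_instance
    exact 𝒰.compactSpace
  have t3 : QuasiCompact π := (quasiCompact_iff_compactSpace π).mpr t2
  have t5 : IsNoetherianRing (CommRingCat.of R) := ‹_›
  have t4 : IsLocallyNoetherian X := LocallyOfFiniteType.isLocallyNoetherian π
  have t6 : QuasiSeparated π := inferInstance
  refine ⟨?_, (LocallyOfFinitePresentation.iff_locallyOfFiniteType).mpr t1⟩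
  apply IsProper.of_valuativeCriterion
  rw [ValuativeCriterion.iff]
  constructor
  · intro S
    let K := S.K
    let O : ValuationSubring K :=
      { toSubring := (algebraMap S.R K).range
        mem_or_inv_mem' := fun x => by
          rcases ValuationRing.isInteger_or_isInteger S.R x with ⟨a, h⟩ | ⟨a, h⟩
          · exact .inl ⟨a, h⟩
          · exact .inr ⟨a, h⟩ }
    obtain ⟨a, ya, hya⟩ := h2 (S.i₁ (⊥ : PrimeSpectrum K))
    have hr : Set.range S.i₁ ⊆ Set.range (j a) := by
      rintro _ ⟨x, rfl⟩
      obtain rfl : x = (⊥ : PrimeSpectrum K) := Subsingleton.elim (α := PrimeSpectrum K) _ _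
      exact ⟨ya, hya⟩
    obtain ⟨φ', hφ'⟩ : ∃ φ, Spec.map φ = IsOpenImmersion.lift (j a) S.i₁ hr := ⟨_, Spec.map_preimage _⟩
    have hφ1 : Spec.map φ' ≫ j a = S.i₁ := by rw [hφ']; exact IsOpenImmersion.lift_fac _ _ _
    obtain ⟨ψ, hψ⟩ : ∃ ψ, Spec.map ψ = S.i₂ := ⟨_, Spec.map_preimage _⟩
    have e1 : φ'.hom.comp (be ρ (hb a.1 a.2)) = (algebraMap S.R K).comp ψ.hom := by
      have := S.commSq.w
      rw [← hφ1, ← hψ, Category.assoc, hπ, ← Spec.map_comp, ← Spec.map_comp] at this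
      exact congrArg CommRingCat.Hom.hom (Spec.map_injective this)
    obtain ⟨b, hbN, θ, hθ, hO⟩ := lemmaE hN ρ hb hcov a.2 O φ'.hom (fun r =>
      ⟨ψ.hom r, (congrArg (fun f => f r) e1).symm⟩)
    obtain ⟨l, hl⟩ := exists_lift_range (IsFractionRing.injective S.R K) (θ.comp (q2r a.1 b)) (fun x => hO x)
    refine ⟨⟨⟨Spec.map (CommRingCat.ofHom l) ≫ j ⟨b, hbN⟩, ?_, ?_⟩⟩⟩
    · rw [← Spec.map_comp_assoc, ← CommRingCat.ofHom_comp]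
      erw [hl]
      rw [CommRingCat.ofHom_comp, Spec.map_comp_assoc, ← h3 a ⟨b, hbN⟩, ← Spec.map_comp_assoc, ← CommRingCat.ofHom_comp, hθ]
      exact hφ1
    · rw [Category.assoc, hπ, ← Spec.map_comp, ← hψ]
      congr 1
      ext r
      apply IsFractionRing.injective S.R K
      have e2 := congrArg (fun f => f (be ρ (hb b hbN) r)) hl
      have e3 := congrArg (fun f => f r) e1
      refine e2.trans (Eq.trans ?_ e3)
      have e4 : q2r a.1 b (be ρ (hb b hbN) r) = q2l a.1 b (be ρ (hb a.1 a.2) r) := by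
        apply Subtype.ext
        change rs _ (bs ρ _ r) = rs _ (bs ρ _ r)
        rw [rs_bs, rs_bs]
      change θ _ = φ'.hom _
      rw [e4, ← hθ]; rfl
  · intro S
    let K := S.K
    constructor
    rintro ⟨l, hl1, hl2⟩ ⟨m, hm1, hm2⟩
    have hi := IsFractionRing.injective S.R K
    have fac : ∀ l : Spec (.of S.R) ⟶ X, ∃ (a : N) (φ : _), Spec.map φ ≫ j a = l := by
      intro l
      obtain ⟨a, ya, hya⟩ := h2 (l (IsLocalRing.closedPoint S.R))
      have hr : Set.range l ⊆ Set.range (j a) := by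
        have : IsLocalRing.closedPoint S.R ∈ l ⁻¹ᵁ (j a).opensRange := ⟨ya, hya⟩
        have := (IsLocalRing.closed_point_mem_iff).mp this
        rintro _ ⟨x, rfl⟩
        have hx : x ∈ l ⁻¹ᵁ (j a).opensRange := by
          rw [this]; trivial
        exact hx
      refine ⟨a, Spec.preimage (IsOpenImmersion.lift (j a) l hr), ?_⟩
      rw [Spec.map_preimage, IsOpenImmersion.lift_fac]
    obtain ⟨a, lam, rfl⟩ := fac l
    obtain ⟨b, mu, rfl⟩ := fac m
    have e : Spec.map (lam ≫ CommRingCat.ofHom (algebraMap S.R K)) ≫ j a =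
        Spec.map (mu ≫ CommRingCat.ofHom (algebraMap S.R K)) ≫ j b := by
      rw [Spec.map_comp, Spec.map_comp, Category.assoc, Category.assoc]
      exact hl1.trans hm1.symm
    obtain ⟨z, hz1, hz2⟩ := h4 a b _ _ (congrArg (fun f => f (⊥ : PrimeSpectrum K)) e)
    have hz := z.2
    obtain ⟨g, hg, hgz⟩ := (hN a.1 a.2 b.1 b.2).exists_notMem (RingHom.id _) z.asIdeal
    have hg0 : algebraMap S.R K (lam.hom ⟨g, hg.1⟩) ≠ 0 := by
      intro h0
      apply hgz
      have h5 := congrArg PrimeSpectrum.asIdeal hz1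
      have h6 : (⟨g, hg.1⟩ : a.1.P) ∈ z.asIdeal.comap (q2l a.1 b.1) := by
        refine (congrArg (fun I => (⟨g, hg.1⟩ : a.1.P) ∈ I) h5).mpr ?_
        exact h0
      exact h6
    obtain ⟨θ, hθ⟩ := (locIso_q2l hg).exists_lift ((algebraMap S.R K).comp lam.hom) hg0.isUnit
    have hθ2 : θ.comp (q2r a.1 b.1) = (algebraMap S.R K).comp mu.hom := by
      have : Spec.map (CommRingCat.ofHom (θ.comp (q2r a.1 b.1))) ≫ j b =
          Spec.map (mu ≫ CommRingCat.ofHom (algebraMap S.R K)) ≫ j b := by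
        rw [CommRingCat.ofHom_comp, Spec.map_comp_assoc, ← h3 a b, ← Spec.map_comp_assoc,
          ← CommRingCat.ofHom_comp, hθ]
        exact e
      rw [cancel_mono] at this
      exact congrArg CommRingCat.Hom.hom (Spec.map_injective this)
    have hθr : ∀ x, θ x ∈ (algebraMap S.R K).range := by
      have : QQ a.1 b.1 ≤ ((algebraMap S.R K).range.comap θ).map (QQ a.1 b.1).subtype := by
        refine Q2_le (fun p hp => ⟨q2l a.1 b.1 ⟨p, hp⟩, ?_, rfl⟩) (fun p hp => ⟨q2r a.1 b.1 ⟨p, hp⟩, ?_, rfl⟩)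
        · exact ⟨lam.hom ⟨p, hp⟩, (congrArg (fun f => f ⟨p, hp⟩) hθ).symm⟩
        · exact ⟨mu.hom ⟨p, hp⟩, (congrArg (fun f => f ⟨p, hp⟩) hθ2).symm⟩
      intro x
      obtain ⟨x', hx', e'⟩ := this x.2
      obtain rfl : x' = x := Subtype.ext e'
      exact hx'
    obtain ⟨ν, hν⟩ := exists_lift_range hi θ hθr
    have n1 : lam = CommRingCat.ofHom (ν.comp (q2l a.1 b.1)) := by
      ext x
      apply hi
      have := congrArg (fun f => f x) hθ
      rw [← hν] at this
      exact this.symm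
    have n2 : mu = CommRingCat.ofHom (ν.comp (q2r a.1 b.1)) := by
      ext x
      apply hi
      have := congrArg (fun f => f x) hθ2
      rw [← hν] at this
      exact this.symm
    congr 1
    rw [n1, n2, CommRingCat.ofHom_comp, CommRingCat.ofHom_comp, Spec.map_comp_assoc, Spec.map_comp_assoc, h3 a b]

end MM
end

section
set_option linter.all false
open AlgebraicGeometry CategoryTheory CategoryTheory.Limits
namespace MM
variable {Y : Scheme.{u}} [Y.IsSeparated]
variable {R B : Type u} [CommRing R] [CommRing B] (ι : R →+* B) (σ : B →+* Γ(Y, ⊤)) (w : R)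

/-- `Γ(Y, U) = B ⊗_R P` -/
def BC (c : Chart Y) : Prop := ∀ (D : Type u) [CommRing D] (α : B →+* D) (β : c.P →+* D),
  (∀ r p, p.1 = bs σ c.U (ι r) → β p = α (ι r)) →
    (∃ γ : Γ(Y, c.U) →+* D, γ.comp (bs σ c.U) = α ∧ γ.comp c.P.subtype = β) ∧
    ∀ γ γ' : Γ(Y, c.U) →+* D, γ.comp (bs σ c.U) = α → γ.comp c.P.subtype = β →
      γ'.comp (bs σ c.U) = α → γ'.comp c.P.subtype = β → γ = γ'

lemma BC.blow (hw : IsUnit (ι w)) {c c' : Chart Y} {G f} (Bl : IsBlow c G f c') {e : ℕ}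
    (hb : Base (σ.comp ι) c)
    (he : bs (σ.comp ι) c.U w ^ e ∈ Submodule.span c.P G) (h : BC ι σ c) : BC ι σ c' := by
  intro D _ α β hαβ
  have hf : f ∈ c.P := Bl.sub Bl.mem
  have hm : ∀ p ∈ c.P, rs Bl.le p ∈ c'.P := fun p hp => by
    rw [Bl.P_eq]; exact Subring.subset_closure (.inl ⟨p, hp, rfl⟩)
  let m : c.P →+* c'.P := ((rs Bl.le).comp c.P.subtype).codRestrict _ fun p => hm p.1 p.2
  have hbs : ∀ b, rs Bl.le (bs σ c.U b) = bs σ c'.U b := fun b => rs_bs σ _ _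
  obtain ⟨⟨γ, hγ1, hγ2⟩, huq⟩ := h D α (β.comp m) (fun r p hp => hαβ r _ (by
    change rs _ p.1 = _; rw [hp, hbs]))
  have hfu : IsUnit (β (m ⟨f, hf⟩)) := by
    have key : ∀ z ∈ Submodule.span c.P G, ∃ t ∈ c'.P, rs Bl.le z = rs Bl.le f * t := by
      intro z hz
      induction hz using Submodule.span_induction with
      | mem z hz =>
        obtain ⟨v, hv⟩ := Bl.isUnit
        refine ⟨rs Bl.le z * (v⁻¹ : _ˣ).1, ?_, ?_⟩
        · rw [Bl.P_eq]
          refine Subring.subset_closure (.inr ⟨z, hz, ?_⟩)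
          rw [← hv, mul_assoc, Units.inv_mul, mul_one]
        · rw [← hv, mul_comm (rs Bl.le z), Units.mul_inv_cancel_left]
      | zero => exact ⟨0, zero_mem _, by simp⟩
      | add z z' _ _ h1 h2 =>
        obtain ⟨t, ht, e1⟩ := h1
        obtain ⟨t', ht', e2⟩ := h2
        exact ⟨t + t', add_mem ht ht', by rw [map_add, e1, e2, mul_add]⟩
      | smul r z _ h1 =>
        obtain ⟨t, ht, e1⟩ := h1
        refine ⟨rs Bl.le r.1 * t, mul_mem (hm _ r.2) ht, ?_⟩
        have : rs Bl.le (r • z) = rs Bl.le r.1 * rs Bl.le z := map_mul (rs Bl.le) r.1 z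
        rw [this, e1]; ring
    obtain ⟨t, ht, e1⟩ := key _ he
    have e2 : m ⟨f, hf⟩ * ⟨t, ht⟩ = m ⟨bs (σ.comp ι) c.U w ^ e, pow_mem (hb w) e⟩ := Subtype.ext e1.symm
    have e3 := hαβ (w ^ e) _ (show (m ⟨bs (σ.comp ι) c.U w ^ e, pow_mem (hb w) e⟩).1 = _ by
      change rs Bl.le (bs (σ.comp ι) c.U w ^ e) = _
      have : bs (σ.comp ι) c.U w = bs σ c.U (ι w) := rfl
      rw [this, ← map_pow, ← map_pow, hbs])
    rw [← e2, map_mul] at e3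
    refine isUnit_of_mul_isUnit_left (y := β ⟨t, ht⟩) ?_
    rw [e3, map_pow]
    exact (hw.pow e).map α
  have eγ : ∀ p (hp : p ∈ c.P), γ p = β (m ⟨p, hp⟩) := fun p hp => congrArg (fun f => f ⟨p, hp⟩) hγ2
  letI := (rs Bl.le).toAlgebra
  have hloc : IsLocalization.Away f Γ(Y, c'.U) := c.hU.isLocalization_of_eq_basicOpen f (homOfLE Bl.le) Bl.eq
  have hγf : IsUnit (γ f) := by rw [eγ f hf]; exact hfu
  let γ' : Γ(Y, c'.U) →+* D := IsLocalization.Away.lift f hγf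
  have hγ' : ∀ z, γ' (rs Bl.le z) = γ z := fun z => IsLocalization.Away.lift_eq f hγf z
  refine ⟨⟨γ', ?_, ?_⟩, ?_⟩
  · ext b
    change γ' (bs σ c'.U b) = _
    rw [← hbs, hγ', ← hγ1]; rfl
  · have : c'.P ≤ (RingHom.eqLocus (γ'.comp c'.P.subtype) β).map c'.P.subtype := by
      conv_lhs => rw [Bl.P_eq]
      rw [Subring.closure_le]
      rintro z (⟨p, hp, rfl⟩ | ⟨g, hg, hz⟩)
      · refine ⟨⟨_, hm p hp⟩, ?_, rfl⟩
        change γ' (rs Bl.le p) = β _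
        rw [hγ', eγ p hp]; rfl
      · have hz' : z ∈ c'.P := by rw [Bl.P_eq]; exact Subring.subset_closure (.inr ⟨g, hg, hz⟩)
        refine ⟨⟨z, hz'⟩, ?_, rfl⟩
        change γ' z = β ⟨z, hz'⟩
        apply hfu.mul_right_cancel
        have e1 : (⟨z, hz'⟩ : c'.P) * m ⟨f, hf⟩ = m ⟨g, Bl.sub hg⟩ := Subtype.ext hz
        rw [← map_mul, e1, ← eγ, ← eγ, ← hγ', ← hγ', ← map_mul, hz]
    ext x
    obtain ⟨x', hx', e'⟩ := this x.2
    obtain rfl : x' = x := Subtype.ext e'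
    exact hx'
  · intro γ1 γ2 h1 h2 h3 h4
    refine IsLocalization.ringHom_ext (Submonoid.powers f) ?_
    refine huq _ _ ?_ ?_ ?_ ?_
    · ext b; rw [← h1]; exact congrArg γ1 (hbs b)
    · rw [← h2]; rfl
    · ext b; rw [← h3]; exact congrArg γ2 (hbs b)
    · rw [← h4]; rfl

lemma Cl.bc (hw : IsUnit (ι w)) {E : Set (Chart Y)} (hE : ∀ c ∈ E, FT (σ.comp ι) c) (hE' : ∀ c ∈ E, BC ι σ c)
    {c} (h : Cl (σ.comp ι) w E c) : BC ι σ c := by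
  induction h with
  | base h => exact hE' _ h
  | step h _ he Bl ih => exact BC.blow ι σ w hw Bl ((h.ft _ _ hE).base _) he ih

lemma BC.isPushout {c : Chart Y} (h : BC ι σ c) (hb : Base (σ.comp ι) c) :
    IsPushout (CommRingCat.ofHom (be (σ.comp ι) hb)) (CommRingCat.ofHom ι)
      (CommRingCat.ofHom c.P.subtype) (CommRingCat.ofHom (bs σ c.U)) := by
  have H : ∀ s : PushoutCocone (CommRingCat.ofHom (be (σ.comp ι) hb)) (CommRingCat.ofHom ι),
      ∀ r p, p.1 = bs σ c.U (ι r) → s.inl.hom p = s.inr.hom (ι r) := by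
    intro s r p hp
    have := congrArg (fun f => f.hom r) s.condition
    have e : p = be (σ.comp ι) hb r := Subtype.ext hp
    rw [e]; exact this
  refine ⟨⟨rfl⟩, ⟨PushoutCocone.IsColimit.mk _ (fun s => CommRingCat.ofHom
    (h s.pt s.inr.hom s.inl.hom (H s)).1.choose) (fun s => ?_) (fun s => ?_) (fun s m h1 h2 => ?_)⟩⟩
  · ext1; exact (h s.pt s.inr.hom s.inl.hom (H s)).1.choose_spec.2
  · ext1; exact (h s.pt s.inr.hom s.inl.hom (H s)).1.choose_spec.1
  · ext1
    have H := h s.pt s.inr.hom s.inl.hom (H s)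
    exact H.2 m.hom _ (congrArg CommRingCat.Hom.hom h2) (congrArg CommRingCat.Hom.hom h1) H.1.choose_spec.1 H.1.choose_spec.2
end MM
end

section
set_option linter.all false
open AlgebraicGeometry CategoryTheory CategoryTheory.Limits
namespace MM
variable {Y : Scheme.{u}} [Y.IsSeparated]

/-- the map from the open to the affine model -/
noncomputable def cm (c : Chart Y) : c.U.toScheme ⟶ Spec (.of c.P) :=
  c.U.toSpecΓ ≫ Spec.map (CommRingCat.ofHom c.P.subtype)

lemma cm_q2l (c d : Chart Y) : ∃ t : (c.U ⊓ d.U).toScheme ⟶ Spec (.of (Q2 c d _ inf_le_left inf_le_right)),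
    t ≫ Spec.map (CommRingCat.ofHom (q2l c d)) = Y.homOfLE inf_le_left ≫ cm c ∧
    t ≫ Spec.map (CommRingCat.ofHom (q2r c d)) = Y.homOfLE inf_le_right ≫ cm d := by
  refine ⟨(c.U ⊓ d.U).toSpecΓ ≫ Spec.map (CommRingCat.ofHom (Subring.subtype _)), ?_, ?_⟩
  · rw [cm, ← Scheme.Opens.toSpecΓ_SpecMap_presheaf_map_assoc, Category.assoc, ← Spec.map_comp, ← Spec.map_comp]
    rfl
  · rw [cm, ← Scheme.Opens.toSpecΓ_SpecMap_presheaf_map_assoc, Category.assoc, ← Spec.map_comp, ← Spec.map_comp]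
    rfl

lemma exists_q {N : Set (Chart Y)} (hcov : ∀ y : Y, ∃ c ∈ N, y ∈ c.U)
    (X : Scheme.{u}) (j : ∀ i : N, Spec (.of i.1.P) ⟶ X)
    (h3 : ∀ i k : N, Spec.map (CommRingCat.ofHom (q2l i.1 k.1)) ≫ j i =
        Spec.map (CommRingCat.ofHom (q2r i.1 k.1)) ≫ j k) :
    ∃ q : Y ⟶ X, ∀ i : N, i.1.U.ι ≫ q = cm i.1 ≫ j i := by
  have hU : TopologicalSpace.IsOpenCover (fun i : N => i.1.U) := by
    rw [TopologicalSpace.IsOpenCover, eq_top_iff]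
    intro y _
    obtain ⟨c, hc, hy⟩ := hcov y
    exact TopologicalSpace.Opens.mem_iSup.mpr ⟨⟨c, hc⟩, hy⟩
  let 𝒰 := Y.openCoverOfIsOpenCover (fun i : N => i.1.U) hU
  have key : ∀ i k : N, pullback.fst i.1.U.ι k.1.U.ι ≫ cm i.1 ≫ j i = pullback.snd i.1.U.ι k.1.U.ι ≫ cm k.1 ≫ j k := by
    intro i k
    rw [← cancel_epi (isPullback_opens_inf i.1.U k.1.U).isoPullback.hom, IsPullback.isoPullback_hom_fst_assoc,
      IsPullback.isoPullback_hom_snd_assoc]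
    obtain ⟨t, h1, h2⟩ := cm_q2l i.1 k.1
    rw [← Category.assoc, ← h1, Category.assoc, h3, ← Category.assoc, h2, Category.assoc]
  exact ⟨𝒰.glueMorphisms (fun i => cm i.1 ≫ j i) key, fun i => 𝒰.ι_glueMorphisms _ key i⟩

lemma mem_basicOpen_of_cm {c : Chart Y} (y : c.U.toScheme) {g : Γ(Y, c.U)} (hg : g ∈ c.P)
    (h : (⟨g, hg⟩ : c.P) ∉ (cm c y).asIdeal) : c.U.ι y ∈ Y.basicOpen g := by
  rw [← c.hU.isoSpec_hom_fromSpec, Scheme.Hom.comp_apply]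
  change c.hU.isoSpec.hom y ∈ c.hU.fromSpec ⁻¹ᵁ Y.basicOpen g
  rw [c.hU.fromSpec_preimage_basicOpen]
  exact h

variable {R B : Type u} [CommRing R] [CommRing B] (ι : R →+* B) (σ : B →+* Γ(Y, ⊤)) (w : R)

theorem bc_glue {N : Set (Chart Y)} (hN : ∀ c ∈ N, ∀ d ∈ N, Rel c d)
    (hb : ∀ c ∈ N, Base (σ.comp ι) c) (hbc : ∀ c ∈ N, BC ι σ c)
    (hcov : ∀ y : Y, ∃ c ∈ N, y ∈ c.U)
    (X : Scheme.{u}) (j : ∀ i : N, Spec (.of i.1.P) ⟶ X) (h1 : ∀ i, IsOpenImmersion (j i))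
    (h2 : ∀ x, ∃ i y, j i y = x)
    (h3 : ∀ i k : N, Spec.map (CommRingCat.ofHom (q2l i.1 k.1)) ≫ j i =
        Spec.map (CommRingCat.ofHom (q2r i.1 k.1)) ≫ j k)
    (h4 : ∀ (i k : N) x y, j i x = j k y → ∃ z, Spec.map (CommRingCat.ofHom (q2l i.1 k.1)) z = x ∧
        Spec.map (CommRingCat.ofHom (q2r i.1 k.1)) z = y)
    (π : X ⟶ Spec (.of R)) (hπ : ∀ i, j i ≫ π = Spec.map (CommRingCat.ofHom (be (σ.comp ι) (hb i.1 i.2))))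
    (g : Y ⟶ Spec (.of B)) (hg : ∀ U : Y.Opens, U.ι ≫ g = U.toSpecΓ ≫ Spec.map (CommRingCat.ofHom (bs σ U))) :
    ∃ q : Y ⟶ X, IsPullback q g π (Spec.map (CommRingCat.ofHom ι)) := by
  obtain ⟨q, hq⟩ := exists_q hcov X j h3
  refine ⟨q, ?_⟩
  have hU : TopologicalSpace.IsOpenCover (fun i : N => i.1.U) := by
    rw [TopologicalSpace.IsOpenCover, eq_top_iff]
    intro y _
    obtain ⟨c, hc, hy⟩ := hcov y
    exact TopologicalSpace.Opens.mem_iSup.mpr ⟨⟨c, hc⟩, hy⟩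
  let 𝒰 := Y.openCoverOfIsOpenCover (fun i : N => i.1.U) hU
  have sq : ∀ i : N, IsPullback (cm i.1) (i.1.U.ι ≫ g) (j i ≫ π) (Spec.map (CommRingCat.ofHom ι)) := by
    intro i
    rw [hg, hπ]
    have hi : IsIso i.1.U.toSpecΓ := by rw [← i.1.hU.isoSpec_hom]; infer_instance
    have := isPullback_SpecMap_of_isPushout _ _ _ _ ((hbc i.1 i.2).isPushout ι σ (hb i.1 i.2))
    exact this.of_iso (asIso i.1.U.toSpecΓ).symm (Iso.refl _) (Iso.refl _) (Iso.refl _)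
      (by simp [cm]) (by simp) (by simp) (by simp)
  have w : q ≫ π = g ≫ Spec.map (CommRingCat.ofHom ι) := by
    refine 𝒰.hom_ext _ _ fun i => ?_
    change i.1.U.ι ≫ _ = i.1.U.ι ≫ _
    rw [reassoc_of% (hq i)]
    exact (sq i).w.trans (by simp)
  obtain ⟨h, hfst, hsnd⟩ : ∃ h : Y ⟶ pullback π (Spec.map (CommRingCat.ofHom ι)),
      h ≫ pullback.fst _ _ = q ∧ h ≫ pullback.snd _ _ = g :=
    ⟨pullback.lift q g w, pullback.lift_fst _ _ _, pullback.lift_snd _ _ _⟩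
  have sq' : ∀ i : N, IsPullback (i.1.U.ι ≫ h) (cm i.1) (pullback.fst π (Spec.map (CommRingCat.ofHom ι))) (j i) := by
    intro i
    refine IsPullback.of_right (h₁₂ := pullback.snd _ _) (h₂₂ := π) (v₁₃ := Spec.map (CommRingCat.ofHom ι)) ?_ ?_ (IsPullback.of_hasPullback _ _).flip
    · have : (i.1.U.ι ≫ h) ≫ pullback.snd _ _ = i.1.U.ι ≫ g := by rw [Category.assoc, hsnd]
      rw [this]; exact (sq i).flip
    · rw [Category.assoc, hfst, hq]
  have ho : ∀ i : N, IsOpenImmersion (i.1.U.ι ≫ h) := fun i =>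
    MorphismProperty.of_isPullback (P := @IsOpenImmersion) (sq' i).flip (h1 i)
  have hpre : ∀ (i : N) (y : Y) x, q y = j i x → y ∈ i.1.U := by
    intro i y x e
    obtain ⟨c, hc, hy⟩ := hcov y
    have e1 : q y = j ⟨c, hc⟩ (cm c ⟨y, hy⟩) := by
      have := congrArg (fun f : c.U.toScheme ⟶ X => f ⟨y, hy⟩) (hq ⟨c, hc⟩)
      exact this
    obtain ⟨z, hz, -⟩ := h4 ⟨c, hc⟩ i _ _ (e1.symm.trans e)
    have := z.2
    obtain ⟨g, hg, hgz⟩ := (hN c hc i.1 i.2).exists_notMem (RingHom.id _) z.asIdeal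
    have := mem_basicOpen_of_cm (c := c) ⟨y, hy⟩ hg.1 (by rw [← hz]; exact hgz)
    exact hg.2.1 this
  have hinj : Function.Injective h := by
    intro y y' e
    obtain ⟨c, hc, hy⟩ := hcov y
    have eq : ∀ y, q y = pullback.fst π (Spec.map (CommRingCat.ofHom ι)) (h y) := fun y => by
      rw [← Scheme.Hom.comp_apply, hfst]
    have e1 : q y = j ⟨c, hc⟩ (cm c ⟨y, hy⟩) := congrArg (fun f : c.U.toScheme ⟶ X => f ⟨y, hy⟩) (hq ⟨c, hc⟩)
    have hy' : y' ∈ c.U := hpre ⟨c, hc⟩ y' (cm c ⟨y, hy⟩) (by rw [eq, ← e, ← eq, e1])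
    have := ho ⟨c, hc⟩
    have := (c.U.ι ≫ h).isOpenEmbedding.injective (a₁ := ⟨y, hy⟩) (a₂ := ⟨y', hy'⟩) e
    exact congrArg Subtype.val this
  have hOI : IsOpenImmersion h := by
    refine IsOpenImmersion.of_forall_source_exists _ hinj fun y => ?_
    obtain ⟨c, hc, hy⟩ := hcov y
    exact ⟨_, c.U.ι, inferInstance, ⟨⟨y, hy⟩, rfl⟩, ho ⟨c, hc⟩⟩
  have hsurj : Surjective h := ⟨fun z => by
    obtain ⟨i, x, hx⟩ := h2 (pullback.fst π (Spec.map (CommRingCat.ofHom ι)) z)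
    obtain ⟨p, hp, -⟩ := Scheme.exists_preimage_of_isPullback (sq' i) z x hx.symm
    exact ⟨i.1.U.ι p, hp⟩⟩
  have : IsIso h := (isIso_iff_isOpenImmersion_and_surjective h).mpr ⟨hOI, hsurj⟩
  exact IsPullback.of_iso_pullback ⟨w⟩ (asIso h) (by simpa using hfst) (by simpa using hsnd)
end MM
end

section
set_option linter.all false
open AlgebraicGeometry CategoryTheory CategoryTheory.Limits
namespace MM
variable {Y : Scheme.{u}} [Y.IsSeparated]

lemma Q2_full {c d : Chart Y} (hc : c.P = ⊤) (hd : d.P = ⊤) : Q2 c d (c.U ⊓ d.U) inf_le_left inf_le_right = ⊤ := by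
  let Q := Q2 c d (c.U ⊓ d.U) inf_le_left inf_le_right
  let T := ⊤_ Scheme.{u}
  let i : Y ⟶ T := terminal.from Y
  let ll : Γ(Y, c.U) →+* Q := (rs inf_le_left).codRestrict _ fun x => mem_Q2_left (hc ▸ trivial)
  let rr : Γ(Y, d.U) →+* Q := (rs inf_le_right).codRestrict _ fun x => mem_Q2_right (hd ▸ trivial)
  let m : (c.U ⊓ d.U).toScheme ⟶ pullback (c.U.ι ≫ i) (d.U.ι ≫ i) :=
    (isPullback_opens_inf c.U d.U).isoPullback.hom ≫ pullback.mapDesc c.U.ι d.U.ι i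
  have hm : IsClosedImmersion m := inferInstance
  let s : (c.U ⊓ d.U).toScheme ⟶ Spec (.of Q) := (c.U ⊓ d.U).toSpecΓ ≫ Spec.map (CommRingCat.ofHom Q.subtype)
  let t : Spec (.of Q) ⟶ pullback (c.U.ι ≫ i) (d.U.ι ≫ i) :=
    pullback.lift (Spec.map (CommRingCat.ofHom ll) ≫ c.hU.isoSpec.inv) (Spec.map (CommRingCat.ofHom rr) ≫ d.hU.isoSpec.inv)
      (terminal.hom_ext _ _)
  have hst : s ≫ t = m := by
    apply pullback.hom_ext
    · have e1 : m ≫ pullback.fst _ _ = Y.homOfLE inf_le_left := by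
        have : pullback.mapDesc c.U.ι d.U.ι i ≫ pullback.fst _ _ = pullback.fst _ _ := (pullback.lift_fst _ _ _).trans (Category.comp_id _)
        rw [Category.assoc, this, IsPullback.isoPullback_hom_fst]
      have e2 : t ≫ pullback.fst _ _ = Spec.map (CommRingCat.ofHom ll) ≫ c.hU.isoSpec.inv := pullback.lift_fst _ _ _
      rw [e1, Category.assoc, e2, ← Category.assoc, Iso.comp_inv_eq, c.hU.isoSpec_hom,
        ← Scheme.Opens.toSpecΓ_SpecMap_presheaf_map, Category.assoc, ← Spec.map_comp]
      rfl
    · have e1 : m ≫ pullback.snd _ _ = Y.homOfLE inf_le_right := by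
        have : pullback.mapDesc c.U.ι d.U.ι i ≫ pullback.snd _ _ = pullback.snd _ _ := (pullback.lift_snd _ _ _).trans (Category.comp_id _)
        rw [Category.assoc, this, IsPullback.isoPullback_hom_snd]
      have e2 : t ≫ pullback.snd _ _ = Spec.map (CommRingCat.ofHom rr) ≫ d.hU.isoSpec.inv := pullback.lift_snd _ _ _
      rw [e1, Category.assoc, e2, ← Category.assoc, Iso.comp_inv_eq, d.hU.isoSpec_hom,
        ← Scheme.Opens.toSpecΓ_SpecMap_presheaf_map, Category.assoc, ← Spec.map_comp]
      rfl
  have hs : IsClosedImmersion s := by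
    have : IsClosedImmersion (s ≫ t) := hst ▸ hm
    exact IsClosedImmersion.of_comp s t
  have hW := c.hU.inf d.hU
  have hs' : IsClosedImmersion (Spec.map (CommRingCat.ofHom Q.subtype)) := by
    have : IsIso (c.U ⊓ d.U).toSpecΓ := by rw [← hW.isoSpec_hom]; infer_instance
    exact (MorphismProperty.cancel_left_of_respectsIso @IsClosedImmersion _ _).mp hs
  have h1 := (IsClosedImmersion.isAffine_surjective_of_isAffine (Spec.map (CommRingCat.ofHom Q.subtype))).2
  have h2 := Scheme.ΓSpecIso_naturality (CommRingCat.ofHom Q.subtype)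
  rw [eq_top_iff]
  intro z _
  obtain ⟨q, hq⟩ := h1 ((Scheme.ΓSpecIso Γ(Y, c.U ⊓ d.U)).inv z)
  have h3 := congrArg (fun f => f.hom q) h2
  have h4 : (Scheme.ΓSpecIso Γ(Y, c.U ⊓ d.U)).hom ((Scheme.ΓSpecIso Γ(Y, c.U ⊓ d.U)).inv z) = z := by simp
  have h5 : z = Q.subtype ((Scheme.ΓSpecIso (.of Q)).hom q) := by
    rw [← h4, ← hq]; exact h3
  rw [h5]; exact Subtype.property _

lemma Rel_full {c d : Chart Y} (hc : c.P = ⊤) (hd : d.P = ⊤) : Rel c d := by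
  apply relI
  intro x hx
  have hW := c.hU.inf d.hU
  have hQ := Q2_full hc hd
  let e : Γ(Y, c.U ⊓ d.U) →+* QQ c d := (RingHom.id _).codRestrict _ fun z => by
    change z ∈ Q2 c d (c.U ⊓ d.U) inf_le_left inf_le_right
    rw [hQ]; trivial
  obtain ⟨y, hy, H⟩ := exists_point hW (x.comap e) inferInstance
  obtain ⟨g, hg, hyg⟩ := c.hU.exists_basicOpen_le ⟨y, hy⟩ hy.1
  refine ⟨g, ⟨hc ▸ trivial, hg.trans inf_le_right, fun q _ => ?_⟩, fun hgx => ?_⟩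
  · obtain ⟨n, p, hp⟩ := exists_pow_mul_eq_rs c.hU g (rs (hg.trans inf_le_right) q)
    exact ⟨n, p, hc ▸ trivial, hp⟩
  · have h1 := (H (rs inf_le_left g)).mpr hgx
    rw [ev_rs] at h1
    exact (ev_ne_zero hy.1 g).mpr hyg h1
end MM
end

section
set_option linter.all false
open AlgebraicGeometry CategoryTheory CategoryTheory.Limits Filter
namespace MM
variable {Y : Scheme.{u}} [Y.IsSeparated]
variable {A B : Type u} [CommRing A] [CommRing B] (φ : A →+* B) (U : Submonoid A) (σ : B →+* Γ(Y, ⊤))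

/-- f.g. subring -/
abbrev Al (l : Finset A) : Subring A := Subring.closure (l : Set A)

lemma Al_noeth (l : Finset A) : IsNoetherianRing (Al l) := by
  have : Algebra.FiniteType ℤ (Algebra.adjoin ℤ (l : Set A)) :=
    (Subalgebra.fg_iff_finiteType _).mp (Subalgebra.fg_adjoin_finset l)
  have := Algebra.FiniteType.isNoetherianRing ℤ (Algebra.adjoin ℤ (l : Set A))
  have e : Al l = (Algebra.adjoin ℤ (l : Set A)).toSubring := by
    rw [Algebra.adjoin_eq_ring_closure]
    apply le_antisymm
    · exact Subring.closure_mono Set.subset_union_right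
    · rw [Subring.closure_le]
      rintro x (⟨n, rfl⟩ | hx)
      · exact (intCast_mem _ n : ((n : ℤ) : A) ∈ Al l)
      · exact Subring.subset_closure hx
  rw [e]; exact this

lemma mem_Al {l : Finset A} {a : A} (h : a ∈ l) : a ∈ Al l := Subring.subset_closure h

open Classical in
/-- product of all denominators -/
noncomputable def wl (l : Finset A) : Al l :=
  ⟨∏ a ∈ l with a ∈ U, a, Subring.prod_mem _ fun _ ha => mem_Al (Finset.mem_filter.mp ha).1⟩

lemma exists_mul_eq_wl {l : Finset A} {u : A} (hu : u ∈ U) (hl : u ∈ l) :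
    ∃ v ∈ Al l, u * v = (wl U l).1 := by
  classical
  have h : u ∈ l.filter (· ∈ U) := Finset.mem_filter.mpr ⟨hl, hu⟩
  refine ⟨∏ a ∈ (l.filter (· ∈ U)).erase u, a, Subring.prod_mem _ fun _ ha => mem_Al (Finset.mem_filter.mp (Finset.mem_of_mem_erase ha)).1, ?_⟩
  rw [Finset.mul_prod_erase _ (fun a => a) h]
  unfold wl
  congr!

lemma wl_mem (l : Finset A) : (wl U l).1 ∈ U := by
  classical
  exact Submonoid.prod_mem _ fun _ ha => (Finset.mem_filter.mp ha).2

/-- the map to `B` -/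
abbrev tl (l : Finset A) : Al l →+* B := φ.comp (Al l).subtype

/-- initial charts -/
noncomputable abbrev ch (l : Finset A) (c : Chart Y) {n : ℕ} (G : Fin n → Γ(Y, c.U)) : Chart Y :=
  ⟨c.U, c.hU, Subring.closure (Set.range (bs (σ.comp (tl φ l)) c.U) ∪
    Set.range fun k => bs (σ.comp (tl φ l)) c.U (wl U l) * G k)⟩

lemma ch_ft (l : Finset A) (c : Chart Y) {n : ℕ} (G : Fin n → Γ(Y, c.U)) :
    FT (σ.comp (tl φ l)) (ch φ U σ l c G) := ⟨_, Set.finite_range _, rfl⟩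

/-- saturation of the initial chart -/
noncomputable abbrev sch (l : Finset A) (c : Chart Y) {n : ℕ} (G : Fin n → Γ(Y, c.U)) : Chart Y :=
  sat (σ.comp (tl φ l)) (wl U l) (ch φ U σ l c G)

variable (hU : ∀ u ∈ U, IsUnit (φ u)) (hs : ∀ b, ∃ u ∈ U, ∃ a, b * φ u = φ a)
include hU

lemma exists_inv (l : Finset A) (c : Chart Y) {n : ℕ} (G : Fin n → Γ(Y, c.U)) :
    ∃ z ∈ (sch φ U σ l c G).P, z * bs σ c.U (φ (wl U l).1) = 1 := by
  obtain ⟨z, hz⟩ := ((hU _ (wl_mem U l)).map (bs σ c.U)).exists_left_inv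
  exact ⟨z, Subring.subset_closure (.inr hz), hz⟩

lemma sch_base (l : Finset A) (c : Chart Y) {n : ℕ} (G : Fin n → Γ(Y, c.U)) {a : A} (ha : a ∈ Al l) :
    bs σ c.U (φ a) ∈ (sch φ U σ l c G).P :=
  le_sat _ _ _ (Subring.subset_closure (.inl ⟨⟨a, ha⟩, rfl⟩))

lemma sch_gen (l : Finset A) (c : Chart Y) {n : ℕ} (G : Fin n → Γ(Y, c.U)) (k) :
    G k ∈ (sch φ U σ l c G).P := by
  obtain ⟨z, hz, e⟩ := exists_inv φ U σ hU l c G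
  have h : bs (σ.comp (tl φ l)) c.U (wl U l) * G k ∈ (sch φ U σ l c G).P :=
    le_sat _ _ _ (Subring.subset_closure (.inr ⟨k, rfl⟩))
  have := mul_mem hz h
  rw [← mul_assoc] at this
  change (z * bs σ c.U (φ (wl U l).1)) * G k ∈ _ at this
  rwa [e, one_mul] at this

lemma sch_le {l : Finset A} {c : Chart Y} {n : ℕ} {G : Fin n → Γ(Y, c.U)} {T : Subring Γ(Y, c.U)}
    (h1 : ∀ a ∈ Al l, bs σ c.U (φ a) ∈ T) (h2 : ∀ k, G k ∈ T)
    (h3 : ∀ z, z * bs σ c.U (φ (wl U l).1) = 1 → z ∈ T) : (sch φ U σ l c G).P ≤ T := by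
  rw [Subring.closure_le]
  rintro x (hx | hx)
  · have : (ch φ U σ l c G).P ≤ T := by
      rw [Subring.closure_le]
      rintro x (⟨a, rfl⟩ | ⟨k, rfl⟩)
      · exact h1 a.1 a.2
      · exact mul_mem (h1 (wl U l).1 (wl U l).2) (h2 k)
    exact this hx
  · exact h3 x hx

include hs
lemma ev_base (c : Chart Y) {n : ℕ} (G : Fin n → Γ(Y, c.U)) (b : B) :
    ∀ᶠ l in atTop, bs σ c.U b ∈ (sch φ U σ l c G).P := by
  classical
  obtain ⟨u, hu, a, e⟩ := hs b
  filter_upwards [eventually_ge_atTop {a, u}] with l hl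
  obtain ⟨v, hv, ev⟩ := exists_mul_eq_wl U hu (hl (by simp : u ∈ ({a, u} : Finset A)))
  obtain ⟨z, hz, ez⟩ := exists_inv φ U σ hU l c G
  have h1 := mul_mem hz (sch_base φ U σ hU l c G (mul_mem hv (mem_Al (hl (by simp : a ∈ ({a, u} : Finset A))))))
  have : z * bs σ c.U (φ (v * a)) = bs σ c.U b := by
    have e1 : φ (v * a) = b * φ (wl U l).1 := by
      rw [← ev, map_mul, map_mul, ← e]; ring
    rw [e1, map_mul, mul_left_comm, ez, mul_one]
  rwa [this] at h1

lemma ev_mem (c : Chart Y) {n : ℕ} {G : Fin n → Γ(Y, c.U)}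
    (hG : Subring.closure (Set.range (bs σ c.U) ∪ Set.range G) = ⊤) (x : Γ(Y, c.U)) :
    ∀ᶠ l in atTop, x ∈ (sch φ U σ l c G).P := by
  have hx : x ∈ Subring.closure (Set.range (bs σ c.U) ∪ Set.range G) := hG ▸ trivial
  induction hx using Subring.closure_induction with
  | mem x hx =>
    rcases hx with ⟨b, rfl⟩ | ⟨k, rfl⟩
    · exact ev_base φ U σ hU hs c G b
    · exact .of_forall fun l => sch_gen φ U σ hU l c G k
  | zero => exact .of_forall fun l => zero_mem _
  | one => exact .of_forall fun l => one_mem _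
  | add x y _ _ h1 h2 => filter_upwards [h1, h2] with l using add_mem
  | neg x _ h1 => filter_upwards [h1] with l using neg_mem
  | mul x y _ _ h1 h2 => filter_upwards [h1, h2] with l using mul_mem

/-- the full chart -/
abbrev fc (c : Chart Y) : Chart Y := ⟨c.U, c.hU, ⊤⟩

lemma ev_good (c d : Chart Y) {n m : ℕ} {G : Fin n → Γ(Y, c.U)} {H : Fin m → Γ(Y, d.U)}
    (hG : Subring.closure (Set.range (bs σ c.U) ∪ Set.range G) = ⊤)
    {h : Γ(Y, c.U)} (hh : Good (fc c) (fc d) h) :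
    ∀ᶠ l in atTop, Good (sch φ U σ l c G) (sch φ U σ l d H) h := by
  obtain ⟨-, hd, hq⟩ := hh
  choose N p hp hN using fun k => hq (H k) trivial
  have h1 : ∀ᶠ l in atTop, ∀ k, p k ∈ (sch φ U σ l c G).P :=
    eventually_all.mpr fun k => ev_mem φ U σ hU hs c hG (p k)
  filter_upwards [h1, ev_mem φ U σ hU hs c hG h] with l h1 h2
  refine ⟨h2, hd, ?_⟩
  let T : Subring Γ(Y, d.U) :=
    { carrier := {q | ∃ n, ∃ p ∈ (sch φ U σ l c G).P, rs (Y.basicOpen_le h) p = rs (Y.basicOpen_le h) h ^ n * rs hd q}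
      zero_mem' := ⟨0, 0, zero_mem _, by simp⟩
      one_mem' := ⟨0, 1, one_mem _, by simp⟩
      add_mem' := by
        rintro x y ⟨n, p, hp, e⟩ ⟨n', p', hp', e'⟩
        refine ⟨n + n', h ^ n' * p + h ^ n * p', add_mem (mul_mem (pow_mem h2 _) hp) (mul_mem (pow_mem h2 _) hp'), ?_⟩
        simp only [map_add, map_mul, map_pow, e, e']; ring
      mul_mem' := by
        rintro x y ⟨n, p, hp, e⟩ ⟨n', p', hp', e'⟩
        refine ⟨n + n', p * p', mul_mem hp hp', ?_⟩
        simp only [map_add, map_mul, map_pow, e, e']; ring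
      neg_mem' := by
        rintro x ⟨n, p, hp, e⟩
        exact ⟨n, -p, neg_mem hp, by simp only [map_neg, e]; ring⟩ }
  have hT : (sch φ U σ l d H).P ≤ T := by
    refine sch_le φ U σ hU (fun a ha => ?_) (fun k => ?_) (fun z hz => ?_)
    · exact ⟨0, _, sch_base φ U σ hU l c G ha, by simp⟩
    · exact ⟨N k, p k, h1 k, hN k⟩
    · obtain ⟨z', hz', e⟩ := exists_inv φ U σ hU l c G
      refine ⟨0, z', hz', ?_⟩
      have e1 := congrArg (rs (Y.basicOpen_le h)) e
      have e2 := congrArg (rs hd) hz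
      simp only [map_mul, map_one, rs_bs] at e1 e2
      rw [pow_zero, one_mul]
      calc rs _ z' = rs (Y.basicOpen_le h) z' * (rs hd z * bs σ (Y.basicOpen h) (φ (wl U l).1)) := by rw [e2, mul_one]
        _ = (rs (Y.basicOpen_le h) z' * bs σ (Y.basicOpen h) (φ (wl U l).1)) * rs hd z := by ring
        _ = _ := by rw [e1, one_mul]
  exact hT

lemma ev_relU (c d : Chart Y) {n m : ℕ} {G : Fin n → Γ(Y, c.U)} {H : Fin m → Γ(Y, d.U)}
    (hG : Subring.closure (Set.range (bs σ c.U) ∪ Set.range G) = ⊤)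
    (hH : Subring.closure (Set.range (bs σ d.U) ∪ Set.range H) = ⊤) :
    ∀ᶠ l in atTop, RelU (σ.comp (tl φ l)) (wl U l) (ch φ U σ l c G) (ch φ U σ l d H) := by
  have hR : Rel (fc c) (fc d) := Rel_full rfl rfl
  have hQ : ∀ q ∈ Q2 (fc c) (fc d) (c.U ⊓ d.U) inf_le_left inf_le_right,
      ∀ᶠ l in atTop, q ∈ Q2 (sch φ U σ l c G) (sch φ U σ l d H) (c.U ⊓ d.U) inf_le_left inf_le_right := by
    intro q hq
    unfold Q2 at hq
    induction hq using Subring.closure_induction with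
    | mem x hx =>
      rcases hx with ⟨p, -, rfl⟩ | ⟨p, -, rfl⟩
      · filter_upwards [ev_mem φ U σ hU hs c hG p] with l hl using mem_Q2_left hl
      · filter_upwards [ev_mem φ U σ hU hs d hH p] with l hl using mem_Q2_right hl
    | zero => exact .of_forall fun l => zero_mem _
    | one => exact .of_forall fun l => one_mem _
    | add x y _ _ h1 h2 => filter_upwards [h1, h2] with l using add_mem
    | neg x _ h1 => filter_upwards [h1] with l using neg_mem
    | mul x y _ _ h1 h2 => filter_upwards [h1, h2] with l using mul_mem
  have key : ∀ z ∈ Submodule.span (Q2 (fc c) (fc d) (c.U ⊓ d.U) inf_le_left inf_le_right)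
    ((rs (inf_le_left : c.U ⊓ d.U ≤ c.U)) '' {h | Good (fc c) (fc d) h}),
      ∀ᶠ l in atTop, z ∈ Submodule.span (Q2 (sch φ U σ l c G) (sch φ U σ l d H) (c.U ⊓ d.U) inf_le_left inf_le_right)
    ((rs (inf_le_left : c.U ⊓ d.U ≤ c.U)) '' {h | Good (sch φ U σ l c G) (sch φ U σ l d H) h}) := by
    intro z hz
    induction hz using Submodule.span_induction with
    | mem z hz =>
      obtain ⟨h, hh, rfl⟩ := hz
      filter_upwards [ev_good φ U σ hU hs c d hG hh] with l hl using Submodule.subset_span ⟨h, hl, rfl⟩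
    | zero => exact .of_forall fun l => zero_mem _
    | add x y _ _ h1 h2 => filter_upwards [h1, h2] with l using add_mem
    | smul r x _ h =>
      filter_upwards [h, hQ r.1 r.2] with l hl hr using span_mul hr hl
  exact key _ hR
end MM
end

section
set_option linter.all false
open AlgebraicGeometry CategoryTheory CategoryTheory.Limits Filter
namespace MM
variable {Y : Scheme.{u}} [Y.IsSeparated]
variable {A B : Type u} [CommRing A] [CommRing B] (φ : A →+* B) (U : Submonoid A) (σ : B →+* Γ(Y, ⊤))
variable (hU : ∀ u ∈ U, IsUnit (φ u)) (hs : ∀ b, ∃ u ∈ U, ∃ a, b * φ u = φ a)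
include hU hs

lemma ev_clear (c : Chart Y) {n : ℕ} (G : Fin n → Γ(Y, c.U)) (f : MvPolynomial (Fin n) B) :
    ∀ᶠ l in atTop, ∃ N : ℕ, ∃ p : (ch φ U σ l c G).P,
      p.1 = bs σ c.U (φ (wl U l).1) ^ N * MvPolynomial.eval₂Hom (bs σ c.U) G f ∧
      ∀ (D : Type u) [CommRing D] (α : B →+* D) (β : (ch φ U σ l c G).P →+* D) (x : Fin n → D),
        (∀ r p, p.1 = bs σ c.U (tl φ l r) → β p = α (tl φ l r)) →
        (∀ k p, p.1 = bs σ c.U (φ (wl U l).1) * G k → β p = α (φ (wl U l).1) * x k) →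
        β p = α (φ (wl U l).1) ^ N * MvPolynomial.eval₂Hom α x f := by
  classical
  induction f using MvPolynomial.induction_on with
  | C b =>
    obtain ⟨u, hu, a, e⟩ := hs b
    filter_upwards [eventually_ge_atTop {a, u}] with l hl
    obtain ⟨v, hv, ev⟩ := exists_mul_eq_wl U hu (hl (by simp : u ∈ ({a, u} : Finset A)))
    have ha : a ∈ Al l := mem_Al (hl (by simp : a ∈ ({a, u} : Finset A)))
    have e1 : φ (v * a) = φ (wl U l).1 * b := by
      rw [← ev, map_mul, map_mul, ← e]; ring
    refine ⟨1, ⟨bs σ c.U (φ (v * a)), Subring.subset_closure (.inl ⟨⟨_, mul_mem hv ha⟩, rfl⟩)⟩, ?_, ?_⟩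
    · simp [e1]
    · intro D _ α β x h1 h2
      rw [h1 ⟨_, mul_mem hv ha⟩ _ rfl]
      change α (φ (v * a)) = _
      simp [e1]
  | add f f' h h' =>
    filter_upwards [h, h'] with l h h'
    obtain ⟨N, p, hp, H⟩ := h
    obtain ⟨N', p', hp', H'⟩ := h'
    have hw : bs σ c.U (φ (wl U l).1) ∈ (ch φ U σ l c G).P := Subring.subset_closure (.inl ⟨wl U l, rfl⟩)
    let w : (ch φ U σ l c G).P := ⟨_, hw⟩
    refine ⟨N + N', w ^ N' * p + w ^ N * p', ?_, ?_⟩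
    · change bs σ c.U (φ (wl U l).1) ^ N' * p.1 + bs σ c.U (φ (wl U l).1) ^ N * p'.1 = _
      rw [hp, hp', map_add]; ring
    · intro D _ α β x h1 h2
      rw [map_add, map_mul, map_mul, H D α β x h1 h2, H' D α β x h1 h2, map_pow, map_pow,
        h1 (wl U l) w rfl, map_add]
      change α (φ (wl U l).1) ^ _ * _ + α (φ (wl U l).1) ^ _ * _ = _
      ring
  | mul_X f k h =>
    filter_upwards [h] with l h
    obtain ⟨N, p, hp, H⟩ := h
    let t : (ch φ U σ l c G).P := ⟨bs σ c.U (φ (wl U l).1) * G k, Subring.subset_closure (.inr ⟨k, rfl⟩)⟩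
    refine ⟨N + 1, p * t, ?_, ?_⟩
    · change p.1 * (bs σ c.U (φ (wl U l).1) * G k) = _
      rw [hp, map_mul]; simp; ring
    · intro D _ α β x h1 h2
      rw [map_mul, H D α β x h1 h2, h2 k t rfl, map_mul]; simp; ring

lemma ev_bc (c : Chart Y) {n : ℕ} (G : Fin n → Γ(Y, c.U))
    (hsurj : Function.Surjective (MvPolynomial.eval₂Hom (bs σ c.U) G))
    (hker : (RingHom.ker (MvPolynomial.eval₂Hom (bs σ c.U) G)).FG) :
    ∀ᶠ l in atTop, BC (tl φ l) σ (ch φ U σ l c G) := by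
  obtain ⟨F, hF⟩ := hker
  have h := (Filter.eventually_all_finset F).mpr fun f _ => ev_clear φ U σ hU hs c G f
  filter_upwards [h] with l h D _ α β hαβ
  obtain ⟨v, hv⟩ := (hU _ (wl_mem U l)).map α
  have hw : bs σ c.U (φ (wl U l).1) ∈ (ch φ U σ l c G).P := Subring.subset_closure (.inl ⟨wl U l, rfl⟩)
  have ht : ∀ k, bs σ c.U (φ (wl U l).1) * G k ∈ (ch φ U σ l c G).P := fun k => Subring.subset_closure (.inr ⟨k, rfl⟩)
  let x : Fin n → D := fun k => (v⁻¹ : Dˣ).1 * β ⟨_, ht k⟩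
  have hx : ∀ k, α (φ (wl U l).1) * x k = β ⟨_, ht k⟩ := fun k => by
    rw [← hv]; exact Units.mul_inv_cancel_left v _
  have hle : RingHom.ker (MvPolynomial.eval₂Hom (bs σ c.U) G) ≤ RingHom.ker (MvPolynomial.eval₂Hom α x) := by
    rw [← hF, Ideal.span_le]
    intro f hf
    have hf0 : MvPolynomial.eval₂Hom (bs σ c.U) G f = 0 := by
      have : f ∈ RingHom.ker (MvPolynomial.eval₂Hom (bs σ c.U) G) := hF ▸ Ideal.subset_span hf
      exact this
    obtain ⟨N, p, hp, H⟩ := h f hf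
    have h1 := H D α β x hαβ (fun k p hp => by rw [hx]; exact congrArg β (Subtype.ext hp))
    have hp0 : p = 0 := Subtype.ext (by rw [hp, hf0, mul_zero]; rfl)
    rw [hp0, map_zero, ← hv, ← Units.val_pow_eq_pow_val] at h1
    exact ((v ^ N).mul_right_eq_zero.mp h1.symm)
  have hch : ∀ γ : Γ(Y, c.U) →+* D, γ.comp (bs σ c.U) = α →
      (γ.comp (ch φ U σ l c G).P.subtype = β ↔ ∀ k, γ (G k) = x k) := by
    intro γ hγ
    have hγ' : ∀ b, γ (bs σ c.U b) = α b := fun b => congrArg (fun f => f b) hγ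
    constructor
    · intro h k
      have := congrArg (fun f => f ⟨_, ht k⟩) h
      change γ (bs σ c.U (φ (wl U l).1) * G k) = _ at this
      rw [← hx, map_mul, hγ', ← hv] at this
      exact v.isUnit.mul_left_cancel this
    · intro h
      have : (ch φ U σ l c G).P ≤ (RingHom.eqLocus (γ.comp (ch φ U σ l c G).P.subtype) β).map (ch φ U σ l c G).P.subtype := by
        conv_lhs => unfold ch
        rw [Subring.closure_le]
        rintro _ (⟨a, rfl⟩ | ⟨k, rfl⟩)
        · refine ⟨⟨_, Subring.subset_closure (.inl ⟨a, rfl⟩)⟩, ?_, rfl⟩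
          change γ (bs σ c.U (tl φ l a)) = _
          rw [hγ', hαβ a _ rfl]
        · refine ⟨⟨_, ht k⟩, ?_, rfl⟩
          change γ (bs σ c.U (φ (wl U l).1) * G k) = _
          rw [← hx, map_mul, hγ', h k]
      ext x
      obtain ⟨x', hx', e'⟩ := this x.2
      obtain rfl : x' = x := Subtype.ext e'
      exact hx'
  constructor
  · let γ : Γ(Y, c.U) →+* D := RingHom.liftOfSurjective _ hsurj ⟨MvPolynomial.eval₂Hom α x, hle⟩
    have hγ : ∀ f, γ (MvPolynomial.eval₂Hom (bs σ c.U) G f) = MvPolynomial.eval₂Hom α x f := fun f =>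
      RingHom.liftOfRightInverse_comp_apply _ _ _ _ _
    have h1 : γ.comp (bs σ c.U) = α := by
      ext b
      have := hγ (MvPolynomial.C b)
      simpa using this
    refine ⟨γ, h1, (hch γ h1).mpr fun k => ?_⟩
    have := hγ (MvPolynomial.X k)
    simpa using this
  · intro γ γ' h1 h2 h3 h4
    have h2 := (hch γ h1).mp h2
    have h4 := (hch γ' h3).mp h4
    have : γ.comp (MvPolynomial.eval₂Hom (bs σ c.U) G) = γ'.comp (MvPolynomial.eval₂Hom (bs σ c.U) G) := by
      apply MvPolynomial.ringHom_ext
      · intro b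
        have e1 := congrArg (fun f => f b) (h1.trans h3.symm)
        simpa using e1
      · intro k; simp [h2, h4]
    ext z
    obtain ⟨f, rfl⟩ := hsurj z
    exact congrArg (fun g => g f) this
end MM
end

section
set_option linter.all false
open AlgebraicGeometry CategoryTheory CategoryTheory.Limits Filter
namespace MM

section ultra
variable {L : Type u} (𝒰 : Ultrafilter L) (k : L → Type u) [∀ l, Field (k l)] (V : ∀ l, ValuationSubring (k l))

lemma exists_ultra : ∃ (F : Type u) (_ : Field F) (W : ValuationSubring F) (mk : (∀ l, k l) →+* F),
    (∀ x, mk x = 0 ↔ ∀ᶠ l in 𝒰, x l = 0) ∧ (∀ x, mk x ∈ W ↔ ∀ᶠ l in 𝒰, x l ∈ V l) := by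
  classical
  let I : Ideal (∀ l, k l) :=
    { carrier := {x | ∀ᶠ l in 𝒰, x l = 0}
      zero_mem' := .of_forall fun _ => rfl
      add_mem' := by
        intro a b ha hb
        filter_upwards [ha, hb] with l h1 h2
        simp [h1, h2]
      smul_mem' := by
        intro c x hx
        filter_upwards [hx] with l h1
        simp [h1] }
  have hinv : ∀ x : ∀ l, k l, x ∉ I → x * x⁻¹ - 1 ∈ I := by
    intro x hx
    have : ∀ᶠ l in 𝒰, x l ≠ 0 := Ultrafilter.eventually_not.mpr hx
    change ∀ᶠ l in 𝒰, (x * x⁻¹ - 1) l = 0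
    filter_upwards [this] with l hl
    simp [hl]
  have hI : I.IsMaximal := by
    rw [Ideal.isMaximal_iff]
    constructor
    · intro h
      have h : ∀ᶠ l in 𝒰, (1 : k l) = 0 := h
      simp at h
      exact 𝒰.neBot.ne h
    · intro J x hJ hx hxJ
      have := hJ (hinv x hx)
      have h2 := J.mul_mem_right x⁻¹ hxJ
      have := J.sub_mem h2 this
      simpa using this
  letI : Field ((∀ l, k l) ⧸ I) := Ideal.Quotient.field I
  let mk := Ideal.Quotient.mk I
  have h0 : ∀ x, mk x = 0 ↔ ∀ᶠ l in 𝒰, x l = 0 := fun x => Ideal.Quotient.eq_zero_iff_mem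
  let S : Subring (∀ l, k l) :=
    { carrier := {x | ∀ᶠ l in 𝒰, x l ∈ V l}
      zero_mem' := .of_forall fun _ => zero_mem _
      one_mem' := .of_forall fun _ => one_mem _
      add_mem' := by
        intro a b ha hb
        filter_upwards [ha, hb] with l h1 h2 using add_mem h1 h2
      mul_mem' := by
        intro a b ha hb
        filter_upwards [ha, hb] with l h1 h2 using mul_mem h1 h2
      neg_mem' := by
        intro a ha
        filter_upwards [ha] with l h1 using neg_mem h1 }
  have hS : ∀ x, mk x ∈ S.map mk ↔ x ∈ S := by
    intro x
    refine ⟨?_, fun h => ⟨x, h, rfl⟩⟩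
    rintro ⟨y, hy, e⟩
    have : ∀ᶠ l in 𝒰, (y - x) l = 0 := (h0 _).mp (by rw [map_sub, e, sub_self])
    have hy : ∀ᶠ l in 𝒰, y l ∈ V l := hy
    change ∀ᶠ l in 𝒰, x l ∈ V l
    filter_upwards [this, hy] with l h1 h2
    rwa [← sub_eq_zero.mp h1]
  refine ⟨_, this, { S.map mk with mem_or_inv_mem' := ?_ }, mk, h0, hS⟩
  intro q
  obtain ⟨x, rfl⟩ := Ideal.Quotient.mk_surjective q
  by_cases hx : x ∈ I
  · left
    have : Ideal.Quotient.mk I x = 0 := Ideal.Quotient.eq_zero_iff_mem.mpr hx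
    rw [this]; exact zero_mem (S.map mk)
  have e : (mk x)⁻¹ = mk x⁻¹ := by
    have h1 : mk x * mk x⁻¹ = 1 := by
      rw [← map_mul]
      have := Ideal.Quotient.eq_zero_iff_mem.mpr (hinv x hx)
      rw [map_sub, sub_eq_zero] at this
      exact this.trans (map_one _)
    exact inv_eq_of_mul_eq_one_right h1
  have : ∀ᶠ l in 𝒰, x l ∈ V l ∨ x⁻¹ l ∈ V l := .of_forall fun l => (V l).mem_or_inv_mem (x l)
  rcases Ultrafilter.eventually_or.mp this with h | h
  · exact .inl ((hS x).mpr h)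
  · right
    change (mk x)⁻¹ ∈ S.map mk
    rw [e]; exact (hS _).mpr h
end ultra

section
variable {Y : Scheme.{u}} {F : Type u} [CommRing F]
/-- sections along a point -/
noncomputable def pv (ψ : Spec (.of F) ⟶ Y) (W : Y.Opens) (h : ⊤ ≤ ψ ⁻¹ᵁ W) : Γ(Y, W) →+* F :=
  (ψ.appLE W ⊤ h ≫ (Scheme.ΓSpecIso (.of F)).hom).hom

lemma pv_rs (ψ : Spec (.of F) ⟶ Y) {W W' : Y.Opens} (hW : W' ≤ W) (h : ⊤ ≤ ψ ⁻¹ᵁ W') (s) :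
    pv ψ W' h (rs hW s) = pv ψ W (h.trans (ψ.preimage_mono hW)) s := by
  have := ψ.map_appLE (V := ⊤) h (homOfLE hW).op
  have := congrArg (fun f => (Scheme.ΓSpecIso (.of F)).hom.hom (f.hom s)) this
  exact this

lemma pv_comp {F' : Type u} [CommRing F'] (α : F →+* F') (ψ : Spec (.of F) ⟶ Y) (W : Y.Opens) (h : ⊤ ≤ ψ ⁻¹ᵁ W)
    (h') (s) :
    pv (Spec.map (CommRingCat.ofHom α) ≫ ψ) W h' s = α (pv ψ W h s) := by
  have e : (Spec.map (CommRingCat.ofHom α) ≫ ψ).appLE W ⊤ h' ≫ (Scheme.ΓSpecIso (.of F')).hom =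
      (ψ.appLE W ⊤ h ≫ (Scheme.ΓSpecIso (.of F)).hom) ≫ CommRingCat.ofHom α := by
    rw [← Scheme.Hom.appLE_comp_appLE (Spec.map (CommRingCat.ofHom α)) ψ W ⊤ ⊤ h le_top, Category.assoc, Category.assoc]
    congr 1
    have := Scheme.ΓSpecIso_naturality (CommRingCat.ofHom α)
    rw [← this]
    congr 1
  exact congrArg (fun f => f.hom s) e

lemma pv_fromSpec {U : Y.Opens} (hU : IsAffineOpen U) (γ : Γ(Y, U) →+* F) (h) (s) :
    pv (Spec.map (CommRingCat.ofHom γ) ≫ hU.fromSpec) U h s = γ s := by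
  have h1 : (⊤ : (Spec Γ(Y,U)).Opens) ≤ hU.fromSpec ⁻¹ᵁ U := hU.fromSpec_preimage_self.ge
  refine (pv_comp (F := Γ(Y, U)) γ hU.fromSpec U h1 h s).trans ?_
  congr 1
  have : hU.fromSpec.appLE U ⊤ h1 ≫ (Scheme.ΓSpecIso Γ(Y,U)).hom = 𝟙 _ := by
    unfold Scheme.Hom.appLE
    rw [hU.fromSpec_app_self, Category.assoc, Category.assoc, ← Functor.map_comp_assoc]
    rw [Iso.inv_comp_eq, Category.comp_id]
    exact (congrArg (· ≫ _) ((Spec Γ(Y,U)).presheaf.map_id _)).trans (Category.id_comp _)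
  exact congrArg (fun f => f.hom s) this
end
end MM
end

section
set_option linter.all false
open AlgebraicGeometry CategoryTheory CategoryTheory.Limits Filter
namespace MM
variable {Y : Scheme.{u}} [Y.IsSeparated]
variable {A B : Type u} [CommRing A] [CommRing B] (φ : A →+* B) (U : Submonoid A) (σ : B →+* Γ(Y, ⊤))

lemma lift_val {ι : Type*} (c : ι → Chart Y) (hcov : ∀ y, ∃ i, y ∈ (c i).U)
    (g : Y ⟶ Spec (.of B)) [IsProper g]
    (hg : ∀ U : Y.Opens, U.ι ≫ g = U.toSpecΓ ≫ Spec.map (CommRingCat.ofHom (bs σ U)))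
    {F : Type u} [Field F] (V : ValuationSubring F) (i : ι) (γ : Γ(Y, (c i).U) →+* F)
    (hB : ∀ b, γ (bs σ _ b) ∈ V) :
    ∃ (j : ι) (h : Γ(Y, (c i).U)) (hle : Y.basicOpen h ≤ (c j).U), γ h ≠ 0 ∧
      ∀ x : Γ(Y, (c j).U), ∃ d ∈ V, ∀ n s, rs (Y.basicOpen_le h) s = rs (Y.basicOpen_le h) h ^ n * rs hle x →
        γ s = γ h ^ n * d := by
  let θ : B →+* V := (γ.comp (bs σ _)).codRestrict V.toSubring hB
  have hc := (c i).hU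
  have hgi : hc.fromSpec ≫ g = Spec.map (CommRingCat.ofHom (bs σ (c i).U)) := by
    rw [← hc.isoSpec_inv_ι, Category.assoc, hg, ← hc.isoSpec_hom, Iso.inv_hom_id_assoc]
  have ex : ValuativeCriterion.Existence g := by
    have h : UniversallyClosed g := inferInstance
    rw [UniversallyClosed.eq_valuativeCriterion] at h
    exact h.1
  let ψ : Spec (.of F) ⟶ Y := Spec.map (CommRingCat.ofHom γ) ≫ hc.fromSpec
  have sq : CommSq ψ (Spec.map (CommRingCat.ofHom (algebraMap V F))) g (Spec.map (CommRingCat.ofHom θ)) := by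
    constructor
    simp only [ψ, Category.assoc, hgi]
    rw [← Spec.map_comp, ← Spec.map_comp]
    rfl
  obtain ⟨⟨l, hl1, hl2⟩⟩ := (ex ⟨V, F, ψ, Spec.map (CommRingCat.ofHom θ), sq⟩).exists_lift
  replace hl1 : Spec.map (CommRingCat.ofHom (algebraMap V F)) ≫ l = ψ := hl1
  obtain ⟨j, hj⟩ := hcov (l (IsLocalRing.closedPoint V))
  have hlj : ⊤ ≤ l ⁻¹ᵁ (c j).U := by
    intro x _
    have hs : x ⤳ IsLocalRing.closedPoint V := IsLocalRing.specializes_closedPoint x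
    exact (hs.map l.continuous).mem_open (c j).U.2 hj
  have hψj : ⊤ ≤ ψ ⁻¹ᵁ (c j).U := by
    intro x _
    rw [← hl1]
    exact hlj (x := Spec.map (CommRingCat.ofHom (algebraMap V F)) x) trivial
  have hψi : ⊤ ≤ ψ ⁻¹ᵁ (c i).U := by
    intro x _
    have h1 : hc.fromSpec (Spec.map (CommRingCat.ofHom γ) x) ∈ Set.range hc.fromSpec := ⟨_, rfl⟩
    rw [hc.range_fromSpec] at h1
    exact h1
  let x0 : Spec (.of F) := (⊥ : PrimeSpectrum F)
  obtain ⟨⟨h, hh⟩, -⟩ | ⟨h, hle, hx⟩ : (∃ h : {h : ℕ // False}, True) ∨ _ := .inr (hc.exists_basicOpen_le (V := (c j).U) ⟨ψ x0, hψj (x := x0) trivial⟩ (hψi (x := x0) trivial))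
  · exact hh.elim
  have hψh : ⊤ ≤ ψ ⁻¹ᵁ Y.basicOpen h := by
    intro x _
    have : x = x0 := Subsingleton.elim (α := PrimeSpectrum F) _ _
    rw [this]; exact hx
  have hγ : ∀ s, pv ψ (Y.basicOpen h) hψh (rs (Y.basicOpen_le h) s) = γ s := fun s => by
    rw [pv_rs]; exact pv_fromSpec hc γ _ s
  refine ⟨j, h, hle, ?_, ?_⟩
  · rw [← hγ]
    exact ((isUnit_rs_basicOpen h (Y.basicOpen_le h) le_rfl).map _).ne_zero
  · intro x
    refine ⟨(pv l (c j).U hlj x).1, (pv l (c j).U hlj x).2, ?_⟩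
    intro n s e
    have e := congrArg (pv ψ (Y.basicOpen h) hψh) e
    rw [map_mul, map_pow, hγ, hγ, pv_rs] at e
    rw [e]
    congr 1
    have : ∀ (ψ' : Spec (.of F) ⟶ Y) (h' : ⊤ ≤ ψ' ⁻¹ᵁ (c j).U), Spec.map (CommRingCat.ofHom (algebraMap V F)) ≫ l = ψ' →
        pv ψ' (c j).U h' x = (pv l (c j).U hlj x).1 := by
      rintro _ h' rfl
      exact pv_comp (algebraMap V F) l (c j).U hlj _ x
    exact this ψ hψj hl1

lemma ev_bs {W : Y.Opens} {y : Y} (hy : y ∈ W) (b : B) : ev hy (bs σ W b) = ev (U := ⊤) trivial (σ b) :=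
  ev_rs le_top hy (σ b)

/-- localized valuation ring -/
def locV {F : Type u} [Field F] (W : ValuationSubring F) (χ : A →+* F) (hχ : ∀ a, χ a ∈ W) : ValuationSubring F :=
  ValuationSubring.ofLE W
    { carrier := {x | ∃ u ∈ U, χ u * x ∈ W}
      zero_mem' := ⟨1, one_mem _, by simp⟩
      one_mem' := ⟨1, one_mem _, by simp⟩
      add_mem' := by
        rintro x y ⟨u, hu, h⟩ ⟨v, hv, h'⟩
        refine ⟨u * v, mul_mem hu hv, ?_⟩
        have : χ (u * v) * (x + y) = χ v * (χ u * x) + χ u * (χ v * y) := by rw [map_mul]; ring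
        rw [this]
        exact add_mem (mul_mem (hχ _) h) (mul_mem (hχ _) h')
      mul_mem' := by
        rintro x y ⟨u, hu, h⟩ ⟨v, hv, h'⟩
        refine ⟨u * v, mul_mem hu hv, ?_⟩
        have : χ (u * v) * (x * y) = (χ u * x) * (χ v * y) := by rw [map_mul]; ring
        rw [this]
        exact mul_mem h h'
      neg_mem' := by
        rintro x ⟨u, hu, h⟩
        exact ⟨u, hu, by rw [mul_neg]; exact neg_mem h⟩ }
    (fun x hx => ⟨1, one_mem _, by simpa using hx⟩)

variable (hU : ∀ u ∈ U, IsUnit (φ u)) (hs : ∀ b, ∃ u ∈ U, ∃ a, b * φ u = φ a)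
include hU hs

lemma ev_cover {ι : Type*} [Finite ι] (c : ι → Chart Y) (hcov : ∀ y, ∃ i, y ∈ (c i).U)
    {n : ι → ℕ} (G : ∀ i, Fin (n i) → Γ(Y, (c i).U))
    (g : Y ⟶ Spec (.of B)) [IsProper g]
    (hg : ∀ U : Y.Opens, U.ι ≫ g = U.toSpecΓ ≫ Spec.map (CommRingCat.ofHom (bs σ U))) :
    ∀ᶠ l in atTop, ∀ (y : Y) (V : ValuationSubring (Y.residueField y)),
      (∀ r : Al l, ev (U := ⊤) trivial (σ (tl φ l r)) ∈ V) → ∃ i, Covers (ch φ U σ l (c i) (G i)) y V := by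
  classical
  by_contra hcon
  rw [not_eventually] at hcon
  have h1 : ∃ᶠ l in atTop, ∃ i, ∃ (y : Y) (V : ValuationSubring (Y.residueField y)), y ∈ (c i).U ∧
      (∀ r : Al l, ev (U := ⊤) trivial (σ (tl φ l r)) ∈ V) ∧ ∀ i, ¬ Covers (ch φ U σ l (c i) (G i)) y V := by
    refine hcon.mono fun l hl => ?_
    push Not at hl
    obtain ⟨y, V, hV, hl⟩ := hl
    obtain ⟨i, hi⟩ := hcov y
    exact ⟨i, y, V, hi, hV, hl⟩
  have h2 : ∃ i, ∃ᶠ l in atTop, ∃ (y : Y) (V : ValuationSubring (Y.residueField y)), y ∈ (c i).U ∧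
      (∀ r : Al l, ev (U := ⊤) trivial (σ (tl φ l r)) ∈ V) ∧ ∀ i, ¬ Covers (ch φ U σ l (c i) (G i)) y V := by
    by_contra h
    replace h := fun i => not_frequently.mp (not_exists.mp h i)
    exact h1 (by filter_upwards [eventually_all.mpr h] with l hl ⟨i, h'⟩ using hl i h')
  obtain ⟨i, h3⟩ := h2
  let S := {l : Finset A | ∃ (y : Y) (V : ValuationSubring (Y.residueField y)), y ∈ (c i).U ∧
      (∀ r : Al l, ev (U := ⊤) trivial (σ (tl φ l r)) ∈ V) ∧ ∀ i, ¬ Covers (ch φ U σ l (c i) (G i)) y V}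
  choose y V hy hV hnc using fun l : S => l.2
  have hne : (comap (Subtype.val : S → Finset A) atTop).NeBot := by
    rw [comap_neBot_iff_frequently]
    exact h3.mono fun l hl => ⟨⟨l, hl⟩, rfl⟩
  let 𝒰 : Ultrafilter S := Ultrafilter.of (comap Subtype.val atTop)
  have hat : ∀ {p : Finset A → Prop}, (∀ᶠ l in atTop, p l) → ∀ᶠ l : S in 𝒰, p l.1 := fun h =>
    Ultrafilter.of_le _ (h.comap _)
  have ha : ∀ a : A, ∀ᶠ l : S in 𝒰, a ∈ Al l.1 := fun a => hat (p := fun l => a ∈ Al l) (by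
    filter_upwards [eventually_ge_atTop {a}] with l hl using mem_Al (hl (Finset.mem_singleton_self a)))
  obtain ⟨F, _, W, mk, hmk, hW⟩ := exists_ultra 𝒰 (fun l => Y.residueField (y l)) V
  let γ : Γ(Y, (c i).U) →+* F := mk.comp (Pi.ringHom fun l => ev (hy l))
  let χ : A →+* F := (γ.comp (bs σ _)).comp φ
  have hev : ∀ l (a : A), ev (hy l) (bs σ (c i).U (φ a)) = ev (U := ⊤) trivial (σ (φ a)) := fun l a =>
    ev_bs σ _ _
  have hχ : ∀ a, χ a ∈ W := by
    intro a
    refine (hW _).mpr ?_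
    filter_upwards [ha a] with l hl
    have := hV l ⟨a, hl⟩
    change ev (U := ⊤) trivial (σ (φ a)) ∈ V l at this
    rw [← hev] at this
    exact this
  obtain ⟨j, h, hle, hne, H⟩ := lift_val σ c hcov g hg (locV U W χ hχ) i γ (by
    intro b
    obtain ⟨u, hu, a, e⟩ := hs b
    refine ⟨u, hu, ?_⟩
    have : χ u * γ (bs σ _ b) = χ a := by
      change γ (bs σ _ (φ u)) * _ = γ (bs σ _ (φ a))
      rw [← e, map_mul, map_mul, mul_comm]
    rw [this]; exact hχ a)
  have hh : ∀ᶠ l : S in 𝒰, y l ∈ Y.basicOpen h := by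
    have : ∀ᶠ l : S in 𝒰, ¬ ev (hy l) h = 0 := Ultrafilter.eventually_not.mpr fun h0 => hne ((hmk _).mpr h0)
    filter_upwards [this] with l hl using (ev_ne_zero _ _).mp hl
  have key : ∀ k, ∀ᶠ l : S in 𝒰, ∀ hl : y l ∈ (c j).U,
      ev hl (bs σ (c j).U (φ (wl U l.1).1) * G j k) ∈ V l := by
    intro k
    obtain ⟨d, ⟨u, hu, hd⟩, hd'⟩ := H (G j k)
    obtain ⟨N, s, e⟩ := exists_pow_mul_eq_rs (c i).hU h (rs hle (G j k))
    have e1 := hd' N s e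
    let z : ∀ l, Y.residueField (y l) := fun l => ev (hy l) (bs σ _ (φ u)) * ev (hy l) s * (ev (hy l) h ^ N)⁻¹
    have hz : mk z = χ u * d := by
      have h1 : mk z * γ h ^ N = χ u * γ s := by
        rw [← sub_eq_zero]
        change mk z * (mk _) ^ N - mk _ * mk _ = 0
        rw [← map_pow, ← map_mul, ← map_mul, ← map_sub, hmk]
        filter_upwards [hh] with l hl
        have := (ev_ne_zero (hy l) h).mpr hl
        change z l * (ev (hy l) h) ^ N - ev (hy l) (bs σ _ (φ u)) * ev (hy l) s = 0
        simp only [z]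
        field_simp
        ring
      rw [e1] at h1
      refine mul_right_cancel₀ (pow_ne_zero N hne) (h1.trans (by ring))
    have hz' : ∀ᶠ l : S in 𝒰, z l ∈ V l := (hW z).mp (hz ▸ hd)
    have hul : ∀ᶠ l : S in 𝒰, u ∈ l.1 := hat (p := fun l => u ∈ l) (by
      filter_upwards [eventually_ge_atTop {u}] with l hl using hl (Finset.mem_singleton_self u))
    filter_upwards [hz', hh, hul] with l h1 h2 h3 h4
    obtain ⟨v, hv, e2⟩ := exists_mul_eq_wl U hu h3
    have h5 := hV l ⟨v, hv⟩
    have h6 : z l = ev h4 (bs σ (c j).U (φ u)) * ev h4 (G j k) := by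
      have := (ev_ne_zero (hy l) h).mpr h2
      have e3 := congrArg (ev h2) e
      rw [map_mul, map_pow] at e3
      simp only [ev_rs] at e3
      simp only [z]
      rw [e3]
      have e4 : ev (hy l) (bs σ _ (φ u)) = ev h4 (bs σ _ (φ u)) := (ev_bs σ _ _).trans (ev_bs σ _ _).symm
      rw [e4]
      field_simp
    have h7 := mul_mem h5 h1
    rw [h6] at h7
    have e5 : ev (U := ⊤) trivial (σ (φ v)) = ev h4 (bs σ _ (φ v)) := (ev_bs σ _ _).symm
    change ev (U := ⊤) trivial (σ (φ v)) * _ ∈ V l at h7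
    rw [e5, ← mul_assoc, ← map_mul, ← map_mul, ← map_mul, ← map_mul φ, mul_comm v u, e2] at h7
    exact h7
  obtain ⟨l, hl1, hl2⟩ := (hh.and (eventually_all.mpr key)).exists
  refine hnc l j ⟨hle hl1, ?_⟩
  have : (ch φ U σ l.1 (c j) (G j)).P ≤ (V l).toSubring.comap (ev (hle hl1)) := by
    rw [Subring.closure_le]
    rintro _ (⟨r, rfl⟩ | ⟨k, rfl⟩)
    · have := hV l r
      have e5 : ev (U := ⊤) trivial (σ (tl φ l.1 r)) = ev (hle hl1) (bs σ _ (tl φ l.1 r)) := (ev_bs σ _ _).symm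
      rw [e5] at this
      exact this
    · exact hl2 k (hle hl1)
  exact this
end MM
end

section
set_option linter.all false
open AlgebraicGeometry CategoryTheory CategoryTheory.Limits Filter
namespace MM
section
variable {A B : Type u} [CommRing A] [CommRing B] 

lemma exists_pres {S : Type u} [CommRing S] (f : B →+* S) (hf : f.FinitePresentation) :
    ∃ (n : ℕ) (G : Fin n → S), Function.Surjective (MvPolynomial.eval₂Hom f G) ∧
      (RingHom.ker (MvPolynomial.eval₂Hom f G)).FG := by
  algebraize [f]
  obtain ⟨n, p, h1, h2⟩ := ‹Algebra.FinitePresentation B S›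
  have : MvPolynomial.eval₂Hom f (fun k => p (.X k)) = p.toRingHom := by
    apply MvPolynomial.ringHom_ext
    · intro b
      simp
      rfl
    · intro k; simp
  refine ⟨n, fun k => p (.X k), ?_⟩
  rw [this]
  exact ⟨h1, h2⟩

lemma closure_of_surj {S : Type u} [CommRing S] (f : B →+* S) {n : ℕ} (G : Fin n → S)
    (h : Function.Surjective (MvPolynomial.eval₂Hom f G)) : Subring.closure (Set.range f ∪ Set.range G) = ⊤ := by
  rw [eq_top_iff]
  rintro x -
  obtain ⟨p, rfl⟩ := h x
  induction p using MvPolynomial.induction_on with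
  | C b => exact Subring.subset_closure (.inl ⟨b, by simp⟩)
  | add p q h1 h2 => rw [map_add]; exact add_mem h1 h2
  | mul_X p k h => rw [map_mul]; exact mul_mem h (Subring.subset_closure (.inr ⟨k, by simp⟩))
end

variable {Y : Scheme.{u}} 
variable {A B : Type u} [CommRing A] [CommRing B] 

/-- structure map -/
noncomputable def sg (g : Y ⟶ Spec (.of B)) : B →+* Γ(Y, ⊤) := ((Scheme.ΓSpecIso (.of B)).inv ≫ g.appTop).hom

lemma sg_spec (g : Y ⟶ Spec (.of B)) (U : Y.Opens) :
    U.ι ≫ g = U.toSpecΓ ≫ Spec.map (CommRingCat.ofHom (bs (sg g) U)) := by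
  have h : g = Y.toSpecΓ ≫ Spec.map (CommRingCat.ofHom (sg g)) := by
    change g = Y.toSpecΓ ≫ Spec.map ((Scheme.ΓSpecIso (.of B)).inv ≫ g.appTop)
    rw [Spec.map_comp, ← Scheme.toSpecΓ_naturality_assoc]
    simp
  have e : CommRingCat.ofHom (bs (sg g) U) = CommRingCat.ofHom (sg g) ≫ Y.presheaf.map (homOfLE le_top).op := rfl
  rw [e, Spec.map_comp]
  conv_lhs => rw [h]
  rw [← Scheme.Opens.toSpecΓ_SpecMap_presheaf_map_top_assoc]

lemma fp_bs (g : Y ⟶ Spec (.of B)) [LocallyOfFinitePresentation g] {U : Y.Opens} (hU : IsAffineOpen U) :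
    (bs (sg g) U).FinitePresentation := by
  have h := g.finitePresentation_appLE (isAffineOpen_top _) hU le_top
  refine h.comp (f := (Scheme.ΓSpecIso (.of B)).inv.hom) (RingHom.FinitePresentation.of_bijective ?_)
  exact ConcreteCategory.bijective_of_isIso (Scheme.ΓSpecIso (.of B)).inv

theorem nagata (φ : A →+* B) (U : Submonoid A) 
    (hU : ∀ u ∈ U, IsUnit (φ u)) (hs : ∀ b, ∃ u ∈ U, ∃ a, b * φ u = φ a)
    (g : Y ⟶ Spec (.of B)) [IsProper g] [LocallyOfFinitePresentation g] :
    ∃ (X : Scheme.{u}) (f : X ⟶ Spec (.of A)) (q : Y ⟶ X), IsProper f ∧ LocallyOfFinitePresentation f ∧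
      IsPullback q g f (Spec.map (CommRingCat.ofHom φ)) := by
  have hsep : Y.IsSeparated := by
    rw [Scheme.isSeparated_iff, ← terminal.comp_from g]; infer_instance
  have hc : CompactSpace Y := (quasiCompact_iff_compactSpace (f := g)).mp inferInstance
  let σ := sg g
  have hg := sg_spec g
  let 𝒰 := Y.affineCover.finiteSubcover
  let c : 𝒰.I₀ → Chart Y := fun i => ⟨(𝒰.f i).opensRange, isAffineOpen_opensRange _, ⊤⟩
  have hcov : ∀ y, ∃ i, y ∈ (c i).U := fun y => ⟨_, 𝒰.covers y⟩
  choose n G hsurj hker using fun i => exists_pres _ (fp_bs g (c i).hU)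
  have hG := fun i => closure_of_surj _ _ (hsurj i)
  have ev1 := eventually_all.mpr fun i => eventually_all.mpr fun j =>
    ev_relU φ U σ hU hs (c i) (c j) (hG i) (hG j)
  have ev2 := eventually_all.mpr fun i => ev_bc φ U σ hU hs (c i) (G i) (hsurj i) (hker i)
  have ev3 := ev_cover φ U σ hU hs c hcov G g hg
  obtain ⟨l, h1, h2, h3⟩ := (ev1.and (ev2.and ev3)).exists
  let ρ := σ.comp (tl φ l)
  let E := Set.range fun i => ch φ U σ l (c i) (G i)
  have := Al_noeth l
  have huw : IsUnit (tl φ l (wl U l)) := hU _ (wl_mem U l)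
  have hEft : ∀ c ∈ E, FT ρ c := by
    rintro _ ⟨i, rfl⟩; exact ch_ft φ U σ l _ _
  obtain ⟨N, ⟨hNf, hNR⟩, hcl, hNc⟩ := exists_model (ρ := ρ) (w := wl U l) (huw.map σ) (E := E) (Set.finite_range _) hEft (by
    rintro _ ⟨i, rfl⟩ _ ⟨j, rfl⟩; exact h1 i j)
  have hft : ∀ c ∈ N, FT ρ c := fun c hc => (hcl c hc).ft _ _ hEft
  have hb : ∀ c ∈ N, Base ρ c := fun c hc => (hft c hc).base
  have hbc : ∀ c ∈ N, BC (tl φ l) σ c := fun c hc => Cl.bc _ _ _ huw hEft (by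
    rintro _ ⟨i, rfl⟩; exact h2 i) (hcl c hc)
  have hcovN : ∀ (y : Y) (V : ValuationSubring (Y.residueField y)), (∀ r, ev (U := ⊤) trivial (ρ r) ∈ V) →
      ∃ c ∈ N, Covers c y V := fun y V hV => by
    obtain ⟨i, hi⟩ := h3 y V hV
    exact hNc y V ⟨_, ⟨i, rfl⟩, hi⟩
  obtain ⟨X, j, j1, j2, j3, j4, j5⟩ := exists_glue (fun i : N => i.1) (fun i k => hNR _ i.2 _ k.2)
  obtain ⟨π, hπ⟩ := j5 (Spec (.of (Al l))) (fun i => Spec.map (CommRingCat.ofHom (be ρ (hb i.1 i.2)))) (by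
    intro i k
    rw [← Spec.map_comp, ← Spec.map_comp]
    congr 1
    ext r
    exact (rs_bs ρ _ r).trans (rs_bs ρ _ r).symm)
  obtain ⟨p1, p2⟩ := proper_glue ρ hNf hNR hb hft hcovN X j j1 j2 j3 j4 π hπ
  obtain ⟨q, hq⟩ := bc_glue (tl φ l) σ hNR hb hbc (fun y => by
    obtain ⟨c, hc, hy, -⟩ := hcovN y ⊤ (fun _ => trivial)
    exact ⟨c, hc, hy⟩) X j j1 j2 j3 j4 π hπ g hg
  let t : Spec (.of A) ⟶ Spec (.of (Al l)) := Spec.map (CommRingCat.ofHom (Al l).subtype)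
  have hq' : IsPullback q g π (Spec.map (CommRingCat.ofHom φ) ≫ t) := by
    have : Spec.map (CommRingCat.ofHom φ) ≫ t = Spec.map (CommRingCat.ofHom (tl φ l)) := by
      rw [← Spec.map_comp]; rfl
    rw [this]; exact hq
  refine ⟨pullback π t, pullback.snd _ _, pullback.lift q (g ≫ Spec.map (CommRingCat.ofHom φ)) (by rw [hq'.w, Category.assoc]), inferInstance, inferInstance, ?_⟩
  refine IsPullback.of_right (t := IsPullback.of_hasPullback π t) ?_ ?_
  · rw [pullback.lift_fst]; exact hq'
  · rw [pullback.lift_snd]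
end MM
end

section
set_option linter.all false
open AlgebraicGeometry CategoryTheory CategoryTheory.Limits
namespace MM
section
variable {R C : Type u} [CommRing R] [CommRing C]

lemma LocIso.isLoc {φ : R →+* C} {h : R} (H : LocIso φ h) (L : Type u) [CommRing L] (j : C →+* L)
    (hj1 : IsUnit (j (φ h))) (hj2 : ∀ z, ∃ n s, z * j (φ h) ^ n = j s)
    (hj3 : ∀ c, j c = 0 → ∃ n, φ h ^ n * c = 0) :
    letI := (j.comp φ).toAlgebra
    IsLocalization.Away h L := by
  letI := (j.comp φ).toAlgebra
  have e : ∀ r : R, algebraMap R L r = j (φ r) := fun r => rfl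
  refine ⟨?_, ?_, ?_⟩
  · rintro ⟨_, n, rfl⟩
    simp only [e, map_pow]
    exact hj1.pow n
  · intro z
    obtain ⟨n, s, hs⟩ := hj2 z
    obtain ⟨m, r, hr⟩ := H.2 s
    refine ⟨⟨r, ⟨h ^ (m + n), m + n, rfl⟩⟩, ?_⟩
    simp only [e, hr, map_mul, map_pow, ← hs]
    ring
  · intro x y hxy
    simp only [e] at hxy
    obtain ⟨n, hn⟩ := hj3 (φ x - φ y) (by simp [hxy])
    have : φ (h ^ n * (x - y)) = 0 := by simp [hn]
    obtain ⟨m, hm⟩ := H.1 _ this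
    refine ⟨⟨h ^ (m + n), m + n, rfl⟩, ?_⟩
    rw [← sub_eq_zero]
    simp only
    rw [← hm]; ring

lemma common {n : ℕ} (S : Submonoid R) (P : Fin n → R → Prop) (hP : ∀ i r t, P i r → P i (t * r))
    (h : ∀ i, ∃ s ∈ S, P i s) : ∃ s ∈ S, ∀ i, P i s := by
  choose s hs h using h
  refine ⟨∏ i, s i, Submonoid.prod_mem _ fun i _ => hs i, fun i => ?_⟩
  rw [← Finset.prod_erase_mul _ _ (Finset.mem_univ i)]
  exact hP _ _ _ (h i)

lemma alg_spread (ρ : R →+* C) (hρ : ρ.FinitePresentation) (S : Submonoid R)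
    (h1 : ∀ c, ∃ s ∈ S, ∃ a, ρ s * c = ρ a) (h2 : ∀ a, ρ a = 0 → ∃ s ∈ S, s * a = 0) :
    ∃ t ∈ S, ∀ r, LocIso ρ (r * t) := by
  obtain ⟨n, G, hG, hk⟩ := exists_pres ρ hρ
  obtain ⟨s, hs, hsa⟩ := common S (fun i s => ∃ a, ρ s * G i = ρ a)
    (fun i r t ⟨a, h⟩ => ⟨t * a, by rw [map_mul, map_mul, mul_assoc, h]⟩) (fun i => h1 (G i))
  choose a ha using hsa
  let L := Localization.Away s
  let ev : MvPolynomial (Fin n) R →+* L := MvPolynomial.eval₂Hom (algebraMap R L)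
    (fun i => algebraMap R L (a i) * IsLocalization.Away.invSelf s)
  have hinv : algebraMap R L s * IsLocalization.Away.invSelf s = 1 := IsLocalization.Away.mul_invSelf s
  have key : ∀ P, ∃ n b, algebraMap R L (s ^ n) * ev P = algebraMap R L b ∧
      ρ (s ^ n) * MvPolynomial.eval₂Hom ρ G P = ρ b := by
    intro P
    induction P using MvPolynomial.induction_on with
    | C b => exact ⟨0, b, by simp [ev], by simp⟩
    | add p q h1 h2 =>
      obtain ⟨n, b, h1, h1'⟩ := h1
      obtain ⟨m, c, h2, h2'⟩ := h2
      refine ⟨n + m, s ^ m * b + s ^ n * c, ?_, ?_⟩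
      · rw [map_add, map_add, map_mul, map_mul, ← h1, ← h2, pow_add, map_mul]; ring
      · rw [map_add, map_add, map_mul, map_mul, ← h1', ← h2', pow_add, map_mul]; ring
    | mul_X p k h =>
      obtain ⟨n, b, h1, h1'⟩ := h
      refine ⟨n + 1, b * a k, ?_, ?_⟩
      · have e : ev (.X k) = algebraMap R L (a k) * IsLocalization.Away.invSelf s := by simp [ev]
        rw [map_mul, map_mul, ← h1, e, pow_succ, map_mul]
        linear_combination (algebraMap R L (s ^ n) * ev p * algebraMap R L (a k)) * hinv
      · have e : MvPolynomial.eval₂Hom ρ G (.X k) = G k := by simp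
        rw [map_mul, map_mul, ← h1', e, pow_succ, map_mul, ← ha k]
        ring
  obtain ⟨m, F, hF⟩ := Submodule.fg_iff_exists_fin_generating_family.mp hk
  obtain ⟨t, ht, htF⟩ := common S (fun i t => algebraMap R L t * ev (F i) = 0)
    (fun i r t h => by rw [map_mul, mul_assoc, h, mul_zero]) (fun i => by
      obtain ⟨n, b, h3, h4⟩ := key (F i)
      have : F i ∈ RingHom.ker (MvPolynomial.eval₂Hom ρ G) := by
        rw [← hF]; exact Submodule.subset_span ⟨i, rfl⟩
      rw [RingHom.mem_ker] at this
      rw [this, mul_zero] at h4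
      obtain ⟨t, ht, h5⟩ := h2 b h4.symm
      refine ⟨t * s ^ n, mul_mem ht (pow_mem hs n), ?_⟩
      rw [map_mul, mul_assoc, h3, ← map_mul, h5, map_zero])
  have hker : ∀ P ∈ RingHom.ker (MvPolynomial.eval₂Hom ρ G), algebraMap R L t * ev P = 0 := by
    intro P hP
    rw [← hF] at hP
    induction hP using Submodule.span_induction with
    | mem x hx => obtain ⟨i, rfl⟩ := hx; exact htF i
    | zero => simp
    | add x y _ _ h1 h2 => rw [map_add, mul_add, h1, h2, add_zero]
    | smul a x _ h => rw [smul_eq_mul, map_mul, mul_left_comm, h, mul_zero]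
  refine ⟨t * s, mul_mem ht hs, fun r => ⟨?_, ?_⟩⟩
  · intro b hb
    have := hker (.C b) (by rw [RingHom.mem_ker]; simpa using hb)
    have e : ev (.C b) = algebraMap R L b := by simp [ev]
    rw [e, ← map_mul, ← map_zero (algebraMap R L)] at this
    obtain ⟨n, hn⟩ := IsLocalization.Away.exists_of_eq s this
    refine ⟨n + 1, ?_⟩
    rw [mul_zero] at hn
    linear_combination (r ^ (n+1) * t ^ n * s) * hn
  · intro c
    obtain ⟨P, rfl⟩ := hG c
    obtain ⟨n, b, -, h⟩ := key P
    refine ⟨n, (r * t) ^ n * b, ?_⟩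
    rw [map_mul, ← h]
    simp only [map_mul, map_pow]
    ring
end
end MM
end

section
set_option linter.all false
open AlgebraicGeometry CategoryTheory CategoryTheory.Limits
namespace MM
section
variable {R : Type u} [CommRing R] {Z : Scheme.{u}}

lemma preimage_bo (f : Z ⟶ Spec (.of R)) (r : R) :
    f ⁻¹ᵁ (PrimeSpectrum.basicOpen r : (Spec (.of R)).Opens) = Z.basicOpen (sg f r) := by
  have : (PrimeSpectrum.basicOpen r : (Spec (.of R)).Opens) =
      (Spec (.of R)).basicOpen ((Scheme.ΓSpecIso (.of R)).inv r) := (basicOpen_eq_of_affine (R := .of R) r).symm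
  rw [this, Scheme.preimage_basicOpen]
  rfl

lemma basicOpen_bs (f : Z ⟶ Spec (.of R)) (r : R) (W : Z.Opens)
    (h : f ⁻¹ᵁ (PrimeSpectrum.basicOpen r : (Spec (.of R)).Opens) ≤ W) :
    Z.basicOpen (bs (sg f) W r) = f ⁻¹ᵁ (PrimeSpectrum.basicOpen r : (Spec (.of R)).Opens) := by
  have : Z.basicOpen (bs (sg f) W r) = W ⊓ Z.basicOpen (sg f r) := basicOpen_rs le_top (sg f r)
  rw [this, ← preimage_bo, inf_eq_right.mpr h]

lemma bo_aux {W O : Z.Opens} (hW : IsAffineOpen W) (s : Γ(Z, W)) (hO : Z.basicOpen s = O) (h : O ≤ W) :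
    (∀ z, ∃ n c, z * rs h s ^ n = rs h c) ∧ (∀ c, rs h c = 0 → ∃ n, s ^ n * c = 0) := by
  subst hO
  refine ⟨fun z => ?_, fun c hc => ?_⟩
  · obtain ⟨n, c, hc⟩ := exists_pow_mul_eq_rs hW s z
    exact ⟨n, c, by rw [hc, mul_comm]⟩
  · obtain ⟨n, hn⟩ := exists_pow_mul_eq hW s c 0 (by rw [hc, map_zero])
    exact ⟨n, by simpa using hn⟩

lemma rs_bs2 (ρ : R →+* Γ(Z, ⊤)) {U W : Z.Opens} (h : W ≤ U) (r : R) : rs h (bs ρ U r) = bs ρ W r := by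
  simp [bs]

lemma isIso_of_locIso (f : Z ⟶ Spec (.of R)) (W : Z.Opens) (hW : IsAffineOpen W) (r : R)
    (hr : f ⁻¹ᵁ (PrimeSpectrum.basicOpen r : (Spec (.of R)).Opens) ≤ W)
    (H : LocIso (bs (sg f) W) r) : IsIso (f ∣_ (PrimeSpectrum.basicOpen r : (Spec (.of R)).Opens)) := by
  have hb := basicOpen_bs f r W hr
  set V : (Spec (.of R)).Opens := PrimeSpectrum.basicOpen r
  set O := f ⁻¹ᵁ V with hO
  have hOa : IsAffineOpen O := hb ▸ hW.basicOpen _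
  have hloc := H.isLoc Γ(Z, O) (rs hr)
    (by exact isUnit_rs_basicOpen _ hr hb.ge)
    (bo_aux hW _ hb hr).1 (bo_aux hW _ hb hr).2
  letI := ((rs hr).comp (bs (sg f) W)).toAlgebra
  have e1 : (rs hr).comp (bs (sg f) W) = bs (sg f) O := by ext x; simp [rs_bs2]
  have hop : IsOpenImmersion (Spec.map (CommRingCat.ofHom (algebraMap R Γ(Z, O)))) :=
    IsOpenImmersion.of_isLocalization r
  have e2 : algebraMap R Γ(Z, O) = bs (sg f) O := e1
  have hiso : IsIso O.toSpecΓ := by rw [← hOa.isoSpec_hom]; infer_instance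
  have hs := sg_spec f O
  rw [← e2] at hs
  have hop2 : IsOpenImmersion (O.ι ≫ f) := by rw [hs]; infer_instance
  have hc : f ∣_ V ≫ V.ι = O.ι ≫ f := morphismRestrict_ι f V
  have hop3 : IsOpenImmersion (f ∣_ V) := by
    have : IsOpenImmersion (f ∣_ V ≫ V.ι) := by rw [hc]; exact hop2
    exact IsOpenImmersion.of_comp _ V.ι
  have hsur : Surjective (f ∣_ V) := by
    refine ⟨fun x => ?_⟩
    have hx : V.ι x ∈ Set.range (O.ι ≫ f) := by
      rw [hs]
      have h1 : (V.ι x : PrimeSpectrum R) ∈ Set.range (PrimeSpectrum.comap (algebraMap R Γ(Z, O))) := by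
        rw [PrimeSpectrum.localization_away_comap_range _ r]
        exact x.2
      obtain ⟨q, hq⟩ := h1
      obtain ⟨y, hy⟩ := O.toSpecΓ.homeomorph.surjective q
      refine ⟨y, Eq.trans ?_ hq⟩
      rw [← hy]; rfl
    obtain ⟨y, hy⟩ := hx
    refine ⟨y, V.ι.isOpenEmbedding.injective ?_⟩
    rw [← hy, ← hc]; rfl
  exact (isIso_iff_isOpenImmersion_and_surjective _).mpr ⟨hop3, hsur⟩

lemma fromSpec_sg (f : Z ⟶ Spec (.of R)) {W : Z.Opens} (hW : IsAffineOpen W) :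
    hW.fromSpec ≫ f = Spec.map (CommRingCat.ofHom (bs (sg f) W)) := by
  rw [← cancel_epi hW.isoSpec.hom, ← Category.assoc, hW.isoSpec_hom_fromSpec, sg_spec, hW.isoSpec_hom]

lemma local_iso (f : Z ⟶ Spec (.of R)) [IsProper f] [LocallyOfFinitePresentation f] (p : Ideal R) [p.IsPrime]
    (h : Spec (.of (Localization.AtPrime p)) ⟶ Z)
    (H : IsPullback h (𝟙 _) f (Spec.map (CommRingCat.ofHom (algebraMap R (Localization.AtPrime p))))) :
    ∃ r ∉ p, IsIso (f ∣_ (PrimeSpectrum.basicOpen r : (Spec (.of R)).Opens)) := by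
  let x0 : Spec (.of R) := (⟨p, inferInstance⟩ : PrimeSpectrum R)
  let y0 : Spec (.of (Localization.AtPrime p)) := (IsLocalRing.closedPoint (Localization.AtPrime p))
  have hy0 : Spec.map (CommRingCat.ofHom (algebraMap R (Localization.AtPrime p))) y0 = x0 := by
    refine PrimeSpectrum.ext ?_
    exact Localization.AtPrime.comap_maximalIdeal
  have huniq : ∀ z, f z = x0 → z = h y0 := by
    intro z hz
    obtain ⟨y, h1, h2⟩ := Scheme.exists_preimage_of_isPullback H z y0 (by rw [hz, hy0])
    have h2 : y = y0 := h2
    rw [← h1, h2]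
  obtain ⟨W, hW, hzW, -⟩ := exists_isAffineOpen_mem_and_subset (x := h y0) (U := ⊤) trivial
  have hcl : IsClosed (f '' (W : Set Z)ᶜ) := f.isClosedMap _ W.2.isClosed_compl
  have hx0 : x0 ∈ (f '' (W : Set Z)ᶜ)ᶜ := by
    rintro ⟨z, hz, hz2⟩
    exact hz (huniq z hz2 ▸ hzW)
  obtain ⟨_, ⟨r, rfl⟩, hr, hrW⟩ := PrimeSpectrum.isTopologicalBasis_basic_opens.exists_subset_of_mem_open
    hx0 hcl.isOpen_compl
  have hrp : r ∉ p := hr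
  have hle : f ⁻¹ᵁ (PrimeSpectrum.basicOpen r : (Spec (.of R)).Opens) ≤ W := by
    intro z hz
    by_contra hzW
    exact hrW hz ⟨z, hzW, rfl⟩
  have hbo := basicOpen_bs f r W hle
  set V : (Spec (.of R)).Opens := PrimeSpectrum.basicOpen r with hV
  set W' := f ⁻¹ᵁ V
  have hW' : IsAffineOpen W' := hbo ▸ hW.basicOpen _
  have hran : Set.range h ⊆ Set.range hW'.fromSpec := by
    rw [hW'.range_fromSpec]
    rintro _ ⟨y, rfl⟩
    have e : f (h y) = Spec.map (CommRingCat.ofHom (algebraMap R (Localization.AtPrime p))) y := by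
      have := H.w
      rw [Category.id_comp] at this
      rw [← this]; rfl
    change f (h y) ∈ V
    rw [e]
    change algebraMap R (Localization.AtPrime p) r ∉ (y : PrimeSpectrum (Localization.AtPrime p)).asIdeal
    intro h4
    exact (y : PrimeSpectrum (Localization.AtPrime p)).2.ne_top (Ideal.eq_top_of_isUnit_mem _ h4
      (IsLocalization.map_units _ (⟨r, hrp⟩ : p.primeCompl)))
  obtain ⟨h', hh'⟩ : ∃ h', h' ≫ hW'.fromSpec = h := ⟨IsOpenImmersion.lift _ _ hran, IsOpenImmersion.lift_fac _ _ hran⟩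
  obtain ⟨χ, rfl⟩ := Spec.map_surjective h'
  set ρ := bs (sg f) W' with hρ
  have hfp : ρ.FinitePresentation := fp_bs f hW'
  have hχ : ∀ a, χ.hom (ρ a) = algebraMap R (Localization.AtPrime p) a := by
    have : CommRingCat.ofHom ρ ≫ χ = CommRingCat.ofHom (algebraMap R (Localization.AtPrime p)) := by
      apply Spec.map_injective
      rw [Spec.map_comp, ← fromSpec_sg f hW', reassoc_of% hh', H.w, Category.id_comp]
    intro a
    exact congr($(this).hom a)
  let M := p.primeCompl.map ρ
  let j := algebraMap Γ(Z, W') (Localization M)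
  let κ : Localization.AtPrime p →+* Localization M := IsLocalization.lift (M := p.primeCompl) (g := j.comp ρ)
    (fun y => IsLocalization.map_units _ (⟨ρ y, y, y.2, rfl⟩ : M))
  have hκ : ∀ a, κ (algebraMap _ _ a) = j (ρ a) := fun a => IsLocalization.lift_eq _ a
  have hκχ : ∀ c, κ (χ.hom c) = j c := by
    obtain ⟨l, hl1, hl2⟩ := H.exists_lift (Spec.map (CommRingCat.ofHom j) ≫ hW'.fromSpec) (Spec.map (CommRingCat.ofHom κ)) (by
      rw [Category.assoc, fromSpec_sg, ← Spec.map_comp, ← Spec.map_comp]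
      congr 1
      ext a
      exact (hκ a).symm)
    rw [Category.comp_id] at hl2
    rw [hl2, ← hh', ← Category.assoc, cancel_mono, ← Spec.map_comp] at hl1
    have := Spec.map_injective hl1
    intro c
    exact congr($(this).hom c)
  obtain ⟨t, ht, hloc⟩ := alg_spread ρ hfp p.primeCompl (by
      intro c
      obtain ⟨⟨a, s⟩, has⟩ := IsLocalization.surj p.primeCompl (χ.hom c)
      have : j (ρ s * c - ρ a) = 0 := by
        rw [map_sub, map_mul, ← hκ, ← hκ, ← hκχ, ← map_mul, mul_comm, has, sub_self]
      obtain ⟨⟨_, s', hs', rfl⟩, hm⟩ := (IsLocalization.map_eq_zero_iff M (Localization M) _).mp this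
      refine ⟨s' * s, mul_mem hs' s.2, s' * a, ?_⟩
      rw [map_mul, map_mul]
      simp only at hm
      linear_combination hm) (by
      intro a ha
      have := hχ a
      rw [ha, map_zero] at this
      obtain ⟨s, hs⟩ := (IsLocalization.map_eq_zero_iff p.primeCompl (Localization.AtPrime p) _).mp this.symm
      exact ⟨s, s.2, hs⟩)
  refine ⟨r * t, fun h5 => (Ideal.IsPrime.mem_or_mem ‹_› h5).elim hrp ht, ?_⟩
  refine isIso_of_locIso f W' hW' _ ?_ (hloc r)
  intro z hz
  change r ∉ (f z : PrimeSpectrum R).asIdeal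
  intro h6
  exact hz (Ideal.mul_mem_right _ _ h6)

end
end MM
end

section
set_option linter.all false
open AlgebraicGeometry CategoryTheory CategoryTheory.Limits
namespace MM
section
variable {R : Type u} [CommRing R] {Z : Scheme.{u}}

/-- isomorphism after base change -/
def IsoOver {X S T : Scheme.{u}} (c : X ⟶ S) (t : T ⟶ S) : Prop := ∃ h, IsPullback h (𝟙 T) c t

lemma isIso_of_two {X S T P : Scheme.{u}} {c : X ⟶ S} {t : T ⟶ S} {a : P ⟶ X} {b : P ⟶ T}
    (H : IsPullback a b c t) : IsoOver c t ↔ IsIso b := by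
  constructor
  · rintro ⟨h, hh⟩
    have : b = (IsPullback.isoIsPullback _ _ H hh).hom ≫ 𝟙 T := (IsPullback.isoIsPullback_hom_snd _ _ H hh).symm
    rw [this]; infer_instance
  · intro hb
    exact ⟨inv b ≫ a, H.of_iso (asIso b) (Iso.refl _) (Iso.refl _) (Iso.refl _) (by simp) (by simp) (by simp) (by simp)⟩

lemma isIso_snd_iff {X S T : Scheme.{u}} (c : X ⟶ S) (t : T ⟶ S) : IsIso (pullback.snd c t) ↔ IsoOver c t :=
  (isIso_of_two (IsPullback.of_hasPullback c t)).symm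

lemma isIso_restrict_iff {X S : Scheme.{u}} (c : X ⟶ S) (V : S.Opens) : IsIso (c ∣_ V) ↔ IsoOver c V.ι :=
  (isIso_of_two (isPullback_morphismRestrict c V).flip).symm

lemma IsoOver.precomp {X S T T' : Scheme.{u}} {c : X ⟶ S} {t : T ⟶ S} (H : IsoOver c t) (s : T' ⟶ T) :
    IsoOver c (s ≫ t) := by
  obtain ⟨h, hh⟩ := H
  exact ⟨_, (IsPullback.of_vert_isIso (fst := s) (snd := 𝟙 _) (f := 𝟙 _) (g := s) ⟨by simp⟩).paste_horiz hh⟩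

lemma IsoOver.of_cover {X S T : Scheme.{u}} {c : X ⟶ S} (t : T ⟶ S) {ι : Type*} (V : ι → T.Opens) (hV : iSup V = ⊤)
    (H : ∀ i, IsoOver c ((V i).ι ≫ t)) : IsoOver c t := by
  rw [← isIso_snd_iff]
  have : MorphismProperty.isomorphisms _ (pullback.snd c t) := by
    refine IsZariskiLocalAtTarget.of_iSup_eq_top V hV fun i => ?_
    have h1 := (isPullback_morphismRestrict (pullback.snd c t) (V i)).flip.paste_horiz (IsPullback.of_hasPullback c t)
    exact (isIso_of_two h1).mp (H i)
  exact this

/-- basic open -/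
def bo (r : R) : (Spec (.of R)).Opens := PrimeSpectrum.basicOpen r

lemma global_iso (f : Z ⟶ Spec (.of R)) (U : Submonoid R)
    (H : ∀ (p : Ideal R), p.IsPrime → (∀ u ∈ U, u ∉ p) →
      ∃ r ∉ p, IsoOver f (bo r).ι) :
    ∃ u ∈ U, IsoOver f (bo u).ι := by
  let J : Set R := {r | IsoOver f (bo r).ι}
  have : ∃ u ∈ U, u ∈ Ideal.span J := by
    by_contra! hcon
    obtain ⟨p, hp, hle, hd⟩ := Ideal.exists_le_prime_disjoint (Ideal.span J) U (by
      rw [Set.disjoint_left]; exact fun x h1 h2 => hcon x h2 h1)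
    obtain ⟨r, hr, hi⟩ := H p hp (fun u hu h => Set.disjoint_left.mp hd h hu)
    exact hr (hle (Ideal.subset_span hi))
  obtain ⟨u, hu, huJ⟩ := this
  refine ⟨u, hu, ?_⟩
  refine IsoOver.of_cover _ (fun r : J => (bo u).ι ⁻¹ᵁ
    bo r.1) ?_ ?_
  · rw [eq_top_iff]
    rintro x -
    rw [TopologicalSpace.Opens.mem_iSup]
    by_contra! hcon
    refine x.2 ?_
    have : Ideal.span J ≤ (x.1 : PrimeSpectrum R).asIdeal := by
      rw [Ideal.span_le]
      intro r hr
      have := hcon ⟨r, hr⟩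
      exact not_not.mp this
    exact this huJ
  · rintro ⟨r, hr⟩
    have h1 : IsoOver f (bo r).ι := hr
    rw [← morphismRestrict_ι]
    exact h1.precomp _
end
end MM
end

section
set_option linter.all false
open AlgebraicGeometry CategoryTheory CategoryTheory.Limits
namespace MM
section

lemma vn {K : Type u} [CommRing K] [IsReduced K] (hK : ∀ p : Ideal K, p.IsPrime → p.IsMaximal) (a : K) :
    ∃ v, a * a * v = a := by
  let M : Submonoid K :=
    { carrier := {y | ∃ n x, y = a ^ n * (1 - a * x)}
      one_mem' := ⟨0, 0, by simp⟩
      mul_mem' := by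
        rintro _ _ ⟨n, x, rfl⟩ ⟨m, y, rfl⟩
        exact ⟨n + m, x + y - a * x * y, by ring⟩ }
  by_cases h0 : (0 : K) ∈ M
  · obtain ⟨n, x, h⟩ := h0
    refine ⟨x, ?_⟩
    have : (a * (1 - a * x)) ^ (n + 1) = 0 := by
      rw [mul_pow]
      linear_combination (-(a * (1 - a * x) ^ n)) * h
    have := pow_eq_zero_iff (by omega) |>.mp this
    linear_combination -this
  · obtain ⟨p, hp, -, hd⟩ := Ideal.exists_le_prime_disjoint (⊥ : Ideal K) M (by
      rw [Set.disjoint_left]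
      intro x hx hM
      rw [SetLike.mem_coe, Ideal.mem_bot] at hx
      exact h0 (hx ▸ hM))
    have hm := hK p hp
    have ha : a ∉ p := fun h => Set.disjoint_left.mp hd h ⟨1, 0, by simp⟩
    obtain ⟨y, hy⟩ := hm.exists_inv ha
    obtain ⟨i, hi, hy⟩ := hy
    exfalso
    refine Set.disjoint_left.mp hd hi ⟨0, y, ?_⟩
    linear_combination hy

lemma factor {A : Type u} [CommRing A] [IsReduced A] (U : Submonoid A) {L : Type u} [CommRing L] (α : A →+* L)
    (hU : ∀ u ∈ U, IsUnit (α u))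
    (hz : ∀ a, (∀ b : Localization U, algebraMap A _ a * b = 0 → b = 0) → IsUnit (α a)) :
    ∃ θ : FractionRing (Localization U ⧸ nilradical (Localization U)) →+* L,
      ∀ a, θ (algebraMap _ _ (Ideal.Quotient.mk (nilradical (Localization U)) (algebraMap A (Localization U) a))) = α a := by
  let B := Localization U
  have hB : IsReduced B := isReduced_localizationPreserves U B inferInstance
  have hn : ∀ x ∈ nilradical B, x = 0 := fun x hx => (mem_nilradical.mp hx).eq_zero
  let β : B →+* L := IsLocalization.lift (M := U) (g := α) (fun u => hU u u.2)
  have hβ : ∀ a, β (algebraMap A B a) = α a := fun a => IsLocalization.lift_eq _ a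
  let γ : B ⧸ nilradical B →+* L := Ideal.Quotient.lift _ β (fun x hx => by rw [hn x hx, map_zero])
  have hγ : ∀ b, γ (Ideal.Quotient.mk _ b) = β b := fun b => rfl
  have hu : ∀ y : nonZeroDivisors (B ⧸ nilradical B), IsUnit (γ y) := by
    rintro ⟨y, hy⟩
    obtain ⟨b, rfl⟩ := Ideal.Quotient.mk_surjective y
    obtain ⟨⟨a, u⟩, hau⟩ := IsLocalization.surj U b
    simp only at hau
    rw [hγ]
    have h1 : IsUnit (α a) := by
      refine hz a fun x hx => ?_
      rw [← hau] at hx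
      have h2 : b * x = 0 := by
        refine (IsLocalization.map_units B u).mul_left_cancel ?_
        rw [mul_zero]; linear_combination hx
      have h3 : Ideal.Quotient.mk (nilradical B) x * Ideal.Quotient.mk (nilradical B) b = 0 := by
        rw [← map_mul, mul_comm, h2, map_zero]
      have h4 := (mem_nonZeroDivisors_iff_right.mp hy) _ h3
      exact hn _ (Ideal.Quotient.eq_zero_iff_mem.mp h4)
    rw [← hβ, ← hau, map_mul] at h1
    exact isUnit_of_mul_isUnit_left h1
  refine ⟨IsLocalization.lift (M := nonZeroDivisors (B ⧸ nilradical B)) (g := γ) hu, fun a => ?_⟩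
  rw [IsLocalization.lift_eq, hγ, hβ]

lemma fracmap {A : Type u} [CommRing A] [IsReduced A] : ∃ ψ : FractionRing A →+* FractionRing (A ⧸ nilradical A),
    ∀ a, ψ (algebraMap A _ a) = algebraMap _ _ (Ideal.Quotient.mk (nilradical A) a) := by
  have hn : ∀ x ∈ nilradical A, x = 0 := fun x hx => (mem_nilradical.mp hx).eq_zero
  refine ⟨IsLocalization.lift (M := nonZeroDivisors A)
    (g := (algebraMap (A ⧸ nilradical A) (FractionRing (A ⧸ nilradical A))).comp (Ideal.Quotient.mk (nilradical A))) ?_,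
    fun a => IsLocalization.lift_eq _ a⟩
  rintro ⟨y, hy⟩
  refine IsLocalization.map_units (M := nonZeroDivisors (A ⧸ nilradical A)) _ ⟨Ideal.Quotient.mk _ y, ?_⟩
  rw [mem_nonZeroDivisors_iff_right]
  intro x hx
  obtain ⟨x, rfl⟩ := Ideal.Quotient.mk_surjective x
  rw [← map_mul, Ideal.Quotient.eq_zero_iff_mem] at hx
  rw [mem_nonZeroDivisors_iff_right.mp hy x (hn _ hx), map_zero]

lemma IsoOver.paste {X S T P Q : Scheme.{u}} {c : X ⟶ S} {t : T ⟶ S} {a : P ⟶ X} {b : P ⟶ T}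
    (H : IsPullback a b c t) (s : Q ⟶ T) : IsoOver b s ↔ IsoOver c (s ≫ t) := by
  constructor
  · rintro ⟨h, hh⟩
    exact ⟨_, hh.paste_horiz H⟩
  · rintro ⟨h, hh⟩
    obtain ⟨l, h1, h2⟩ := H.exists_lift h s (by rw [hh.w, Category.id_comp])
    subst h1
    exact ⟨l, IsPullback.of_right hh (by rw [h2, Category.id_comp]) H⟩

lemma glue_clopen {X S : Scheme.{u}} (f : X ⟶ S) (V V' : S.Opens) (hd : V ⊓ V' = ⊥) :
    ∃ (X'' : Scheme.{u}) (c : X'' ⟶ S) (i : (f ⁻¹ᵁ V).toScheme ⟶ X'') (i' : V'.toScheme ⟶ X''),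
      IsPullback i (f ∣_ V) c V.ι ∧ IsPullback i' (𝟙 _) c V'.ι := by
  let X1 := (f ⁻¹ᵁ V).toScheme
  let X2 := V'.toScheme
  let c : X1 ⨿ X2 ⟶ S := coprod.desc ((f ⁻¹ᵁ V).ι ≫ f) V'.ι
  have hc1 : coprod.inl ≫ c = (f ⁻¹ᵁ V).ι ≫ f := coprod.inl_desc _ _
  have hc2 : coprod.inr ≫ c = V'.ι := coprod.inr_desc _ _
  have hv1 : ∀ x, c ((coprod.inl : X1 ⟶ X1 ⨿ X2) x) ∈ V := by
    intro x
    have : c ((coprod.inl : X1 ⟶ X1 ⨿ X2) x) = f ((f ⁻¹ᵁ V).ι x) := congr($hc1 x)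
    rw [this]; exact x.2
  have hv2 : ∀ x, c ((coprod.inr : X2 ⟶ X1 ⨿ X2) x) ∈ V' := by
    intro x
    have : c ((coprod.inr : X2 ⟶ X1 ⨿ X2) x) = V'.ι x := congr($hc2 x)
    rw [this]; exact x.2
  have hall : ∀ z : (X1 ⨿ X2 : Scheme.{u}), (∃ x, (coprod.inl : X1 ⟶ X1 ⨿ X2) x = z) ∨ (∃ x, (coprod.inr : X2 ⟶ X1 ⨿ X2) x = z) := by
    intro z
    have := (isCompl_range_inl_inr X1 X2).sup_eq_top
    have h : z ∈ (⊤ : Set (X1 ⨿ X2 : Scheme.{u})) := trivial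
    rw [← this] at h
    exact h
  have hno : ∀ y, y ∈ V → y ∈ V' → False := fun y h1 h2 => by
    have : y ∈ V ⊓ V' := ⟨h1, h2⟩
    rw [hd] at this; exact this
  refine ⟨X1 ⨿ X2, c, coprod.inl, coprod.inr, (IsOpenImmersion.isPullback _ _ _ _ ?_ ?_).flip,
    (IsOpenImmersion.isPullback _ _ _ _ ?_ ?_).flip⟩
  · rw [hc1]; exact (morphismRestrict_ι f V).symm
  · rw [Scheme.Opens.opensRange_ι]
    ext z
    constructor
    · intro hz
      rcases hall z with h | ⟨x, rfl⟩
      · exact h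
      · exact (hno _ hz (hv2 x)).elim
    · rintro ⟨x, rfl⟩
      exact hv1 x
  · rw [hc2, Category.id_comp]
  · rw [Scheme.Opens.opensRange_ι]
    ext z
    constructor
    · intro hz
      rcases hall z with ⟨x, rfl⟩ | h
      · exact (hno _ (hv1 x) hz).elim
      · exact h
    · rintro ⟨x, rfl⟩
      exact hv2 x

lemma local_two (P : MorphismProperty Scheme.{u}) [IsZariskiLocalAtTarget P] {X S X1 X2 : Scheme.{u}} {c : X ⟶ S}
    {V V' : S.Opens} (hcov : V ⊔ V' = ⊤) {i : X1 ⟶ X} {j : X1 ⟶ V.toScheme} {i' : X2 ⟶ X} {j' : X2 ⟶ V'.toScheme}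
    (h1 : IsPullback i j c V.ι) (h2 : IsPullback i' j' c V'.ι) (hj : P j) (hj' : P j') : P c := by
  refine IsZariskiLocalAtTarget.of_iSup_eq_top (fun b : Bool => if b then V else V') (by
    rw [iSup_bool_eq]; simpa using hcov) ?_
  rintro (b | b)
  · have h3 := (isPullback_morphismRestrict c V').flip
    have e : c ∣_ V' = (IsPullback.isoIsPullback _ _ h3 h2).hom ≫ j' := (IsPullback.isoIsPullback_hom_snd _ _ h3 h2).symm
    change P (c ∣_ V')
    rw [e]
    exact (P.cancel_left_of_respectsIso _ _).mpr hj'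
  · have h3 := (isPullback_morphismRestrict c V).flip
    have e : c ∣_ V = (IsPullback.isoIsPullback _ _ h3 h1).hom ≫ j := (IsPullback.isoIsPullback_hom_snd _ _ h3 h1).symm
    change P (c ∣_ V)
    rw [e]
    exact (P.cancel_left_of_respectsIso _ _).mpr hj
end
end MM
end

/-- Let `A` be reduced with total fraction ring `K` of Krull dimension zero, and `A`
integrally closed in `K`.  Then any M-morphism over a localization `U⁻¹A` extends to an
M-morphism over `A`. -/
theorem stmt5 {A : Type u} [CommRing A] [IsReduced A]
    (hK : ∀ p : Ideal (FractionRing A), p.IsPrime → p.IsMaximal)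
    (hic : IsIntegrallyClosedIn A (FractionRing A))
    (U : Submonoid A) {Y : Scheme.{u}}
    (g : Y ⟶ Spec (CommRingCat.of (Localization U))) (hg : IsMMorphism g) :
    ∃ (X : Scheme.{u}) (f : X ⟶ Spec (CommRingCat.of A)),
      IsMMorphism f ∧
      ∃ e : pullback f (Spec.map (CommRingCat.ofHom (algebraMap A (Localization U)))) ≅ Y,
        e.hom ≫ g =
          pullback.snd f (Spec.map (CommRingCat.ofHom (algebraMap A (Localization U)))) := by
  obtain ⟨hg1, hg2, hg3⟩ := hg
  obtain ⟨X, f, q, hf1, hf2, hq⟩ := MM.nagata (algebraMap A (Localization U)) U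
    (fun u hu => IsLocalization.map_units _ (⟨u, hu⟩ : U))
    (fun b => by
      obtain ⟨⟨a, u⟩, h⟩ := IsLocalization.surj U b
      exact ⟨u, u.2, a, h⟩) g
  set K := FractionRing A
  have hKr : _root_.IsReduced K := inferInstance
  let ι : A →+* K := algebraMap A K
  have hι : Function.Injective ι := IsFractionRing.injective A K
  let kK : Spec (.of K) ⟶ Spec (.of A) := Spec.map (CommRingCat.ofHom ι)
  have hF := (MM.IsoOver.paste hq _).mp ((MM.isIso_snd_iff _ _).mp hg3)
  have hZ := IsPullback.of_hasPullback f kK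
  set fK := pullback.snd f kK
  have : IsProper fK := inferInstance
  have : LocallyOfFinitePresentation fK := inferInstance
  obtain ⟨_, ⟨u, hu, rfl⟩, hiso⟩ := MM.global_iso fK (U.map ι) (by
    intro p hp hpU
    let L := Localization.AtPrime p
    obtain ⟨θ, hθ⟩ := MM.factor U ((algebraMap K L).comp ι)
      (fun u hu => IsLocalization.map_units L (⟨ι u, hpU _ ⟨u, hu, rfl⟩⟩ : p.primeCompl))
      (by
        intro a ha
        refine IsLocalization.map_units L (⟨ι a, fun hap => ?_⟩ : p.primeCompl)
        obtain ⟨v, hv⟩ := MM.vn hK (ι a)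
        obtain ⟨⟨n, d⟩, hnd⟩ := IsLocalization.surj (nonZeroDivisors A) (1 - ι a * v)
        have hnd : (1 - ι a * v) * ι d = ι n := hnd
        have hna : a * n = 0 := by
          apply hι
          rw [map_mul, ← hnd, map_zero]
          linear_combination (-ι d) * hv
        have hB : algebraMap A (Localization U) n = 0 := by
          apply ha
          rw [← map_mul, hna, map_zero]
        obtain ⟨u, hu⟩ := (IsLocalization.map_eq_zero_iff U _ _).mp hB
        have h1 : ι u * ι n ∈ p := by rw [← map_mul, hu, map_zero]; exact p.zero_mem
        have h2 := (hp.mem_or_mem h1).resolve_left (hpU _ ⟨u, u.2, rfl⟩)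
        rw [← hnd] at h2
        have h3 := (p.mul_unit_mem_iff_mem (IsLocalization.map_units K d)).mp h2
        refine hp.ne_top ((Ideal.eq_top_iff_one _).mpr ?_)
        have := p.add_mem h3 (p.mul_mem_right v hap)
        simpa using this)
    have h1 := hF.precomp (Spec.map (CommRingCat.ofHom θ))
    have h2 : Spec.map (CommRingCat.ofHom θ) ≫ Spec.map (totalFractionMap (Localization U)) ≫
        Spec.map (CommRingCat.ofHom (algebraMap A (Localization U))) =
        Spec.map (CommRingCat.ofHom (algebraMap K L)) ≫ kK := by
      rw [← Spec.map_comp, ← Spec.map_comp, ← Spec.map_comp]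
      congr 1
      ext a
      exact hθ a
    rw [h2, ← MM.IsoOver.paste hZ] at h1
    obtain ⟨h, hh⟩ := h1
    obtain ⟨r, hr, hri⟩ := MM.local_iso fK p h hh
    exact ⟨r, hr, (MM.isIso_restrict_iff _ _).mp hri⟩)
  rw [MM.IsoOver.paste hZ] at hiso
  obtain ⟨v, hv⟩ := MM.vn hK (ι u)
  obtain ⟨e, he⟩ : ∃ e : A, ι e = ι u * v := by
    refine (IsIntegrallyClosedIn.isIntegral_iff (R := A)).mp ⟨Polynomial.X ^ 2 - Polynomial.X, ?_, ?_⟩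
    · apply Polynomial.monic_X_pow_sub
      exact (Polynomial.degree_X_le (R := A)).trans_lt (by norm_num)
    · simp
      linear_combination v * hv
  have hee : e * e = e := hι (by rw [map_mul, he]; linear_combination v * hv)
  have heu : e * u = u := hι (by rw [map_mul, he]; linear_combination hv)
  let V := MM.bo e
  let V' := MM.bo (1 - e)
  have hd : V ⊓ V' = ⊥ := by
    rw [eq_bot_iff]
    rintro x ⟨h1, h2⟩
    have hx := (x : PrimeSpectrum A).2
    have : e * (1 - e) ∈ (x : PrimeSpectrum A).asIdeal := by
      rw [mul_sub, hee, mul_one, sub_self]; exact Ideal.zero_mem _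
    exact ((hx.mem_or_mem this).elim h1 h2).elim
  have hcov : V ⊔ V' = ⊤ := by
    rw [eq_top_iff]
    rintro x -
    by_contra hcon
    have h1 : e ∈ (x : PrimeSpectrum A).asIdeal := not_not.mp fun h => hcon (Or.inl h)
    have h2 : 1 - e ∈ (x : PrimeSpectrum A).asIdeal := not_not.mp fun h => hcon (Or.inr h)
    have := Ideal.add_mem _ h1 h2
    rw [add_sub_cancel] at this
    exact (x : PrimeSpectrum A).2.ne_top ((Ideal.eq_top_iff_one _).mpr this)
  obtain ⟨X'', c, i, i', h1, h2⟩ := MM.glue_clopen f V V' hd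
  have hres := (isPullback_morphismRestrict f V).flip
  have hkB : ∃ s, Spec.map (CommRingCat.ofHom (algebraMap A (Localization U))) = s ≫ V.ι := by
    have hran : Set.range (Spec.map (CommRingCat.ofHom (algebraMap A (Localization U)))) ⊆ Set.range V.ι := by
      rw [Scheme.Opens.range_ι]
      rintro _ ⟨y, rfl⟩
      change algebraMap A (Localization U) e ∉ (y : PrimeSpectrum (Localization U)).asIdeal
      have : algebraMap A (Localization U) e = 1 := by
        refine (IsLocalization.map_units (Localization U) (⟨u, hu⟩ : U)).mul_right_cancel ?_
        rw [← map_mul, one_mul]; simp only; rw [heu]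
      rw [this]
      exact fun h => (y : PrimeSpectrum (Localization U)).2.ne_top ((Ideal.eq_top_iff_one _).mpr h)
    exact ⟨IsOpenImmersion.lift _ _ hran, (IsOpenImmersion.lift_fac _ _ hran).symm⟩
  obtain ⟨s, hs⟩ := hkB
  have hfin : ∃ q', IsPullback q' g c (Spec.map (CommRingCat.ofHom (algebraMap A (Localization U)))) := by
    rw [hs] at hq ⊢
    obtain ⟨l, hl1, hl2⟩ := hres.exists_lift q (g ≫ s) (by rw [hq.w, Category.assoc])
    subst hl1
    exact ⟨_, (IsPullback.of_right hq hl2 hres).paste_horiz h1⟩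
  obtain ⟨q', hq'⟩ := hfin
  refine ⟨X'', c, ⟨?_, ?_, ?_⟩, hq'.isoPullback.symm, hq'.isoPullback_inv_snd⟩
  · exact MM.local_two @IsProper hcov h1 h2 (MorphismProperty.of_isPullback (P := @IsProper) hres hf1) (by infer_instance)
  · haveI : IsZariskiLocalAtTarget @LocallyOfFinitePresentation.{u} :=
      HasRingHomProperty.instIsZariskiLocalAtTarget (@LocallyOfFinitePresentation.{u})
    exact MM.local_two @LocallyOfFinitePresentation hcov h1 h2
      (MorphismProperty.of_isPullback (P := @LocallyOfFinitePresentation) hres hf2) (by infer_instance)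
  · rw [MM.isIso_snd_iff]
    obtain ⟨ψ, hψ⟩ := MM.fracmap (A := A)
    have e1 : Spec.map (totalFractionMap A) = Spec.map (CommRingCat.ofHom ψ) ≫ kK := by
      rw [← Spec.map_comp]
      congr 1
      ext a
      exact (hψ a).symm
    rw [e1]
    refine MM.IsoOver.precomp ?_ _
    refine MM.IsoOver.of_cover kK (fun b : Bool => if b then kK ⁻¹ᵁ V else kK ⁻¹ᵁ V') ?_ ?_
    · rw [iSup_bool_eq]
      change kK ⁻¹ᵁ (V ⊔ V') = ⊤
      rw [hcov]; rfl
    · rintro (b | b)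
      · change MM.IsoOver c ((kK ⁻¹ᵁ V').ι ≫ kK)
        rw [← morphismRestrict_ι]
        exact MM.IsoOver.precomp ⟨_, h2⟩ _
      · change MM.IsoOver c ((kK ⁻¹ᵁ V).ι ≫ kK)
        have e2 : kK ⁻¹ᵁ V = MM.bo (ι u) := by
          ext x
          have hx := (x : PrimeSpectrum K).2
          change ι e ∉ (x : PrimeSpectrum K).asIdeal ↔ ι u ∉ (x : PrimeSpectrum K).asIdeal
          rw [not_iff_not]
          constructor
          · intro h
            rw [← heu, map_mul]; exact Ideal.mul_mem_right _ _ h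
          · intro h
            rw [he]; exact Ideal.mul_mem_right _ _ h
        have h4 : MM.IsoOver f ((kK ⁻¹ᵁ V).ι ≫ kK) := by rw [e2]; exact hiso
        rw [← morphismRestrict_ι] at h4 ⊢
        exact (MM.IsoOver.paste h1 _).mp ((MM.IsoOver.paste hres _).mpr h4)
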